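/- There exist exactly 2 equivalence classes of maximal binary [32,11] codes satisfying the conditions (C1) and (C2) (with m = 5, n = 32), and every such maximal [32,11] code has minimum weight 12 (so a = 4 and its set of weights is {0, 12, 16, 20, 32}). -/

import Mathlib

open Finset

/-- The (Hamming) weight of a vector over `ZMod 2`. -/
def wt {ι : Type*} [Fintype ι] (x : ι → ZMod 2) : ℕ :=
  (Finset.univ.filter fun i => x i ≠ 0).card

/-- The first order Reed–Muller code `RM(1,m)`: coordinates are indexed by the
points of `F_2^m`, and the codewords are the evaluation vectors
`v ↦ a·v + b` for `a ∈ F_2^m`, `b ∈ F_2`. -/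
def RM1 (m : ℕ) : Set ((Fin m → ZMod 2) → ZMod 2) :=
  {f | ∃ (a : Fin m → ZMod 2) (b : ZMod 2), f = fun v => (∑ i, a i * v i) + b}

/-- A binary `[2^m, k]` code `C` satisfies conditions (C1) and (C2) with respect to
a positive integer `a` with `0 < a < 2^m/2`:
(C1) the set of weights of codewords of `C` is exactly
`{0, 2^m/2 - a, 2^m/2, 2^m/2 + a, 2^m}`, and
(C2) `C` contains `RM(1,m)` as a subcode. -/
def SatCond (m k a : ℕ) (C : Submodule (ZMod 2) ((Fin m → ZMod 2) → ZMod 2)) : Prop :=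
  Module.finrank (ZMod 2) C = k ∧ 0 < a ∧ a < 2 ^ m / 2 ∧
  {w : ℕ | ∃ x ∈ C, wt x = w} =
    ({0, 2 ^ m / 2 - a, 2 ^ m / 2, 2 ^ m / 2 + a, 2 ^ m} : Set ℕ) ∧
  RM1 m ⊆ (C : Set ((Fin m → ZMod 2) → ZMod 2))

/-- `Ai C i` is the number `A_i(C)` of codewords of weight `i` in `C`. -/
noncomputable def Ai {ι : Type*} [Fintype ι] (C : Set (ι → ZMod 2)) (i : ℕ) : ℕ :=
  {x ∈ C | wt x = i}.ncard

/-- The minimum (nonzero) weight of a code. -/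
noncomputable def dmin {ι : Type*} [Fintype ι] (C : Set (ι → ZMod 2)) : ℕ :=
  sInf {w : ℕ | ∃ x ∈ C, x ≠ 0 ∧ wt x = w}

/-- Two binary codes of the same length are equivalent if one is obtained from
the other by a permutation of the coordinates. -/
def CodeEquiv {ι : Type*} [Fintype ι] (C C' : Set (ι → ZMod 2)) : Prop :=
  ∃ σ : Equiv.Perm ι, C' = (fun x => x ∘ σ) '' C

/-- The dual code of a binary code. -/
def dualCode {ι : Type*} [Fintype ι] (C : Submodule (ZMod 2) (ι → ZMod 2)) :
    Submodule (ZMod 2) (ι → ZMod 2) where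
  carrier := {x | ∀ y ∈ C, ∑ i, x i * y i = 0}
  add_mem' := by
    intro x₁ x₂ h₁ h₂ y hy
    simp only [Set.mem_setOf_eq] at h₁ h₂ ⊢
    simp only [Pi.add_apply, add_mul, Finset.sum_add_distrib, h₁ y hy, h₂ y hy, add_zero]
  zero_mem' := by
    intro y hy
    simp
  smul_mem' := by
    intro c x hx y hy
    simp only [Set.mem_setOf_eq] at hx ⊢
    simp only [Pi.smul_apply, smul_eq_mul, mul_assoc, ← Finset.mul_sum, hx y hy, mul_zero]

/-- The covering radius `ρ(C) = max_x min_{c ∈ C} wt (x - c)`. -/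
noncomputable def covRad {ι : Type*} [Fintype ι] (C : Set (ι → ZMod 2)) : ℕ :=
  sSup {r : ℕ | ∃ x : ι → ZMod 2, r = sInf {w : ℕ | ∃ c ∈ C, w = wt (x - c)}}

/-- A code of length `2^m` satisfying the conditions (C1) and (C2) is maximal if it is
not properly contained in any code of length `2^m` satisfying the conditions. -/
def MaximalSat (m : ℕ) (C : Submodule (ZMod 2) ((Fin m → ZMod 2) → ZMod 2)) : Prop :=
  (∃ k a, SatCond m k a C) ∧
  ∀ D : Submodule (ZMod 2) ((Fin m → ZMod 2) → ZMod 2),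
    (∃ k a, SatCond m k a D) → C ≤ D → D = C

/-- `P` has exactly `N` equivalence classes of codes. -/
def ExactlyNClasses {m : ℕ} (N : ℕ)
    (P : Submodule (ZMod 2) ((Fin m → ZMod 2) → ZMod 2) → Prop) : Prop :=
  ∃ f : Fin N → Submodule (ZMod 2) ((Fin m → ZMod 2) → ZMod 2),
    (∀ i, P (f i)) ∧
    (∀ i j, i ≠ j →
      ¬ CodeEquiv (↑(f i) : Set ((Fin m → ZMod 2) → ZMod 2)) (↑(f j))) ∧
    ∀ C, P C → ∃ i, CodeEquiv (↑C : Set ((Fin m → ZMod 2) → ZMod 2)) (↑(f i))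

/-- A weighing matrix of order `n` and weight `k`. -/
def IsWeighing (n k : ℕ) (W : Matrix (Fin n) (Fin n) ℤ) : Prop :=
  (∀ i j, W i j = 0 ∨ W i j = 1 ∨ W i j = -1) ∧
  W * W.transpose = (k : ℤ) • (1 : Matrix (Fin n) (Fin n) ℤ)

/-- A Hadamard matrix of order `n`. -/
def IsHadamard (n : ℕ) (H : Matrix (Fin n) (Fin n) ℤ) : Prop :=
  (∀ i j, H i j = 1 ∨ H i j = -1) ∧
  H * H.transpose = (n : ℤ) • (1 : Matrix (Fin n) (Fin n) ℤ)

/-! ### Words as natural numbers -/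

/-- The binary word of length 32 whose support is given by the bits of `n`. -/
def vec (n : ℕ) : Fin 32 → ZMod 2 := fun i => if n.testBit i then 1 else 0

/-- Number of ones of a byte, by table. -/
def pc8 (n : ℕ) : ℕ :=
  Nat.land 15 (Nat.shiftRight 95125173855764218123276304889944061997689682402263585766959741291920687686033329201817409157123347502415384089435969498586180241031507595463600295898153685276653211633572815512294064538494957912327413386667662218713394765509704508661031522276467630197481635010039778342554499416459730172574551513689147646224 (Nat.mul 4 n))

/-- Number of ones among the lowest 32 bits. -/
def popc (n : ℕ) : ℕ :=
  Nat.add (Nat.add (pc8 (Nat.land 255 n)) (pc8 (Nat.land 255 (Nat.shiftRight n 8))))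
    (Nat.add (pc8 (Nat.land 255 (Nat.shiftRight n 16))) (pc8 (Nat.land 255 (Nat.shiftRight n 24))))

lemma pc8_eq : ∀ n < 256, pc8 n = ∑ i ∈ range 8, (n.testBit i).toNat := by
  decide +kernel

lemma pc8_shift (n k : ℕ) : pc8 (Nat.land 255 (Nat.shiftRight n k)) =
    ∑ i ∈ range 8, (n.testBit (k + i)).toNat := by
  have h : Nat.land 255 (Nat.shiftRight n k) = (n >>> k) % 2 ^ 8 := by
    change 255 &&& (n >>> k) = _
    rw [Nat.and_comm, show (255 : ℕ) = 2 ^ 8 - 1 from rfl, Nat.and_two_pow_sub_one_eq_mod]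
  rw [h, pc8_eq ((n >>> k) % 2 ^ 8) (Nat.mod_lt _ (by norm_num))]
  refine Finset.sum_congr rfl fun i hi => ?_
  rw [Nat.testBit_mod_two_pow, Nat.testBit_shiftRight]
  simp [Finset.mem_range.mp hi]

lemma popc_eq (n : ℕ) : popc n = ∑ i ∈ range 32, (n.testBit i).toNat := by
  have h0 := pc8_shift n 0
  have h8 := pc8_shift n 8
  have h16 := pc8_shift n 16
  have h24 := pc8_shift n 24
  have e0 : Nat.shiftRight n 0 = n := rfl
  rw [e0] at h0
  unfold popc
  rw [h0, h8, h16, h24]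
  simp only [Finset.sum_range_succ, Finset.sum_range_zero, Nat.add_eq]
  ring_nf

lemma wt_vec (n : ℕ) : wt (vec n) = popc n := by
  rw [popc_eq, Finset.sum_range, wt, Finset.card_filter]
  refine Finset.sum_congr rfl fun i _ => ?_
  unfold vec
  cases n.testBit i <;> simp

lemma vec_xor (a b : ℕ) : vec (a ^^^ b) = vec a + vec b := by
  funext i
  simp only [vec, Pi.add_apply, Nat.testBit_xor]
  cases a.testBit i <;> cases b.testBit i <;> simp
  decide

lemma vec_zero : vec 0 = 0 := by
  funext i; simp [vec]

/-- The number attached to a word. -/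
def toN (x : Fin 32 → ZMod 2) : ℕ := Nat.ofBits (fun i => decide (x i ≠ 0))

lemma toN_lt (x : Fin 32 → ZMod 2) : toN x < 2 ^ 32 := Nat.ofBits_lt_two_pow _

lemma testBit_toN (x : Fin 32 → ZMod 2) (i : Fin 32) :
    (toN x).testBit i = decide (x i ≠ 0) := by
  unfold toN
  rw [Nat.testBit_ofBits_lt _ _ i.2]

lemma zmod2_cases (a : ZMod 2) : a = 0 ∨ a = 1 := by
  revert a; decide

lemma vec_toN (x : Fin 32 → ZMod 2) : vec (toN x) = x := by
  funext i
  simp only [vec, testBit_toN]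
  rcases zmod2_cases (x i) with h | h <;> simp [h]

/-- Apply a list of positions to a word. -/
def permN : List ℕ → ℕ → ℕ
  | [], _ => 0
  | a :: l, n => Nat.add (Nat.land 1 (Nat.shiftRight n a)) (Nat.mul 2 (permN l n))

lemma testBit_permN (l : List ℕ) (n i : ℕ) (h : i < l.length) :
    (permN l n).testBit i = n.testBit l[i] := by
  induction l generalizing i with
  | nil => simp at h
  | cons a l ih =>
    have e : permN (a :: l) n = (n.testBit a).toNat + 2 * permN l n := by
      change Nat.land 1 (Nat.shiftRight n a) + 2 * permN l n = _
      congr 1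
      change 1 &&& (n >>> a) = _
      rw [Nat.and_comm, Nat.and_one_is_mod, Nat.shiftRight_eq_div_pow, Nat.toNat_testBit]
    rw [e]
    cases i with
    | zero =>
      rw [Nat.testBit_zero]
      have h1 : (a :: l)[0] = a := rfl
      rw [h1]
      generalize n.testBit a = b
      cases b <;> simp <;> omega
    | succ i =>
      rw [Nat.testBit_succ]
      have : ((n.testBit a).toNat + 2 * permN l n) / 2 = permN l n := by
        generalize n.testBit a = b
        cases b <;> simp <;> omega
      rw [this, ih i (by simpa using h)]
      simp

/-- The union of the positions of a list, as a bit mask. -/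
def maskL : List ℕ → ℕ
  | [] => 0
  | a :: l => Nat.lor (Nat.shiftLeft 1 a) (maskL l)

lemma testBit_maskL (l : List ℕ) (j : ℕ) : (maskL l).testBit j = true ↔ j ∈ l := by
  induction l with
  | nil => simp [maskL]
  | cons a l ih =>
    have : maskL (a :: l) = (1 <<< a) ||| maskL l := rfl
    rw [this, Nat.testBit_or, Bool.or_eq_true, ih, Nat.one_shiftLeft, Nat.testBit_two_pow]
    simp [eq_comm]

/-- Check that a list is a permutation of the 32 positions. -/
def permOK (l : List ℕ) : Bool := Nat.beq l.length 32 && Nat.beq (maskL l) 4294967295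

lemma exists_perm (l : List ℕ) (h : permOK l = true) :
    ∃ σ : Equiv.Perm (Fin 32), (∀ n, vec (permN l n) = vec n ∘ σ) ∧
      ∀ i : Fin 32, (σ i).1 = l.getD i.1 0 := by
  simp only [permOK, Bool.and_eq_true] at h
  have hl : l.length = 32 := Nat.eq_of_beq_eq_true h.1
  have hm : maskL l = 4294967295 := Nat.eq_of_beq_eq_true h.2
  have hmem : ∀ j, j ∈ l ↔ j < 32 := by
    intro j
    rw [← testBit_maskL, hm, show (4294967295 : ℕ) = 2 ^ 32 - 1 from rfl,
      Nat.testBit_two_pow_sub_one]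
    simp
  have hlt : ∀ i : Fin 32, l[i.1]'(by omega) < 32 := fun i =>
    (hmem _).1 (List.getElem_mem _)
  let f : Fin 32 → Fin 32 := fun i => ⟨l[i.1]'(by omega), hlt i⟩
  have hs : Function.Surjective f := by
    intro j
    obtain ⟨i, hi, hij⟩ := List.getElem_of_mem ((hmem j.1).2 j.2)
    exact ⟨⟨i, by omega⟩, Fin.ext hij⟩
  refine ⟨Equiv.ofBijective f ⟨Finite.injective_iff_surjective.2 hs, hs⟩, fun n => ?_,
    fun i => ?_⟩
  · funext i
    simp only [vec, Function.comp]
    rw [testBit_permN l n i.1 (by omega)]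
    rfl
  · rw [List.getD_eq_getElem _ _ (by omega)]
    rfl

/-- Linear combination of a list of words. -/
def xcomb : List ℕ → ℕ → ℕ
  | [], _ => 0
  | w :: ws, m => Nat.xor (cond (Nat.beq (Nat.land 1 m) 1) w 0) (xcomb ws (Nat.shiftRight m 1))

lemma vec_xcomb_mem (C : Submodule (ZMod 2) (Fin 32 → ZMod 2)) (ws : List ℕ)
    (h : ∀ w ∈ ws, vec w ∈ C) (m : ℕ) : vec (xcomb ws m) ∈ C := by
  induction ws generalizing m with
  | nil => simp [xcomb, vec_zero]
  | cons w ws ih =>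
    have e : xcomb (w :: ws) m = (cond (Nat.beq (Nat.land 1 m) 1) w 0) ^^^
      (xcomb ws (Nat.shiftRight m 1)) := rfl
    rw [e, vec_xor]
    refine C.add_mem ?_ (ih (fun w hw => h w (by simp [hw])) _)
    cases Nat.beq (Nat.land 1 m) 1
    · simp [vec_zero]
    · simpa using h w (by simp)

/-- All words obtained from a list by linear combination satisfy a test. -/
def allSpan (f : ℕ → Bool) : List ℕ → ℕ → Bool
  | [], acc => f acc
  | c :: cs, acc => allSpan f cs acc && allSpan f cs (Nat.xor acc c)

lemma allSpan_spec (f : ℕ → Bool) (cs : List ℕ) (acc : ℕ) (h : allSpan f cs acc = true)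
    (m : ℕ) : f (acc ^^^ xcomb cs m) = true := by
  induction cs generalizing acc m with
  | nil => simpa [xcomb, allSpan] using h
  | cons c cs ih =>
    simp only [allSpan, Bool.and_eq_true] at h
    have e : xcomb (c :: cs) m = (cond (Nat.beq (Nat.land 1 m) 1) c 0) ^^^
      (xcomb cs (Nat.shiftRight m 1)) := rfl
    rw [e, ← Nat.xor_assoc]
    cases Nat.beq (Nat.land 1 m) 1
    · simpa using ih _ h.1 (Nat.shiftRight m 1)
    · exact ih _ h.2 (Nat.shiftRight m 1)

/-! ### Data and kernel computations -/

/-- Standard words: the five words `u_i`, the word `t`, and the all-one word. -/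
def stdW : List ℕ := [
  765677601, 893034530, 969719844, 1106309160, 2180972592, 4294963200, 4294967295]

/-- Sums of standard words: weight of the first part (plus two) and last 20 positions. -/
def T64 : List (ℕ × ℕ) := [
  (2, 0), (2, 1048575), (8, 125523), (4, 100767), (4, 83705), (4, 53094), (4, 218026),
  (4, 236748), (4, 186933), (4, 492483), (4, 740442), (4, 270095), (4, 532464), (4, 786687),
  (4, 443706), (4, 478373), (4, 705989), (4, 754492), (4, 830549), (4, 811827), (4, 604869),
  (4, 570202), (4, 342586), (4, 294083), (4, 947808), (4, 964870), (4, 995481), (4, 861642),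
  (4, 556092), (4, 308133), (4, 778480), (4, 516111), (4, 261888), (8, 923052), (6, 136531),
  (6, 366224), (6, 350710), (6, 315497), (6, 395868), (6, 628335), (6, 612617), (6, 577686),
  (6, 658083), (6, 973514), (6, 1004373), (6, 887136), (6, 1023027), (6, 869894), (6, 839577),
  (6, 912044), (6, 682351), (6, 697865), (6, 733078), (6, 652707), (6, 420240), (6, 435958),
  (6, 470889), (6, 390492), (6, 75061), (6, 44202), (6, 161439), (6, 25548), (6, 178681),
  (6, 208998)]

/-- Basis of the words orthogonal to the standard words on the last 20 positions. -/
def colsT : List ℕ := [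
  458753, 425986, 344068, 311304, 720912, 622624, 671808, 573568, 999680, 803328, 1016832,
  821248, 921600]

/-- Bit set of the admissible keys. -/
def LB : ℕ := 3186648996983374297765908861366898464214652707953983039161414292786570071800914858208303569782641975816945125415364696429416704485277212622017032203510218738812763012110284022168802297015037374933473496502914465031086045444997930131967691678845222335313070955346263788321539707688005969786258120508764916621424616531140882681087871505268312480512358156619131152851595411602694467576732427933320875606846829159429572857767085437279048745531761623310920288269593680659524317622823143733867646471693506385781526910653295468318781221522938595923036781118136270711099912643914846664949351442896589138888012480068590593541056198329700801868125274447436311919523172191615786118214500777847707130258335087253290101317420963489060945128089310860218712735874388205404553074821452967221687108077899611177278655914935195052514569510989797537896339431662432728040098702081549132159598888121537356120101323578550264060076072743865178281376329250622407949167877130603153999716543039157747608217922667408476875383800775944825817521211590603897033921933572821967889206141451819763449000656331962619813213630418599229542971086643131070750745952726417988002938227699974092454672160398089581542639912093279980688920339831741506483520992665805755415889101266117568556058156837859744165072834667626470816203066641849749242719559299740751686709264091354199464499777735449571084972453502093478535423149107334476626979957191661753133319994667546049904128918660227814035258428062656906073859421977210203355461043093752147836833539963490261227116259551351580791393010622612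4394463498271939344198079102535574336397579905058859606146858409565950662965604595402647777542683431246147049764968360205838872031145886369327117241345914850340173773884961884090806024438659485268014241571374527664749277564508110700089642699019800481792369649495854670739232729640909952450885250503501042140246532331544751621747857372491814790282402977817178347265222092032288209060680939945836648716679734054013900370410116506293459159686965975526297392261176094345103055247065291996864791295114740087256088851711169616241489198025533043835250954638554072426812337756993160892866249672430667707923910772424334860012516410975409009461697242806879015887912200362790889058667506963048476279466222200329537681916563544599009377075294315029303488420877552001160927958223593337031376529762607628282616390725959978550558720

/-- List of the admissible keys. -/
def LL : List ℕ := [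
  342, 345, 358, 361, 363, 373, 375, 406, 422, 425, 476, 492, 598, 601, 613, 615, 618, 619,
  630, 661, 663, 666, 667, 678, 679, 681, 694, 716, 718, 734, 748, 846, 847, 861, 862, 863,
  877, 909, 910, 925, 982, 984, 996, 1000, 1012, 1079, 1123, 1126, 1129, 1132, 1143, 1171,
  1174, 1180, 1195, 1198, 1238, 1303, 1309, 1319, 1327, 1367, 1373, 1389, 1391, 1393, 1395,
  1396, 1457, 1459, 1462, 1524, 1526, 1553, 1563, 1565, 1567, 1571, 1575, 1579, 1581, 1583,
  1591, 1611, 1613, 1614, 1620, 1623, 1630, 1631, 1645, 1646, 1650, 1651, 1672, 1675, 1677,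
  1679, 1686, 1687, 1693, 1694, 1710, 1711, 1713, 1714, 1716, 1718, 1742, 1746, 1748, 1750,
  1752, 1764, 1766, 1770, 1801, 1803, 1813, 1815, 1868, 1872, 1878, 1879, 1881, 1884, 1893,
  1897, 1899, 1909, 1932, 1936, 1938, 1941, 1942, 1947, 1950, 1952, 1959, 1963, 1974, 1975,
  2012, 2014, 2102, 2105, 2147, 2151, 2156, 2157, 2166, 2169, 2172, 2195, 2204, 2218, 2222,
  2246, 2249, 2262, 2265, 2282, 2283, 2321, 2333, 2339, 2347, 2349, 2350, 2375, 2379, 2381,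
  2388, 2391, 2409, 2411, 2413, 2414, 2419, 2420, 2421, 2425, 2440, 2443, 2481, 2482, 2484,
  2486, 2488, 2489, 2510, 2513, 2514, 2516, 2520, 2530, 2531, 2534, 2537, 2538, 2540, 2545,
  2547, 2548, 2552, 2556, 2583, 2587, 2589, 2590, 2594, 2599, 2606, 2607, 2628, 2631, 2638,
  2639, 2664, 2667, 2669, 2671, 2673, 2674, 2676, 2680, 2694, 2695, 2697, 2699, 2701, 2702,
  2712, 2715, 2731, 2734, 2737, 2742, 2744, 2746, 2765, 2766, 2767, 2769, 2774, 2776, 2777,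
  2780, 2785, 2786, 2788, 2792, 2794, 2796, 2802, 2804, 2806, 2810, 2821, 2823, 2826, 2827,
  2838, 2841, 2857, 2893, 2896, 2902, 2903, 2905, 2909, 2913, 2917, 2922, 2923, 2928, 2933,
  2937, 2939, 2956, 2961, 2962, 2965, 2970, 2976, 2977, 2982, 2985, 2986, 2989, 2992, 2998,
  3001, 3004, 3016, 3019, 3020, 3022, 3028, 3029, 3032, 3034, 3052, 3053, 3118, 3119, 3179,
  3211, 3214, 3251, 3254, 3256, 3257, 3298, 3299, 3304, 3314, 3315, 3331, 3337, 3340, 3377,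
  3382, 3383, 3385, 3401, 3427, 3433, 3437, 3441, 3443, 3452, 3453, 3472, 3475, 3478, 3490,
  3491, 3496, 3499, 3536, 3542, 3545, 3548, 3561, 3563, 3587, 3591, 3596, 3597, 3606, 3609,
  3612, 3627, 3632, 3638, 3639, 3641, 3643, 3657, 3681, 3683, 3692, 3693, 3696, 3699, 3722,
  3723, 3729, 3731, 3732, 3735, 3740, 3741, 3752, 3754, 3757, 3758, 3762, 3763, 3772, 3774,
  3776, 3782, 3785, 3787, 3788, 3792, 3798, 3799, 3802, 3818, 3858, 3859, 3860, 3861, 3873,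
  3874, 3880, 3881, 3889, 3891, 3905, 3908, 3912, 3913, 3921, 3925, 3928, 3929, 3970, 3971,
  3972, 3977, 3978, 3980, 3986, 3987, 3988, 3992, 3996, 4008, 4009, 4040, 4150, 4155, 4179,
  4183, 4188, 4189, 4197, 4202, 4205, 4206, 4211, 4219, 4220, 4222, 4259, 4263, 4269, 4275,
  4278, 4284, 4294, 4299, 4309, 4311, 4314, 4315, 4326, 4327, 4371, 4381, 4382, 4383, 4385,
  4395, 4399, 4407, 4413, 4424, 4427, 4429, 4431, 4438, 4439, 4441, 4443, 4445, 4446, 4452,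
  4455, 4462, 4463, 4465, 4466, 4468, 4470, 4472, 4473, 4487, 4491, 4500, 4503, 4530, 4531,
  4533, 4537, 4557, 4558, 4562, 4563, 4564, 4566, 4572, 4577, 4578, 4582, 4585, 4593, 4595,
  4597, 4598, 4600, 4604, 4626, 4631, 4638, 4639, 4647, 4651, 4653, 4654, 4678, 4679, 4681,
  4683, 4685, 4686, 4696, 4699, 4701, 4703, 4711, 4717, 4718, 4721, 4723, 4726, 4740, 4743,
  4750, 4751, 4759, 4763, 4766, 4786, 4787, 4788, 4792, 4813, 4815, 4817, 4818, 4819, 4820,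
  4828, 4835, 4838, 4840, 4841, 4844, 4850, 4852, 4854, 4856, 4871, 4873, 4886, 4889, 4940,
  4941, 4961, 4966, 4967, 4969, 4973, 4976, 4982, 4983, 4985, 4988, 5008, 5009, 5014, 5015,
  5021, 5062, 5065, 5076, 5079, 5084, 5085, 5140, 5143, 5150, 5151, 5158, 5159, 5161, 5163,
  5181, 5183, 5191, 5195, 5197, 5198, 5201, 5211, 5213, 5215, 5219, 5223, 5227, 5230, 5231,
  5235, 5237, 5238, 5240, 5241, 5250, 5255, 5263, 5267, 5271, 5277, 5278, 5291, 5295, 5297,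
  5298, 5299, 5301, 5306, 5330, 5331, 5332, 5336, 5345, 5347, 5350, 5354, 5361, 5362, 5364,
  5366, 5379, 5387, 5390, 5397, 5405, 5415, 5421, 5425, 5431, 5435, 5446, 5449, 5451, 5456,
  5462, 5465, 5469, 5474, 5475, 5480, 5483, 5492, 5493, 5501, 5502, 5510, 5513, 5522, 5523,
  5528, 5531, 5553, 5555, 5556, 5559, 5584, 5586, 5589, 5590, 5593, 5598, 5600, 5607, 5611,
  5637, 5642, 5645, 5646, 5651, 5659, 5660, 5662, 5667, 5670, 5673, 5676, 5682, 5685, 5686,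
  5689, 5691, 5701, 5703, 5706, 5707, 5713, 5715, 5716, 5719, 5724, 5725, 5746, 5747, 5756,
  5758, 5766, 5767, 5769, 5780, 5781, 5784, 5786, 5789, 5790, 5793, 5795, 5796, 5799, 5811,
  5814, 5822, 5826, 5830, 5833, 5835, 5838, 5842, 5845, 5847, 5850, 5862, 5863, 5866, 5905,
  5906, 5908, 5910, 5912, 5913, 5922, 5923, 5925, 5929, 5937, 5939, 5940, 5955, 5956, 5958,
  5961, 5964, 5969, 5970, 5972, 5973, 5976, 5980, 5989, 5992, 5993, 6017, 6018, 6022, 6025,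
  6033, 6035, 6037, 6038, 6041, 6044, 6084, 6088, 6167, 6171, 6184, 6187, 6189, 6191, 6209,
  6219, 6221, 6223, 6231, 6235, 6237, 6238, 6242, 6247, 6254, 6255, 6257, 6258, 6260, 6262,
  6264, 6265, 6275, 6285, 6286, 6287, 6290, 6302, 6315, 6318, 6322, 6323, 6324, 6326, 6330,
  6354, 6355, 6356, 6361, 6369, 6370, 6372, 6374, 6376, 6377, 6385, 6387, 6392, 6394, 6419,
  6428, 6435, 6441, 6444, 6448, 6450, 6453, 6457, 6459, 6469, 6471, 6474, 6475, 6481, 6483,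
  6484, 6487, 6492, 6493, 6500, 6501, 6504, 6506, 6509, 6510, 6514, 6515, 6520, 6523, 6524,
  6526, 6537, 6548, 6549, 6552, 6554, 6561, 6563, 6564, 6567, 6576, 6579, 6585, 6592, 6594,
  6601, 6603, 6606, 6609, 6610, 6613, 6618, 6624, 6625, 6631, 6633, 6634, 6637, 6659, 6667,
  6668, 6670, 6726, 6729, 6736, 6739, 6742, 6745, 6754, 6755, 6760, 6763, 6764, 6766, 6790,
  6793, 6802, 6803, 6808, 6811, 6812, 6814, 6816, 6822, 6825, 6830, 6864, 6870, 6873, 6875,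
  6878, 6880, 6886, 6889, 6891, 6892, 6929, 6931, 6934, 6936, 6945, 6947, 6948, 6952, 6977,
  6978, 6979, 6984, 6988, 6994, 6996, 6998, 7001, 7004, 7009, 7012, 7016, 7017, 7041, 7043,
  7048, 7049, 7052, 7057, 7058, 7060, 7064, 7108, 7113, 7175, 7177, 7190, 7193, 7211, 7265,
  7270, 7271, 7273, 7274, 7280, 7286, 7287, 7289, 7291, 7312, 7313, 7318, 7319, 7322, 7330,
  7335, 7339, 7346, 7350, 7353, 7355, 7441, 7443, 7445, 7448, 7449, 7457, 7458, 7459, 7461,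
  7466, 7475, 7476, 7478, 7481, 7489, 7491, 7492, 7496, 7506, 7508, 7509, 7513, 7521, 7522,
  7528, 7529, 7553, 7555, 7558, 7562, 7569, 7570, 7572, 7574, 7576, 7577, 7586, 7587, 7593,
  7697, 7698, 7700, 7702, 7704, 7705, 7715, 7716, 7718, 7721, 7722, 7746, 7747, 7753, 7761,
  7762, 7764, 7768, 7777, 7779, 7809, 7810, 7812, 7814, 7816, 7817, 7827, 7830, 7832, 7834,
  7842, 7843, 7848]

/-- Orbit representatives of keys. -/
def repsL : List ℕ := [
  342, 345, 358, 406, 422, 476, 598, 615, 663, 678, 694, 1565, 1613]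

/-- Coordinate permutations preserving the standard words, with their inverses. -/
def symL : List (List ℕ × List ℕ) := [
  ([
    4, 5, 1, 0, 3, 2, 6, 7, 8, 9, 10, 11, 13, 27, 30, 29, 26, 22, 16, 15, 14, 23, 31, 25,
    24, 21, 18, 12, 28, 19, 20, 17],
   [
    3, 2, 5, 4, 0, 1, 6, 7, 8, 9, 10, 11, 27, 12, 20, 19, 18, 31, 26, 29, 30, 25, 17, 21,
    24, 23, 16, 13, 28, 15, 14, 22]),
  ([
    0, 4, 3, 1, 2, 5, 6, 7, 8, 9, 10, 11, 22, 14, 18, 27, 20, 13, 17, 26, 12, 30, 16, 31,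
    25, 24, 15, 19, 29, 28, 23, 21],
   [
    0, 3, 4, 2, 1, 5, 6, 7, 8, 9, 10, 11, 20, 17, 13, 26, 22, 18, 14, 27, 16, 31, 12, 30,
    25, 24, 19, 15, 29, 28, 21, 23]),
  ([
    2, 4, 1, 5, 3, 0, 6, 7, 8, 9, 10, 11, 29, 17, 27, 16, 31, 25, 19, 28, 21, 24, 12, 14,
    23, 22, 30, 20, 15, 13, 26, 18],
   [
    5, 2, 0, 4, 1, 3, 6, 7, 8, 9, 10, 11, 22, 29, 23, 28, 15, 13, 31, 18, 27, 20, 25, 24,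
    21, 17, 30, 14, 19, 12, 26, 16]),
  ([
    3, 5, 2, 0, 4, 1, 6, 7, 8, 9, 10, 11, 18, 26, 31, 29, 27, 20, 12, 19, 17, 21, 30, 25,
    24, 23, 13, 16, 28, 15, 22, 14],
   [
    3, 5, 2, 0, 4, 1, 6, 7, 8, 9, 10, 11, 18, 26, 31, 29, 27, 20, 12, 19, 17, 21, 30, 25,
    24, 23, 13, 16, 28, 15, 22, 14]),
  ([
    3, 1, 5, 2, 4, 0, 6, 7, 8, 9, 10, 11, 22, 19, 26, 12, 30, 13, 24, 23, 28, 15, 21, 17,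
    16, 31, 20, 29, 14, 27, 18, 25],
   [
    5, 1, 3, 0, 4, 2, 6, 7, 8, 9, 10, 11, 15, 17, 28, 21, 24, 23, 30, 13, 26, 22, 12, 19,
    18, 31, 14, 29, 20, 27, 16, 25]),
  ([
    1, 0, 5, 4, 3, 2, 6, 7, 8, 9, 10, 11, 24, 22, 25, 26, 29, 28, 20, 21, 18, 19, 13, 30,
    12, 14, 15, 31, 17, 16, 23, 27],
   [
    1, 0, 5, 4, 3, 2, 6, 7, 8, 9, 10, 11, 24, 22, 25, 26, 29, 28, 20, 21, 18, 19, 13, 30,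
    12, 14, 15, 31, 17, 16, 23, 27]),
  ([
    5, 1, 0, 3, 2, 4, 6, 7, 8, 9, 10, 11, 20, 29, 21, 28, 19, 18, 30, 13, 26, 22, 25, 24,
    23, 14, 31, 17, 15, 16, 27, 12],
   [
    2, 1, 4, 3, 5, 0, 6, 7, 8, 9, 10, 11, 31, 19, 25, 28, 29, 27, 17, 16, 12, 14, 21, 24,
    23, 22, 20, 30, 15, 13, 18, 26]),
  ([
    0, 3, 1, 5, 2, 4, 6, 7, 8, 9, 10, 11, 23, 18, 24, 19, 28, 15, 27, 14, 31, 16, 20, 21,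
    17, 26, 13, 25, 12, 30, 22, 29],
   [
    0, 2, 4, 1, 5, 3, 6, 7, 8, 9, 10, 11, 28, 26, 19, 17, 21, 24, 13, 15, 22, 23, 30, 12,
    14, 27, 25, 18, 16, 31, 29, 20]),
  ([
    0, 4, 1, 3, 5, 2, 6, 7, 8, 9, 10, 11, 29, 19, 27, 18, 31, 25, 17, 26, 12, 30, 21, 20,
    13, 15, 24, 14, 22, 23, 28, 16],
   [
    0, 2, 5, 3, 1, 4, 6, 7, 8, 9, 10, 11, 20, 24, 27, 25, 31, 18, 15, 13, 23, 22, 28, 29,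
    26, 17, 19, 14, 30, 12, 21, 16]),
  ([
    0, 2, 1, 4, 3, 5, 6, 7, 8, 9, 10, 11, 16, 18, 17, 19, 12, 14, 13, 15, 22, 23, 20, 21,
    24, 25, 27, 26, 28, 29, 31, 30],
   [
    0, 2, 1, 4, 3, 5, 6, 7, 8, 9, 10, 11, 16, 18, 17, 19, 12, 14, 13, 15, 22, 23, 20, 21,
    24, 25, 27, 26, 28, 29, 31, 30]),
  ([
    1, 5, 3, 0, 2, 4, 6, 7, 8, 9, 10, 11, 17, 15, 21, 28, 19, 12, 22, 26, 13, 30, 23, 24,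
    25, 31, 14, 20, 29, 27, 16, 18],
   [
    3, 0, 4, 2, 5, 1, 6, 7, 8, 9, 10, 11, 17, 20, 26, 13, 30, 12, 31, 16, 27, 14, 18, 22,
    23, 24, 19, 29, 15, 28, 21, 25]),
  ([
    2, 1, 4, 3, 5, 0, 6, 7, 8, 9, 10, 11, 31, 19, 25, 28, 29, 27, 17, 16, 12, 14, 21, 24,
    23, 22, 20, 30, 15, 13, 18, 26],
   [
    5, 1, 0, 3, 2, 4, 6, 7, 8, 9, 10, 11, 20, 29, 21, 28, 19, 18, 30, 13, 26, 22, 25, 24,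
    23, 14, 31, 17, 15, 16, 27, 12]),
  ([
    2, 5, 1, 3, 0, 4, 6, 7, 8, 9, 10, 11, 13, 16, 30, 17, 26, 22, 27, 20, 31, 18, 14, 12,
    19, 28, 23, 25, 21, 24, 15, 29],
   [
    4, 2, 0, 3, 5, 1, 6, 7, 8, 9, 10, 11, 23, 12, 22, 30, 13, 15, 21, 24, 19, 28, 17, 26,
    29, 27, 16, 18, 25, 31, 14, 20]),
  ([
    0, 4, 5, 2, 3, 1, 6, 7, 8, 9, 10, 11, 16, 25, 15, 24, 23, 14, 26, 17, 30, 12, 29, 28,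
    19, 18, 27, 13, 21, 20, 31, 22],
   [
    0, 5, 3, 4, 1, 2, 6, 7, 8, 9, 10, 11, 21, 27, 17, 14, 12, 19, 25, 24, 29, 28, 31, 16,
    15, 13, 18, 26, 23, 22, 20, 30]),
  ([
    2, 4, 3, 0, 5, 1, 6, 7, 8, 9, 10, 11, 18, 25, 22, 30, 13, 20, 28, 19, 24, 21, 29, 26,
    17, 16, 27, 23, 12, 14, 31, 15],
   [
    3, 5, 0, 2, 1, 4, 6, 7, 8, 9, 10, 11, 28, 16, 29, 31, 25, 24, 12, 19, 17, 21, 14, 27,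
    20, 13, 23, 26, 18, 22, 15, 30]),
  ([
    3, 2, 0, 1, 4, 5, 6, 7, 8, 9, 10, 11, 22, 31, 23, 16, 15, 13, 29, 26, 25, 30, 27, 14,
    12, 19, 20, 24, 17, 21, 18, 28],
   [
    2, 3, 1, 0, 4, 5, 6, 7, 8, 9, 10, 11, 24, 17, 23, 16, 15, 28, 30, 25, 26, 29, 12, 14,
    27, 20, 19, 22, 31, 18, 21, 13]),
  ([
    4, 2, 3, 0, 1, 5, 6, 7, 8, 9, 10, 11, 25, 18, 30, 22, 26, 29, 21, 24, 19, 28, 20, 13,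
    15, 16, 27, 12, 23, 14, 31, 17],
   [
    3, 4, 1, 2, 0, 5, 6, 7, 8, 9, 10, 11, 27, 23, 29, 24, 25, 31, 13, 20, 22, 18, 15, 28,
    19, 12, 16, 26, 21, 17, 14, 30])]

/-- The final solutions. -/
def solL : List (List ℕ) := [
  [342, 2794, 4259, 6088],
  [342, 3004, 4597, 5790],
  [358, 2669, 4639, 5195],
  [358, 2827, 4985, 5421],
  [406, 2767, 4445, 5964],
  [406, 2905, 4299, 5850],
  [422, 3762, 5425, 5992],
  [422, 3860, 5271, 5838],
  [598, 3548, 5297, 5973],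
  [598, 3978, 5379, 5863],
  [678, 2379, 5079, 5600],
  [678, 3053, 4465, 5958]]

/-- Allowed weights. -/
def okw (w : ℕ) : Bool := Nat.beq (Nat.land 1 (Nat.shiftRight 4296085505 w)) 1

/-- Conditions on the last 20 positions. -/
def okTl : List (ℕ × ℕ) → ℕ → Bool
  | [], _ => true
  | (c, m) :: l, n => okw (Nat.add c (popc (Nat.xor n m))) && okTl l n

/-- Key test. -/
def tb (k : ℕ) : Bool := Nat.beq (Nat.land 1 (Nat.shiftRight LB k)) 1

/-- Membership test. -/
def memB : List ℕ → ℕ → Bool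
  | [], _ => false
  | a :: l, n => Nat.beq a n || memB l n

/-- Normalize the last 20 positions so that bit 13 vanishes. -/
def norm20 (n : ℕ) : ℕ :=
  cond (Nat.beq (Nat.land 1 (Nat.shiftRight n 13)) 1) (Nat.xor n 1048575) n

/-- Some symmetry lowers the key. -/
def descB : List (List ℕ × List ℕ) → ℕ → Bool
  | [], _ => false
  | (l, _) :: r, n =>
    Nat.blt (Nat.land 8191 (norm20 (Nat.shiftRight
      (permN l (Nat.add 2112 (Nat.mul 4096 n))) 12))) (Nat.land 8191 n)
    || descB r n

/-- The test for the words `w_j`. -/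
def testL (n : ℕ) : Bool :=
  cond (tb (Nat.land 8191 n)) (memB repsL (Nat.land 8191 n) || descB symL n) (!(okTl T64 n))

/-- Innermost search loop. -/
def srch3 (r d b : ℕ) : List ℕ → Bool
  | [] => true
  | c :: l => (!(tb (Nat.xor b c)) || !(Nat.blt d (Nat.xor 5548 (Nat.xor r (Nat.xor b (Nat.xor c d)))))
      || !(tb (Nat.xor 5548 (Nat.xor r (Nat.xor b (Nat.xor c d)))))
      || !(tb (Nat.xor 5548 (Nat.xor b (Nat.xor c d))))
      || !(tb (Nat.xor 5548 (Nat.xor r (Nat.xor c d))))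
      || !(tb (Nat.xor 5548 (Nat.xor r (Nat.xor b d))))
      || !(tb (Nat.xor 5548 (Nat.xor r (Nat.xor b c))))
      || solL.any (fun s => s == [r, b, c, d])) && srch3 r d b l

/-- Second search loop. -/
def srch2 (r d : ℕ) : List ℕ → Bool
  | [] => true
  | b :: l => srch3 r d b l && srch2 r d l

/-- Filter a list and pass on the result in reversed order. -/
def filtK (p : ℕ → Bool) (k : List ℕ → Bool) : List ℕ → List ℕ → Bool
  | [], acc => k acc
  | a :: l, acc => cond (p a) (filtK p k l (a :: acc)) (filtK p k l acc)

/-- First search loop. -/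
def srch1 (r : ℕ) : List ℕ → Bool
  | [] => true
  | d :: l => filtK (fun c => tb (Nat.xor d c)) (srch2 r d) l [] && srch1 r l

/-- The whole search for one representative. -/
def srch0 (r : ℕ) : Bool :=
  filtK (fun b => tb (Nat.xor r b)) (srch1 r) LL []

lemma srch_all : repsL.all srch0 = true := by
  decide +kernel

lemma testL_all : allSpan testL colsT 0 = true := by
  decide +kernel

/-! ### Data for the position set of the last 20 coordinates -/

/-- Parity checks on the position set (bit 32 is the constant term). -/
def basicM : List ℕ := [
  4294967295, 2863311530, 3435973836, 4042322160, 4278255360, 4294901760, 6585616520,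
  6989848736, 7147137536, 7158235136, 7528825024, 7717571584, 7730888704, 8321560576,
  8337227776, 8573157376, 4294967297]

/-- A position (dependent) with its reduced parity check, and its combination. -/
def redM : List (ℕ × ℕ × ℕ) := [
  (7, 254, 98353), (11, 3854, 81961), (13, 13106, 69669), (14, 21844, 66083),
  (15, 4295005800, 119359), (19, 983054, 73753), (21, 3342386, 67605), (22, 5570644, 65811),
  (23, 4304797800, 108863), (25, 50529026, 66573), (26, 84215044, 65675),
  (27, 4446357000, 91327), (28, 286331152, 65607), (29, 4849799712, 72831),
  (30, 5386802240, 66559), (31, 2165774206, 65534), (0, 4294967297, 65536)]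

/-- Free positions with the corresponding basis words. -/
def colsM : List (ℕ × ℕ) := [
  (1, 2183669890), (2, 2219329668), (3, 2290649224), (4, 2422235280), (5, 2694881440),
  (6, 3233857728), (8, 2516609280), (9, 2852170240), (10, 3422604288), (12, 4026593280),
  (16, 2523463680), (17, 2863267840), (18, 3435921408), (20, 4042260480), (24, 4278190080)]

/-- A particular solution of the parity checks. -/
def M00 : ℕ := 1753251841

/-- Weight conditions. -/
def wcondM : List (ℕ × ℕ) := [
  (2, 2863311530), (2, 3435973836), (2, 1717986918), (2, 4042322160), (2, 1515870810),
  (2, 1010580540), (4, 2526451350), (2, 4278255360), (2, 1437226410), (2, 869020620),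
  (4, 2573637990), (2, 267390960), (4, 2774181210), (4, 3275539260), (4, 1771465110),
  (2, 4294901760), (2, 1431677610), (2, 859032780), (4, 2576967270), (2, 252702960),
  (4, 2779077210), (4, 3284352060), (4, 1768527510), (2, 16776960), (4, 2857719210),
  (4, 3425907660), (4, 1721342310), (4, 4027518960), (4, 1520805210), (4, 1019462460),
  (6, 2523490710)]

/-- The six model position sets. -/
def xsJ : List (List ℕ) := [
  [9, 10, 13, 14, 17, 19, 20, 22, 26, 27, 28, 29, 31, 0, 3, 5, 6, 7, 8, 16],
  [10, 9, 14, 13, 18, 19, 20, 21, 25, 27, 28, 30, 31, 0, 3, 6, 5, 7, 8, 16],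
  [12, 10, 13, 11, 20, 22, 17, 19, 26, 30, 25, 29, 31, 0, 6, 5, 3, 7, 8, 16],
  [9, 3, 13, 7, 24, 26, 20, 22, 19, 27, 21, 29, 31, 0, 10, 12, 6, 14, 1, 16],
  [24, 10, 28, 14, 17, 19, 5, 7, 11, 27, 13, 29, 31, 0, 18, 20, 6, 22, 8, 1],
  [23, 10, 19, 14, 15, 13, 20, 22, 26, 5, 28, 3, 1, 0, 29, 27, 6, 25, 8, 16]]

/-- Test of the weight conditions. -/
def okMl : List (ℕ × ℕ) → ℕ → Bool
  | [], _ => true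
  | (c, h) :: l, n => okw (Nat.add c (popc (Nat.land n h))) &&
      okw (Nat.sub (Nat.add c 20) (popc (Nat.land n h))) && okMl l n

/-- All translated positions belong to the set. -/
def allPos (M s : ℕ) : List ℕ → Bool
  | [] => true
  | x :: l => Nat.beq (Nat.land 1 (Nat.shiftRight M (Nat.xor s x))) 1 && allPos M s l

/-- The test for position sets. -/
def testM (M : ℕ) : Bool :=
  !(Nat.beq (popc M) 20) || !(okMl wcondM M) ||
    (List.range 32).any (fun s => xsJ.any (fun l => allPos M s l))

lemma testM_all : allSpan testM (colsM.map Prod.snd) M00 = true := by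
  decide +kernel

/-! ### Character sums -/

/-- The nontrivial additive character of `ZMod 2`. -/
def chi (a : ZMod 2) : ℤ := if a = 0 then 1 else -1

lemma chi_add (a b : ZMod 2) : chi (a + b) = chi a * chi b := by
  revert a b; decide

lemma chi_zero : chi 0 = 1 := rfl
lemma chi_one : chi 1 = -1 := rfl

lemma add_self2 (a : ZMod 2) : a + a = 0 := by
  revert a; decide

lemma vadd_self2 {ι : Type*} (x : ι → ZMod 2) : x + x = 0 := by
  funext i; exact add_self2 _

lemma chi_sum_wt {ι : Type*} [Fintype ι] (x : ι → ZMod 2) :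
    ∑ v, chi (x v) = (Fintype.card ι : ℤ) - 2 * (wt x : ℤ) := by
  have : ∀ v, chi (x v) = 1 - 2 * (if x v ≠ 0 then 1 else 0 : ℤ) := by
    intro v
    unfold chi
    by_cases h : x v = 0 <;> simp [h]
  simp only [this, Finset.sum_sub_distrib, ← Finset.mul_sum]
  simp [wt, Finset.card_filter]

section
variable {V : Type*} [AddCommGroup V] [Module (ZMod 2) V] [Fintype V]

lemma chi_charsum (φ : V →ₗ[ZMod 2] ZMod 2) [Decidable (φ = 0)] :
    ∑ x, chi (φ x) = if φ = 0 then (Fintype.card V : ℤ) else 0 := by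
  split_ifs with h
  · subst h
    simp [chi_zero]
  · have : ∃ y, φ y ≠ 0 := by
      by_contra hc
      push Not at hc
      exact h (LinearMap.ext hc)
    obtain ⟨y, hy⟩ := this
    have hy1 : φ y = 1 := (zmod2_cases _).resolve_left hy
    have e : ∑ x, chi (φ (x + y)) = ∑ x, chi (φ x) :=
      Equiv.sum_comp (Equiv.addRight y) (fun x => chi (φ x))
    have e2 : ∑ x, chi (φ (x + y)) = - ∑ x, chi (φ x) := by
      rw [← Finset.sum_neg_distrib]
      refine Finset.sum_congr rfl fun x _ => ?_
      rw [map_add, chi_add, hy1, chi_one]; ring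
    linarith

open Classical in
lemma chi_double {Ω : Type*} (s : Finset Ω) (L : Ω → V →ₗ[ZMod 2] ZMod 2) :
    ∑ x, ∑ ω ∈ s, chi (L ω x) = (Fintype.card V : ℤ) * ((s.filter fun ω => L ω = 0).card : ℤ) := by
  rw [Finset.sum_comm]
  simp only [chi_charsum]
  rw [← Finset.sum_filter, Finset.sum_const, nsmul_eq_mul, mul_comm]
end

section
variable {ι : Type*} [Fintype ι] (C : Submodule (ZMod 2) (ι → ZMod 2))

/-- Evaluation at a coordinate. -/
def evC (v : ι) : C →ₗ[ZMod 2] ZMod 2 := (LinearMap.proj v).comp C.subtype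

lemma evC_apply (v : ι) (x : C) : evC C v x = x.1 v := rfl

open Classical in
lemma moment2 [Fintype C] (S : Finset ι) :
    ∑ x : C, (∑ v ∈ S, chi (x.1 v)) ^ 2 = (Fintype.card C : ℤ) *
      (((S ×ˢ S).filter fun p => evC C p.1 + evC C p.2 = 0).card : ℤ) := by
  rw [← chi_double]
  refine Finset.sum_congr rfl fun x _ => ?_
  rw [sq, Finset.sum_mul_sum, Finset.sum_product]
  refine Finset.sum_congr rfl fun v _ => Finset.sum_congr rfl fun v' _ => ?_
  simp [chi_add, evC_apply]

open Classical in
lemma moment4 [Fintype C] :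
    ∑ x : C, (∑ v, chi (x.1 v)) ^ 4 = (Fintype.card C : ℤ) *
      (((univ : Finset ((ι × ι) × (ι × ι))).filter fun p =>
        (evC C p.1.1 + evC C p.1.2) + (evC C p.2.1 + evC C p.2.2) = 0).card : ℤ) := by
  rw [← chi_double]
  refine Finset.sum_congr rfl fun x _ => ?_
  have h2 : (∑ v, chi (x.1 v)) ^ 2 = ∑ p : ι × ι, chi (x.1 p.1 + x.1 p.2) := by
    rw [sq, Finset.sum_mul_sum, ← Finset.univ_product_univ, Finset.sum_product]
    refine Finset.sum_congr rfl fun v _ => Finset.sum_congr rfl fun v' _ => ?_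
    rw [chi_add]
  rw [show (4 : ℕ) = 2 * 2 from rfl, pow_mul, h2, sq, Finset.sum_mul_sum,
    ← Finset.univ_product_univ (α := ι × ι), Finset.sum_product]
  refine Finset.sum_congr rfl fun v _ => Finset.sum_congr rfl fun v' _ => ?_
  rw [← chi_add]
  rfl

lemma ev_sum_zero_iff (v w : ι) : evC C v + evC C w = 0 ↔ ∀ x ∈ C, x v = x w := by
  constructor
  · intro h x hx
    have := LinearMap.congr_fun h ⟨x, hx⟩
    simp only [LinearMap.add_apply, evC_apply, LinearMap.zero_apply] at this
    generalize x v = a at *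
    generalize x w = b at *
    revert a b; decide
  · intro h
    ext ⟨x, hx⟩
    simp only [LinearMap.add_apply, evC_apply, LinearMap.zero_apply, h x hx, add_self2]

end

lemma wt_add {ι : Type*} [Fintype ι] (x y : ι → ZMod 2) :
    wt (x + y) + 2 * wt (x * y) = wt x + wt y := by
  simp only [wt, Finset.card_filter, Finset.mul_sum, ← Finset.sum_add_distrib]
  refine Finset.sum_congr rfl fun i _ => ?_
  simp only [Pi.add_apply, Pi.mul_apply]
  rcases zmod2_cases (x i) with h | h <;> rcases zmod2_cases (y i) with h' | h' <;>
    simp [h, h', add_self2]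

lemma wt_eq_zero {ι : Type*} [Fintype ι] {x : ι → ZMod 2} : wt x = 0 ↔ x = 0 := by
  simp only [wt, Finset.card_eq_zero, Finset.filter_eq_empty_iff, Finset.mem_univ, true_implies,
    not_not]
  exact ⟨fun h => funext h, fun h i => congrFun h i⟩

lemma wt_one {ι : Type*} [Fintype ι] : wt (1 : ι → ZMod 2) = Fintype.card ι := by
  simp [wt, Finset.card_univ]

lemma wt_one_add {ι : Type*} [Fintype ι] (x : ι → ZMod 2) :
    wt (1 + x) + wt x = Fintype.card ι := by
  have h := wt_add 1 x
  rw [one_mul, wt_one] at h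
  omega

lemma wt_comp {ι κ : Type*} [Fintype ι] [Fintype κ] (e : κ ≃ ι) (x : ι → ZMod 2) :
    wt (x ∘ e) = wt x := by
  simp only [wt, Finset.card_filter, Function.comp]
  exact Equiv.sum_comp e (fun i => if x i ≠ 0 then 1 else 0)

lemma wt_le {ι : Type*} [Fintype ι] (x : ι → ZMod 2) : wt x ≤ Fintype.card ι := by
  unfold wt
  exact Finset.card_le_univ _

lemma card_code {ι : Type*} [Fintype ι] (C : Submodule (ZMod 2) (ι → ZMod 2)) [Fintype C] :
    Fintype.card C = 2 ^ Module.finrank (ZMod 2) C := by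
  have := Module.card_eq_pow_finrank (K := ZMod 2) (V := C)
  simpa [ZMod.card] using this

/-! ### Structure of codes satisfying the conditions for `m = 5` -/

/-- The index set of the coordinates. -/
abbrev K5 := Fin 5 → ZMod 2

lemma card_K5 : Fintype.card K5 = 32 := by
  simp [K5, ZMod.card]

/-- Affine functions. -/
def aff (a : K5) (b : ZMod 2) : K5 → ZMod 2 := fun v => (∑ i, a i * v i) + b

section
variable {C : Submodule (ZMod 2) (K5 → ZMod 2)} {k a : ℕ}

lemma sat_aff (h : SatCond 5 k a C) (α : K5) (b : ZMod 2) : aff α b ∈ C :=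
  h.2.2.2.2 ⟨α, b, rfl⟩

lemma sat_one (h : SatCond 5 k a C) : (1 : K5 → ZMod 2) ∈ C := by
  have := sat_aff h 0 1
  have e : aff 0 1 = 1 := by funext v; simp [aff]
  rwa [e] at this

lemma sat_wt (h : SatCond 5 k a C) (x : K5 → ZMod 2) (hx : x ∈ C) :
    wt x = 0 ∨ wt x = 16 - a ∨ wt x = 16 ∨ wt x = 16 + a ∨ wt x = 32 := by
  have h1 : wt x ∈ {w : ℕ | ∃ x ∈ C, wt x = w} := ⟨x, hx, rfl⟩
  rw [h.2.2.2.1] at h1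
  simpa using h1

lemma sat_ex (h : SatCond 5 k a C) : ∃ x ∈ C, wt x = 16 - a := by
  have h1 : 16 - a ∈ {w : ℕ | ∃ x ∈ C, wt x = w} := by
    rw [h.2.2.2.1]; simp
  exact h1

lemma sat_lt (h : SatCond 5 k a C) : 0 < a ∧ a < 16 := ⟨h.2.1, by simpa using h.2.2.1⟩

lemma sat_sep (h : SatCond 5 k a C) (v w : K5) (hvw : ∀ x ∈ C, x v = x w) : v = w := by
  funext i
  have := hvw _ (sat_aff h (Pi.single i 1) 0)
  simpa [aff, Pi.single_apply] using this

lemma W_eq (x : K5 → ZMod 2) : ∑ v, chi (x v) = 32 - 2 * (wt x : ℤ) := by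
  rw [chi_sum_wt, card_K5]; rfl

/-- Evaluation of the linear function with coefficient vector `α` at `v`. -/
def dotL (v : K5) : K5 →ₗ[ZMod 2] ZMod 2 where
  toFun α := ∑ i, α i * v i
  map_add' x y := by simp [add_mul, Finset.sum_add_distrib]
  map_smul' r x := by simp [mul_assoc, Finset.mul_sum]

lemma dotL_zero_iff (v w : K5) : dotL v + dotL w = 0 ↔ v = w := by
  constructor
  · intro h
    funext i
    have := LinearMap.congr_fun h (Pi.single i 1)
    simp [dotL, Pi.single_apply] at this
    generalize v i = a at *
    generalize w i = b at *
    revert a b; decide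
  · rintro rfl
    ext x
    simp [add_self2]

lemma parseval (c : K5 → ZMod 2) :
    ∑ α : K5, (∑ v, chi (c v + aff α 0 v)) ^ 2 = 1024 := by
  classical
  have h1 : ∀ α : K5, (∑ v, chi (c v + aff α 0 v)) ^ 2 =
      ∑ v, ∑ w, chi (c v + c w) * chi ((dotL v + dotL w) α) := by
    intro α
    rw [sq, Finset.sum_mul_sum]
    refine Finset.sum_congr rfl fun v _ => Finset.sum_congr rfl fun w _ => ?_
    have : (dotL v + dotL w) α = aff α 0 v + aff α 0 w := by
      simp [dotL, aff]
    rw [this]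
    simp only [chi_add]
    ring
  simp only [h1]
  rw [Finset.sum_comm]
  have h2 : ∀ v : K5, ∑ α : K5, ∑ w, chi (c v + c w) * chi ((dotL v + dotL w) α) = 32 := by
    intro v
    rw [Finset.sum_comm]
    simp only [← Finset.mul_sum, chi_charsum, dotL_zero_iff, card_K5]
    simp [add_self2, chi_zero]
  simp only [h2]
  rw [Finset.sum_const, Finset.card_univ, card_K5]; rfl

lemma sat_a (h : SatCond 5 k a C) : a = 4 ∨ a = 8 := by
  classical
  obtain ⟨c, hc, hwc⟩ := sat_ex h
  obtain ⟨ha0, ha⟩ := sat_lt h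
  have hp := parseval c
  have hmem : ∀ α : K5, c + aff α 0 ∈ C := fun α => C.add_mem hc (sat_aff h α 0)
  have hW : ∀ α : K5, ∑ v, chi (c v + aff α 0 v) = 32 - 2 * (wt (c + aff α 0) : ℤ) :=
    fun α => W_eq (c + aff α 0)
  have hval : ∀ α : K5, (∑ v, chi (c v + aff α 0 v)) ^ 2 = 0 ∨
      (∑ v, chi (c v + aff α 0 v)) ^ 2 = 4 * (a : ℤ) ^ 2 ∨
      (∑ v, chi (c v + aff α 0 v)) ^ 2 = 1024 := by
    intro α
    rw [hW]
    rcases sat_wt h _ (hmem α) with e | e | e | e | e <;> rw [e]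
    · right; right; norm_num
    · right; left; rw [Nat.cast_sub ha.le]; push_cast; ring
    · left; norm_num
    · right; left; push_cast; ring
    · right; right; norm_num
  have h0 : (∑ v, chi (c v + aff 0 0 v)) ^ 2 = 4 * (a : ℤ) ^ 2 := by
    rw [hW]
    have : aff 0 0 = 0 := by funext v; simp [aff]
    rw [this, add_zero, hwc, Nat.cast_sub ha.le]; push_cast; ring
  have hval' : ∀ α : K5, (∑ v, chi (c v + aff α 0 v)) ^ 2 =
      4 * (a : ℤ) ^ 2 * (if (∑ v, chi (c v + aff α 0 v)) ^ 2 = 4 * (a : ℤ) ^ 2 then 1 else 0) := by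
    intro α
    rcases hval α with e | e | e
    · rw [e]; split_ifs with e' <;> simp [e']
    · rw [e]; simp
    · exfalso
      have hne : α ≠ 0 := by
        rintro rfl
        rw [h0] at e
        have h3 : (a : ℤ) < 16 := by exact_mod_cast ha
        nlinarith
      have h2 : ∑ α ∈ ({0, α} : Finset K5), (∑ v, chi (c v + aff α 0 v)) ^ 2 ≤
          ∑ α : K5, (∑ v, chi (c v + aff α 0 v)) ^ 2 :=
        Finset.sum_le_sum_of_subset_of_nonneg (Finset.subset_univ _) (fun _ _ _ => sq_nonneg _)
      rw [Finset.sum_pair hne.symm, hp, h0, e] at h2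
      have h3 : (0 : ℤ) < a := by exact_mod_cast ha0
      nlinarith
  rw [Finset.sum_congr rfl (fun α _ => hval' α), ← Finset.mul_sum, ← Finset.sum_filter,
    Finset.sum_const, nsmul_eq_mul, mul_one] at hp
  set N := (Finset.univ.filter fun α : K5 =>
    (∑ v, chi (c v + aff α 0 v)) ^ 2 = 4 * (a : ℤ) ^ 2).card with hN
  have hN32 : N ≤ 32 := by
    rw [← card_K5]; exact Finset.card_le_univ _
  have hp' : 4 * a ^ 2 * N = 1024 := by exact_mod_cast hp
  clear_value N
  clear hp hN h0 hval' hval hwc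
  interval_cases a <;> omega

/-! #### The case `a = 4` -/

lemma triv_card {ι : Type*} [Fintype ι] [DecidableEq ι] (hι : Fintype.card ι = 32)
    (s : Finset ((ι × ι) × (ι × ι)))
    (h1 : ∀ v w, ((v, v), (w, w)) ∈ s) (h2 : ∀ v w, ((v, w), (v, w)) ∈ s)
    (h3 : ∀ v w, ((v, w), (w, v)) ∈ s) :
    3008 ≤ s.card ∧ ∀ a b c d, a ≠ b → a ≠ c → a ≠ d → ((a, b), (c, d)) ∈ s → 3009 ≤ s.card := by
  let A : Finset ((ι × ι) × (ι × ι)) := univ.image fun p : ι × ι => ((p.1, p.1), (p.2, p.2))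
  let B : Finset ((ι × ι) × (ι × ι)) := univ.offDiag.image fun p : ι × ι => ((p.1, p.2), (p.1, p.2))
  let D : Finset ((ι × ι) × (ι × ι)) := univ.offDiag.image fun p : ι × ι => ((p.1, p.2), (p.2, p.1))
  have hA : A.card = 1024 := by
    rw [Finset.card_image_of_injective]
    · simp [hι]
    · rintro ⟨a, b⟩ ⟨c, d⟩ h; simp at h; simp [h]
  have hB : B.card = 992 := by
    rw [Finset.card_image_of_injective]
    · simp [hι, Finset.offDiag_card]
    · rintro ⟨a, b⟩ ⟨c, d⟩ h; simpa using h
  have hD : D.card = 992 := by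
    rw [Finset.card_image_of_injective]
    · simp [hι, Finset.offDiag_card]
    · rintro ⟨a, b⟩ ⟨c, d⟩ h; simp at h; simp [h]
  have hAB : Disjoint A B := by
    rw [Finset.disjoint_left]
    rintro ⟨⟨a, b⟩, ⟨c, d⟩⟩ h h'
    simp [A, B] at h h'
    grind
  have hABD : Disjoint (A ∪ B) D := by
    rw [Finset.disjoint_left]
    rintro ⟨⟨a, b⟩, ⟨c, d⟩⟩ h h'
    simp [A, B, D] at h h'
    grind
  have hc : ((A ∪ B) ∪ D).card = 3008 := by
    rw [Finset.card_union_of_disjoint hABD, Finset.card_union_of_disjoint hAB, hA, hB, hD]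
  have hsub : (A ∪ B) ∪ D ⊆ s := by
    intro p hp
    simp [A, B, D] at hp
    grind
  refine ⟨hc ▸ Finset.card_le_card hsub, fun a b c d hab hac had hs => ?_⟩
  have hn : ((a, b), (c, d)) ∉ (A ∪ B) ∪ D := by
    simp [A, B, D]
    grind
  have := Finset.card_le_card (Finset.insert_subset hs hsub)
  rw [Finset.card_insert_of_notMem hn, hc] at this
  exact this

open Classical in
lemma quad_identity (h : SatCond 5 k 4 C) [Fintype C] :
    (Fintype.card C : ℤ) * (((univ : Finset ((K5 × K5) × (K5 × K5))).filter fun p =>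
        (evC C p.1.1 + evC C p.1.2) + (evC C p.2.1 + evC C p.2.2) = 0).card : ℤ) =
      2048 * (Fintype.card C : ℤ) + 1966080 := by
  rw [← moment4]
  have h2 := moment2 C univ
  have e2 : ((univ ×ˢ univ : Finset (K5 × K5)).filter fun p => evC C p.1 + evC C p.2 = 0).card
      = 32 := by
    have : ((univ ×ˢ univ : Finset (K5 × K5)).filter fun p => evC C p.1 + evC C p.2 = 0) =
        univ.image fun v : K5 => (v, v) := by
      ext ⟨v, w⟩
      simp only [mem_filter, mem_image, mem_univ, true_and, ev_sum_zero_iff, mem_product]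
      constructor
      · intro hh
        exact ⟨v, by rw [sat_sep h v w hh]⟩
      · rintro ⟨u, hu⟩ x _
        simp at hu
        rw [← hu.1, ← hu.2]
    rw [this, Finset.card_image_of_injective _ (fun a b h => (Prod.mk.inj h).1), Finset.card_univ,
      card_K5]
  rw [e2] at h2
  have h01 : (⟨0, C.zero_mem⟩ : C) ≠ ⟨1, sat_one h⟩ := by
    intro e
    have := congrArg (fun x : C => x.1 0) e
    simp at this
  have hterm : ∀ x : C, (∑ v, chi (x.1 v)) ^ 4 = 64 * (∑ v, chi (x.1 v)) ^ 2 +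
      (if x ∈ ({⟨0, C.zero_mem⟩, ⟨1, sat_one h⟩} : Finset C) then 983040 else 0) := by
    intro x
    have hx0 : wt x.1 = 0 → x = ⟨0, C.zero_mem⟩ := fun e => Subtype.ext (wt_eq_zero.1 e)
    have hx1 : wt x.1 = 32 → x = ⟨1, sat_one h⟩ := by
      intro e
      have h3 := wt_one_add x.1
      rw [e, card_K5] at h3
      have h4 : wt (1 + x.1) = 0 := by omega
      rw [wt_eq_zero] at h4
      refine Subtype.ext ?_
      have h5 : x.1 = 1 + (1 + x.1) := by rw [← add_assoc, vadd_self2, zero_add]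
      rw [h4, add_zero] at h5
      exact h5
    have hn : wt x.1 ≠ 0 → wt x.1 ≠ 32 →
        x ∉ ({⟨0, C.zero_mem⟩, ⟨1, sat_one h⟩} : Finset C) := by
      intro h0 h32 hm
      simp only [mem_insert, mem_singleton] at hm
      rcases hm with e | e
      · apply h0; rw [e]; exact wt_eq_zero.2 rfl
      · apply h32; rw [e, wt_one, card_K5]
    rw [W_eq]
    rcases sat_wt h x.1 x.2 with e | e | e | e | e
    · rw [if_pos (by rw [hx0 e]; simp), e]; norm_num
    · rw [if_neg (hn (by omega) (by omega)), e]; norm_num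
    · rw [if_neg (hn (by omega) (by omega)), e]; norm_num
    · rw [if_neg (hn (by omega) (by omega)), e]; norm_num
    · rw [if_pos (by rw [hx1 e]; simp), e]; norm_num
  rw [Finset.sum_congr rfl (fun x _ => hterm x), Finset.sum_add_distrib, ← Finset.mul_sum, h2,
    Finset.sum_ite_mem, Finset.univ_inter, Finset.sum_const, Finset.card_pair h01]
  ring

lemma sat4_k_le (h : SatCond 5 k 4 C) : k ≤ 11 := by
  classical
  have : Fintype C := Fintype.ofFinite C
  have hq := quad_identity h
  have ht := (triv_card card_K5 ((univ : Finset ((K5 × K5) × (K5 × K5))).filter fun p =>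
        (evC C p.1.1 + evC C p.1.2) + (evC C p.2.1 + evC C p.2.2) = 0)
        (by intro v w; simp; ext x; simp [add_self2])
        (by intro v w; simp; ext x; simp [add_self2])
        (by intro v w; simp; ext x; simp [add_self2, evC_apply, add_comm (x.1 v)])).1
  have hc := card_code C
  rw [h.1] at hc
  by_contra hk
  have h12 : 2 ^ 12 ≤ Fintype.card C := by
    rw [hc]; exact Nat.pow_le_pow_right (by norm_num) (by omega)
  have ht' : (3008 : ℤ) ≤ ((((univ : Finset ((K5 × K5) × (K5 × K5))).filter fun p =>
        (evC C p.1.1 + evC C p.1.2) + (evC C p.2.1 + evC C p.2.2) = 0)).card : ℤ) := by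
    exact_mod_cast ht
  have h12' : (4096 : ℤ) ≤ (Fintype.card C : ℤ) := by exact_mod_cast h12
  nlinarith

lemma sat4_dual (h : SatCond 5 11 4 C) (Z : Finset K5) (hZ : ∀ x ∈ C, ∑ i ∈ Z, x i = 0) :
    Z = ∅ ∨ 6 ≤ Z.card := by
  classical
  have : Fintype C := Fintype.ofFinite C
  have hq := quad_identity h
  have ht := (triv_card card_K5 ((univ : Finset ((K5 × K5) × (K5 × K5))).filter fun p =>
        (evC C p.1.1 + evC C p.1.2) + (evC C p.2.1 + evC C p.2.2) = 0)
        (by intro v w; simp; ext x; simp [add_self2])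
        (by intro v w; simp; ext x; simp [add_self2])
        (by intro v w; simp; ext x; simp [add_self2, evC_apply, add_comm (x.1 v)])).2
  have hc := card_code C
  rw [h.1] at hc
  rw [hc] at hq
  by_contra hcon
  push Not at hcon
  obtain ⟨hne, hlt⟩ := hcon
  have hev : (Z.card : ZMod 2) = 0 := by
    have := hZ 1 (sat_one h)
    simpa using this
  have hev2 : 2 ∣ Z.card := (ZMod.natCast_eq_zero_iff _ _).1 hev
  have hpos : 0 < Z.card := Finset.card_pos.2 hne
  have h24 : Z.card = 2 ∨ Z.card = 4 := by omega
  rcases h24 with e | e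
  · obtain ⟨v, w, hvw, rfl⟩ := Finset.card_eq_two.1 e
    refine hvw (sat_sep h v w fun x hx => ?_)
    have := hZ x hx
    rw [Finset.sum_pair hvw] at this
    generalize x v = a at *
    generalize x w = b at *
    revert a b; decide
  · obtain ⟨p, q, r, s, h1, h2, h3, h4, h5, h6, rfl⟩ := Finset.card_eq_four.1 e
    have h7 := ht p q r s h1 h2 h3 (by
      simp only [mem_filter, mem_univ, true_and]
      ext ⟨x, hx⟩
      have := hZ x hx
      rw [Finset.sum_insert (by simp [*]), Finset.sum_insert (by simp [*]),
        Finset.sum_pair h6] at this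
      simp only [LinearMap.add_apply, evC_apply, LinearMap.zero_apply]
      rw [← this]; ring)
    have h7' : (3009 : ℤ) ≤ ((((univ : Finset ((K5 × K5) × (K5 × K5))).filter fun p =>
        (evC C p.1.1 + evC C p.1.2) + (evC C p.2.1 + evC C p.2.2) = 0)).card : ℤ) := by
      exact_mod_cast h7
    rw [show (((2 ^ 11 : ℕ)) : ℤ) = 2048 by norm_num] at hq
    linarith
end

/-! #### The case `a = 8` -/

section
variable {ι : Type*} [Fintype ι] (C : Submodule (ZMod 2) (ι → ZMod 2))

open Classical in
lemma moment2tw [Fintype C] (S : Finset ι) (p q : ι) :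
    ∑ x : C, (∑ v ∈ S, chi (x.1 v)) ^ 2 * chi (x.1 p + x.1 q) = (Fintype.card C : ℤ) *
      (((S ×ˢ S).filter fun r => evC C r.1 + evC C r.2 = evC C p + evC C q).card : ℤ) := by
  have hh : ∀ r : ι × ι, evC C r.1 + evC C r.2 = evC C p + evC C q ↔
      (evC C r.1 + evC C r.2) + (evC C p + evC C q) = 0 := by
    intro r
    have h2 : (evC C p + evC C q) + (evC C p + evC C q) = 0 := by
      ext x; simp only [LinearMap.add_apply]; exact add_self2 _
    constructor
    · intro e; rw [e, h2]
    · intro e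
      have := congrArg (· + (evC C p + evC C q)) e
      simpa [add_assoc, h2] using this
  simp only [hh]
  rw [← chi_double (V := C) (S ×ˢ S) (fun r => (evC C r.1 + evC C r.2) + (evC C p + evC C q))]
  refine Finset.sum_congr rfl fun x _ => ?_
  rw [sq, Finset.sum_mul_sum, Finset.sum_product, Finset.sum_mul]
  refine Finset.sum_congr rfl fun v _ => ?_
  rw [Finset.sum_mul]
  refine Finset.sum_congr rfl fun v' _ => ?_
  simp only [LinearMap.add_apply, evC_apply, chi_add]
end

/-- A counting contradiction used for `a = 8`. -/
lemma class_contra {ι M : Type*} [DecidableEq ι] [DecidableEq M] [AddCommGroup M] (T : Finset ι) (hT : T.card = 24)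
    (f : ι → M) (h2 : ∀ i, f i + f i = 0)
    (hlo : 64 ≤ ((T ×ˢ T).filter fun r => f r.1 + f r.2 = 0).card)
    (hhi : ((T ×ˢ T).filter fun r => f r.1 + f r.2 = 0).card ≤ 72)
    (h8 : ∀ p ∈ T, ∀ q ∈ T, f p ≠ f q →
      ((T ×ˢ T).filter fun r => f r.1 + f r.2 = f p + f q).card ≤ 8) : False := by
  have hz : ∀ a b, f a + f b = 0 ↔ f b = f a := by
    intro a b
    constructor
    · intro e
      have := congrArg (f a + ·) e
      simpa [← add_assoc, h2] using this
    · intro e; rw [e, h2]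
  let s : ι → ℕ := fun p => (T.filter fun v => f v = f p).card
  have hN : ((T ×ˢ T).filter fun r => f r.1 + f r.2 = 0).card = ∑ p ∈ T, s p := by
    simp only [hz, Finset.card_filter, Finset.sum_product, s]
  rw [hN] at hlo hhi
  have hex : ∃ p ∈ T, 3 ≤ s p := by
    by_contra hc
    push Not at hc
    have : ∑ p ∈ T, s p ≤ ∑ p ∈ T, 2 := Finset.sum_le_sum fun p hp => by
      have := hc p hp; omega
    rw [Finset.sum_const, hT] at this
    simp at this
    omega
  obtain ⟨p, hp, hsp⟩ := hex
  have hprod : ∀ q ∈ T, f q ≠ f p → 2 * (s p * s q) ≤ 8 := by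
    intro q hq hne
    refine le_trans ?_ (h8 p hp q hq (Ne.symm hne))
    let A := (T.filter fun v => f v = f p) ×ˢ (T.filter fun v => f v = f q)
    let B := (T.filter fun v => f v = f q) ×ˢ (T.filter fun v => f v = f p)
    have hd : Disjoint A B := by
      rw [Finset.disjoint_left]
      rintro ⟨a, b⟩ ha hb
      simp [A, B] at ha hb
      exact hne (hb.1.2.symm.trans ha.1.2)
    have hc : (A ∪ B).card = 2 * (s p * s q) := by
      rw [Finset.card_union_of_disjoint hd, Finset.card_product, Finset.card_product]
      simp only [s]; ring
    rw [← hc]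
    refine Finset.card_le_card ?_
    rintro ⟨a, b⟩ hab
    simp only [A, B, mem_union, mem_product, mem_filter] at hab ⊢
    rcases hab with h | h
    · exact ⟨⟨h.1.1, h.2.1⟩, by rw [h.1.2, h.2.2]⟩
    · exact ⟨⟨h.1.1, h.2.1⟩, by rw [h.1.2, h.2.2, add_comm]⟩
  by_cases hall : ∀ q ∈ T, f q = f p
  · have h24 : ∀ q ∈ T, s q = 24 := by
      intro q hq
      simp only [s]
      rw [Finset.filter_true_of_mem, hT]
      intro v hv
      rw [hall v hv, hall q hq]
    rw [Finset.sum_congr rfl h24, Finset.sum_const, hT] at hhi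
    simp at hhi
  · push Not at hall
    obtain ⟨q, hq, hqp⟩ := hall
    have hsq : 1 ≤ s q := Finset.card_pos.2 ⟨q, by simp [hq]⟩
    have hsp4 : s p ≤ 4 := by
      have := hprod q hq hqp
      nlinarith
    have hle : ∀ q ∈ T, s q ≤ 1 + (if f q = f p then 3 else 0) := by
      intro q hq
      split_ifs with e
      · have : s q = s p := by simp only [s, e]
        omega
      · have := hprod q hq e
        by_contra hcon
        have h2 : 2 ≤ s q := by omega
        nlinarith
    have h1 := Finset.sum_le_sum hle
    rw [Finset.sum_add_distrib, ← Finset.sum_filter, Finset.sum_const, Finset.sum_const, hT] at h1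
    have : (T.filter fun q => f q = f p).card ≤ 4 := hsp4
    simp at h1
    omega

/-- Words of `C` that are constant on `S`. -/
def constOn {ι : Type*} (C : Submodule (ZMod 2) (ι → ZMod 2)) (S : Finset ι) :
    Submodule (ZMod 2) (ι → ZMod 2) where
  carrier := {x | x ∈ C ∧ ∀ i ∈ S, ∀ j ∈ S, x i = x j}
  add_mem' := by
    rintro x y ⟨hx, hx'⟩ ⟨hy, hy'⟩
    exact ⟨C.add_mem hx hy, fun i hi j hj => by simp [hx' i hi j hj, hy' i hi j hj]⟩
  zero_mem' := ⟨C.zero_mem, fun _ _ _ _ => rfl⟩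
  smul_mem' := by
    rintro r x ⟨hx, hx'⟩
    exact ⟨C.smul_mem r hx, fun i hi j hj => by simp [hx' i hi j hj]⟩

lemma mem_constOn {ι : Type*} {C : Submodule (ZMod 2) (ι → ZMod 2)} {S : Finset ι} {x : ι → ZMod 2} :
    x ∈ constOn C S ↔ x ∈ C ∧ ∀ i ∈ S, ∀ j ∈ S, x i = x j := Iff.rfl

lemma chi_sum_S {ι : Type*} (S : Finset ι) (x : ι → ZMod 2) :
    ∑ v ∈ S, chi (x v) = (S.card : ℤ) - 2 * ((S.filter fun v => x v ≠ 0).card : ℤ) := by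
  have : ∀ v, chi (x v) = 1 - 2 * (if x v ≠ 0 then 1 else 0 : ℤ) := by
    intro v
    unfold chi
    by_cases h : x v = 0 <;> simp [h]
  simp only [this, Finset.sum_sub_distrib, ← Finset.mul_sum]
  simp [Finset.card_filter]

lemma no_a8 {C : Submodule (ZMod 2) (K5 → ZMod 2)} (h : SatCond 5 11 8 C) : False := by
  classical
  have iC : Fintype C := Fintype.ofFinite C
  obtain ⟨c, hc, hwc⟩ := sat_ex h
  norm_num at hwc
  set S : Finset K5 := univ.filter fun i => c i ≠ 0 with hS
  have hScard : S.card = 8 := hwc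
  set T : Finset K5 := univ.filter fun i => ¬ c i ≠ 0 with hT
  have hTcard : T.card = 24 := by
    have := Finset.card_filter_add_card_filter_not (s := (univ : Finset K5)) (fun i => c i ≠ 0)
    rw [Finset.card_univ, card_K5] at this
    change S.card + T.card = 32 at this
    omega
  have hw8 : ∀ x ∈ C, 8 ∣ wt x := by
    intro x hx
    rcases sat_wt h x hx with e | e | e | e | e <;> rw [e] <;> norm_num
  -- intersection with S
  have hcut : ∀ x : K5 → ZMod 2, wt (c * x) = (S.filter fun v => x v ≠ 0).card := by
    intro x
    rw [wt, hS, Finset.filter_filter]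
    congr 1
    ext i
    simp [Pi.mul_apply]
  have hsplit : ∀ x : K5 → ZMod 2, wt x = (S.filter fun v => x v ≠ 0).card +
      (T.filter fun v => x v ≠ 0).card := by
    intro x
    rw [hS, hT, Finset.filter_filter, Finset.filter_filter]
    have := Finset.card_filter_add_card_filter_not (s := (univ.filter fun i => x i ≠ 0))
      (fun i => c i ≠ 0)
    rw [Finset.filter_filter, Finset.filter_filter] at this
    rw [wt, ← this]
    congr 2 <;> (ext i; simp only [mem_filter, mem_univ, true_and]; tauto)
  have h4 : ∀ x ∈ C, 4 ∣ (S.filter fun v => x v ≠ 0).card := by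
    intro x hx
    have h1 := wt_add c x
    rw [hcut, hwc] at h1
    have h2 := hw8 _ (C.add_mem hc hx)
    have h3 := hw8 _ hx
    omega
  have hle8 : ∀ x : K5 → ZMod 2, (S.filter fun v => x v ≠ 0).card ≤ 8 := by
    intro x; rw [← hScard]; exact Finset.card_filter_le _ _
  set D := constOn C S with hD
  have iD : Fintype D := Fintype.ofFinite D
  -- membership in D by count
  have hDmem : ∀ x ∈ C, (S.filter fun v => x v ≠ 0).card ≠ 4 → x ∈ D := by
    intro x hx hne
    have h1 := h4 x hx
    have h2 := hle8 x
    have h3 : (S.filter fun v => x v ≠ 0).card = 0 ∨ (S.filter fun v => x v ≠ 0).card = 8 := by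
      omega
    refine ⟨hx, fun i hi j hj => ?_⟩
    rcases h3 with e | e
    · rw [Finset.card_eq_zero, Finset.filter_eq_empty_iff] at e
      have e1 := e hi
      have e2 := e hj
      push Not at e1 e2
      rw [e1, e2]
    · have h5 : (S.filter fun v => x v ≠ 0) = S :=
        Finset.eq_of_subset_of_card_le (Finset.filter_subset _ _) (by rw [e, hScard])
      have e1 : i ∈ S.filter fun v => x v ≠ 0 := by rw [h5]; exact hi
      have e2 : j ∈ S.filter fun v => x v ≠ 0 := by rw [h5]; exact hj
      rw [mem_filter] at e1 e2
      rw [(zmod2_cases _).resolve_left e1.2, (zmod2_cases _).resolve_left e2.2]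
  -- size of D
  have hcardC : Fintype.card C = 2048 := by
    rw [card_code, h.1]
    norm_num
  have hDcard : 256 ≤ Fintype.card D := by
    have hm := moment2 C S
    have hlow : 8 ≤ ((S ×ˢ S).filter fun p => evC C p.1 + evC C p.2 = 0).card := by
      have : S.image (fun v => (v, v)) ⊆
          (S ×ˢ S).filter fun p => evC C p.1 + evC C p.2 = 0 := by
        intro p hp
        simp only [mem_image] at hp
        obtain ⟨v, hv, rfl⟩ := hp
        simp only [mem_filter, mem_product, hv, and_self, true_and]
        rw [ev_sum_zero_iff]; intros; rfl
      have h1 := Finset.card_le_card this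
      rwa [Finset.card_image_of_injective _ (fun a b h => (Prod.mk.inj h).1), hScard] at h1
    have hterm : ∀ x : C, (∑ v ∈ S, chi (x.1 v)) ^ 2 ≤ 64 * (if x.1 ∈ D then 1 else 0 : ℤ) := by
      intro x
      rw [chi_sum_S, hScard]
      split_ifs with hx
      · have := hle8 x.1
        have h1 : ((S.filter fun v => x.1 v ≠ 0).card : ℤ) ≤ 8 := by exact_mod_cast this
        have h2 : (0 : ℤ) ≤ ((S.filter fun v => x.1 v ≠ 0).card : ℤ) := by positivity
        push_cast
        nlinarith
      · have : (S.filter fun v => x.1 v ≠ 0).card = 4 := by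
          by_contra hne
          exact hx (hDmem x.1 x.2 hne)
        rw [this]; norm_num
    have hs := Finset.sum_le_sum (fun x (_ : x ∈ (univ : Finset C)) => hterm x)
    rw [hm, ← Finset.mul_sum, ← Finset.sum_filter, Finset.sum_const, nsmul_eq_mul, mul_one,
      hcardC] at hs
    have hcc : (univ.filter fun x : C => x.1 ∈ D).card ≤ Fintype.card D := by
      rw [← Fintype.card_subtype]
      refine Fintype.card_le_of_injective (fun x => ⟨x.1.1, x.2⟩) ?_
      intro x y hxy
      have hxy' := Subtype.mk.inj hxy
      exact Subtype.ext (Subtype.ext hxy')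
    have hlow' : (8 : ℤ) ≤ (((S ×ˢ S).filter fun p => evC C p.1 + evC C p.2 = 0).card : ℤ) := by
      exact_mod_cast hlow
    have hcc' : ((univ.filter fun x : C => x.1 ∈ D).card : ℤ) ≤ Fintype.card D := by
      exact_mod_cast hcc
    push_cast at hs
    have : (256 : ℤ) ≤ Fintype.card D := by linarith
    exact_mod_cast this
  -- weights on T
  have hTw : ∀ x ∈ D, 8 ∣ (T.filter fun v => x v ≠ 0).card := by
    intro x hx
    have h1 := hw8 x hx.1
    have h2 := hsplit x
    have h3 : (S.filter fun v => x v ≠ 0).card = 0 ∨ (S.filter fun v => x v ≠ 0).card = 8 := by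
      by_cases he : ∃ i ∈ S, x i ≠ 0
      · right
        obtain ⟨i, hi, hxi⟩ := he
        rw [Finset.filter_true_of_mem, hScard]
        intro j hj
        rw [← hx.2 i hi j hj]; exact hxi
      · left
        push Not at he
        rw [Finset.card_eq_zero, Finset.filter_eq_empty_iff]
        intro j hj
        simp [he j hj]
    omega
  -- words that are constant on both parts
  let E : Finset D := univ.filter fun x => ∀ i ∈ T, ∀ j ∈ T, x.1 i = x.1 j
  have hE : E.card ≤ 4 := by
    obtain ⟨i0, hi0⟩ : S.Nonempty := Finset.card_pos.1 (by omega)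
    obtain ⟨j0, hj0⟩ : T.Nonempty := Finset.card_pos.1 (by omega)
    have : E.card ≤ (univ : Finset (ZMod 2 × ZMod 2)).card := by
      refine Finset.card_le_card_of_injOn (fun x => (x.1 i0, x.1 j0)) (fun _ _ => mem_univ _) ?_
      intro x hx y hy hxy
      have hx' := (mem_filter.1 (mem_coe.1 hx)).2
      have hy' := (mem_filter.1 (mem_coe.1 hy)).2
      simp only [Prod.mk.injEq] at hxy
      refine Subtype.ext (funext fun i => ?_)
      by_cases hi : c i ≠ 0
      · have hi' : i ∈ S := by simp [hS, hi]
        rw [x.2.2 i hi' i0 hi0, y.2.2 i hi' i0 hi0, hxy.1]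
      · have hi' : i ∈ T := by simpa [hT] using hi
        rw [hx' i hi' j0 hj0, hy' i hi' j0 hj0, hxy.2]
    simpa using this
  have hsq : ∀ x : D, (∑ v ∈ T, chi (x.1 v)) ^ 2 = 64 + (if x ∈ E then 512 else 0) := by
    intro x
    have h1 := hTw x.1 x.2
    have h2 : (T.filter fun v => x.1 v ≠ 0).card ≤ 24 := by
      rw [← hTcard]; exact Finset.card_filter_le _ _
    rw [chi_sum_S, hTcard]
    by_cases hx : x ∈ E
    · rw [if_pos hx]
      have hx' := (mem_filter.1 hx).2
      by_cases he : ∃ i ∈ T, x.1 i ≠ 0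
      · obtain ⟨i, hi, hxi⟩ := he
        rw [Finset.filter_true_of_mem, hTcard]
        · norm_num
        · intro j hj
          rw [← hx' i hi j hj]; exact hxi
      · push Not at he
        rw [Finset.filter_false_of_mem]
        · norm_num
        · intro j hj; simp [he j hj]
    · rw [if_neg hx]
      have hcase : (T.filter fun v => x.1 v ≠ 0).card = 8 ∨
          (T.filter fun v => x.1 v ≠ 0).card = 16 := by
        have h0 : (T.filter fun v => x.1 v ≠ 0).card ≠ 0 := by
          intro e
          rw [Finset.card_eq_zero, Finset.filter_eq_empty_iff] at e
          apply hx
          simp only [E, mem_filter, mem_univ, true_and]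
          intro i hi j hj
          have e1 := e hi
          have e2 := e hj
          push Not at e1 e2
          rw [e1, e2]
        have h24 : (T.filter fun v => x.1 v ≠ 0).card ≠ 24 := by
          intro e
          have h5 : (T.filter fun v => x.1 v ≠ 0) = T :=
            Finset.eq_of_subset_of_card_le (Finset.filter_subset _ _) (by rw [e, hTcard])
          apply hx
          simp only [E, mem_filter, mem_univ, true_and]
          intro i hi j hj
          have e1 : i ∈ T.filter fun v => x.1 v ≠ 0 := by rw [h5]; exact hi
          have e2 : j ∈ T.filter fun v => x.1 v ≠ 0 := by rw [h5]; exact hj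
          rw [mem_filter] at e1 e2
          rw [(zmod2_cases _).resolve_left e1.2, (zmod2_cases _).resolve_left e2.2]
        omega
      rcases hcase with e | e <;> rw [e] <;> norm_num
  -- the counts
  have key : ∀ p q, (Fintype.card D : ℤ) *
      (((T ×ˢ T).filter fun r => evC D r.1 + evC D r.2 = evC D p + evC D q).card : ℤ) =
      64 * (if evC D p + evC D q = 0 then (Fintype.card D : ℤ) else 0) +
        512 * ∑ x ∈ E, chi (x.1 p + x.1 q) := by
    intro p q
    rw [← moment2tw, ← chi_charsum (evC D p + evC D q), Finset.mul_sum, Finset.mul_sum,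
      ← Finset.univ_inter E, ← Finset.sum_ite_mem, ← Finset.sum_add_distrib]
    refine Finset.sum_congr rfl fun x _ => ?_
    rw [hsq]
    simp only [LinearMap.add_apply, evC_apply]
    split_ifs <;> ring
  have hEb : ∀ p q, 512 * ∑ x ∈ E, chi (x.1 p + x.1 q) ≤ 2048 := by
    intro p q
    have : ∑ x ∈ E, chi (x.1 p + x.1 q) ≤ ∑ x ∈ E, 1 := Finset.sum_le_sum fun x _ => by
      generalize x.1 p + x.1 q = b
      revert b; decide
    rw [Finset.sum_const] at this
    have h2 : (E.card : ℤ) ≤ 4 := by exact_mod_cast hE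
    simp at this
    linarith
  have hDc' : (256 : ℤ) ≤ Fintype.card D := by exact_mod_cast hDcard
  have hself : ∀ i, evC D i + evC D i = 0 := by
    intro i; ext x; simp [add_self2]
  have h00 : ∃ p : K5, True := ⟨0, trivial⟩
  have key0 := key 0 0
  have hEb0 := hEb 0 0
  simp only [hself, if_true, add_self2, chi_zero, Finset.sum_const] at key0 hEb0
  refine class_contra T hTcard (evC D) hself ?_ ?_ ?_
  · have : (64 : ℤ) ≤ (((T ×ˢ T).filter fun r => evC D r.1 + evC D r.2 = 0).card : ℤ) := by
      have h3 : (0 : ℤ) ≤ 512 * E.card • 1 := by positivity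
      nlinarith
    exact_mod_cast this
  · have : (((T ×ˢ T).filter fun r => evC D r.1 + evC D r.2 = 0).card : ℤ) ≤ 72 := by
      by_contra hcon
      push Not at hcon
      nlinarith
    exact_mod_cast this
  · intro p _ q _ hpq
    have hk := key p q
    have hb := hEb p q
    have hne : evC D p + evC D q ≠ 0 := by
      rw [Ne, ev_sum_zero_iff]
      intro hx
      exact hpq (LinearMap.ext fun x => hx x.1 x.2)
    rw [if_neg hne] at hk
    have : (((T ×ˢ T).filter fun r => evC D r.1 + evC D r.2 = evC D p + evC D q).card : ℤ) ≤ 8 := by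
      by_contra hcon
      push Not at hcon
      nlinarith
    exact_mod_cast this

/-! #### Consequences -/

section
variable {C : Submodule (ZMod 2) (K5 → ZMod 2)} {a : ℕ}

lemma sat11_a (h : SatCond 5 11 a C) : a = 4 := by
  rcases sat_a h with e | e
  · exact e
  · subst e; exact (no_a8 h).elim

lemma sat11_max (h : SatCond 5 11 a C) : MaximalSat 5 C := by
  have ha := sat11_a h
  subst ha
  refine ⟨⟨11, 4, h⟩, ?_⟩
  rintro D ⟨k', a', hD⟩ hCD
  have ha' : a' = 4 := by
    obtain ⟨x, hx, hxw⟩ := sat_ex h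
    norm_num at hxw
    have := sat_wt hD x (hCD hx)
    rcases sat_a hD with e | e
    · exact e
    · omega
  subst ha'
  have hk := sat4_k_le hD
  refine (Submodule.eq_of_le_of_finrank_le hCD ?_).symm
  rw [hD.1, h.1]; exact hk

lemma sat11_weights (h : SatCond 5 11 a C) :
    {w : ℕ | ∃ x ∈ C, wt x = w} = ({0, 12, 16, 20, 32} : Set ℕ) := by
  have ha := sat11_a h
  subst ha
  exact h.2.2.2.1

lemma sat11_dmin (h : SatCond 5 11 a C) : dmin (C : Set (K5 → ZMod 2)) = 12 := by
  have ha := sat11_a h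
  subst ha
  obtain ⟨x, hx, hxw⟩ := sat_ex h
  norm_num at hxw
  refine le_antisymm (Nat.sInf_le ⟨x, hx, ?_, hxw⟩) ?_
  · rintro rfl
    rw [wt_eq_zero.2 rfl] at hxw
    omega
  · refine le_csInf ⟨12, x, hx, ?_, hxw⟩ ?_
    · rintro rfl
      rw [wt_eq_zero.2 rfl] at hxw
      omega
    · rintro w ⟨y, hy, hy0, rfl⟩
      have h1 : wt y ≠ 0 := fun e => hy0 (wt_eq_zero.1 e)
      have := sat_wt h y hy
      omega
end

/-! ### Coordinates adapted to a word of weight 12 -/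

/-- Transport of a code along a bijection of the coordinates. -/
def pull {ι κ : Type*} (e : ι ≃ κ) (C : Submodule (ZMod 2) (κ → ZMod 2)) :
    Submodule (ZMod 2) (ι → ZMod 2) :=
  C.map (LinearEquiv.funCongrLeft (ZMod 2) (ZMod 2) e : (κ → ZMod 2) →ₗ[ZMod 2] (ι → ZMod 2))

lemma mem_pull {ι κ : Type*} {e : ι ≃ κ} {C : Submodule (ZMod 2) (κ → ZMod 2)} {y : ι → ZMod 2} :
    y ∈ pull e C ↔ y ∘ e.symm ∈ C := by
  constructor
  · rintro ⟨x, hx, rfl⟩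
    have : (LinearEquiv.funCongrLeft (ZMod 2) (ZMod 2) e x) ∘ e.symm = x := by
      funext i; simp [LinearEquiv.funCongrLeft_apply, LinearMap.funLeft_apply]
    exact this.symm ▸ hx
  · intro h
    refine ⟨y ∘ e.symm, h, ?_⟩
    funext i
    simp [LinearEquiv.funCongrLeft_apply, LinearMap.funLeft_apply]

lemma comp_mem_pull {ι κ : Type*} (e : ι ≃ κ) {C : Submodule (ZMod 2) (κ → ZMod 2)}
    {x : κ → ZMod 2} (hx : x ∈ C) : x ∘ e ∈ pull e C := by
  rw [mem_pull]
  have : (x ∘ e) ∘ e.symm = x := by funext i; simp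
  rwa [this]

lemma finrank_pull {ι κ : Type*} (e : ι ≃ κ) (C : Submodule (ZMod 2) (κ → ZMod 2)) :
    Module.finrank (ZMod 2) (pull e C) = Module.finrank (ZMod 2) C :=
  LinearEquiv.finrank_map_eq _ _

/-- The indicator of the last twenty coordinates. -/
def tV : Fin 32 → ZMod 2 := fun i => if 12 ≤ i.1 then 1 else 0

/-- Normal form of the code after choosing adapted coordinates. -/
structure Base (C : Submodule (ZMod 2) (Fin 32 → ZMod 2)) : Prop where
  wts : ∀ x ∈ C, wt x = 0 ∨ wt x = 12 ∨ wt x = 16 ∨ wt x = 20 ∨ wt x = 32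
  one : (1 : Fin 32 → ZMod 2) ∈ C
  t : tV ∈ C
  dual : ∀ Z : Finset (Fin 32), (∀ x ∈ C, ∑ i ∈ Z, x i = 0) → Z = ∅ ∨ 6 ≤ Z.card
  p : ∀ x ∈ C, ∑ i ∈ univ.filter (fun i : Fin 32 => i.1 < 6), x i = 0
  p' : ∀ x ∈ C, ∑ i ∈ univ.filter (fun i : Fin 32 => 6 ≤ i.1 ∧ i.1 < 12), x i = 0
  rank : Module.finrank (ZMod 2) C = 11

lemma exists_split {C : Submodule (ZMod 2) (K5 → ZMod 2)} (h : SatCond 5 11 4 C)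
    (c : K5 → ZMod 2) (hc : c ∈ C) (hw : wt c = 12) :
    ∃ Z : Finset K5, (∀ i ∈ Z, c i ≠ 0) ∧ Z.card = 6 ∧ (∀ x ∈ C, ∑ i ∈ Z, x i = 0) ∧
      (∀ x ∈ C, ∑ i ∈ univ.filter (fun i => c i ≠ 0), x i = 0) := by
  classical
  set S : Finset K5 := univ.filter (fun i => c i ≠ 0) with hS
  have hScard : S.card = 12 := hw
  have h4 : ∀ x ∈ C, 4 ∣ wt x := by
    intro x hx
    rcases sat_wt h x hx with e | e | e | e | e <;> rw [e] <;> norm_num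
  have hSd : ∀ x ∈ C, ∑ i ∈ S, x i = 0 := by
    intro x hx
    have h1 := wt_add c x
    have h2 := h4 _ (C.add_mem hc hx)
    have h3 := h4 _ hx
    have h5 : 2 ∣ wt (c * x) := by omega
    have h6 : ∑ i ∈ S, x i = (wt (c * x) : ZMod 2) := by
      rw [hS, Finset.sum_filter, wt, Finset.card_filter, Nat.cast_sum]
      refine Finset.sum_congr rfl fun i _ => ?_
      simp only [Pi.mul_apply]
      rcases zmod2_cases (c i) with e | e <;> rcases zmod2_cases (x i) with e' | e' <;>
        simp [e, e']
    rw [h6]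
    exact (ZMod.natCast_eq_zero_iff _ _).2 h5
  -- restriction to S
  let r : C →ₗ[ZMod 2] (S → ZMod 2) :=
    (LinearMap.funLeft (ZMod 2) (ZMod 2) (fun i : S => i.1)).comp C.subtype
  have hr : ∀ (x : C) (i : S), r x i = x.1 i.1 := fun _ _ => rfl
  have hker : 1 ≤ Module.finrank (ZMod 2) (LinearMap.ker r) := by
    have hm : (⟨1 + c, C.add_mem (sat_one h) hc⟩ : C) ∈ LinearMap.ker r := by
      rw [LinearMap.mem_ker]
      funext i
      rw [hr]
      have := (mem_filter.1 i.2).2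
      have h1 := (zmod2_cases _).resolve_left this
      simp [h1, add_self2]
    have hne : (1 + c : K5 → ZMod 2) ≠ 0 := by
      intro e
      have := wt_one_add c
      rw [e, hw, wt_eq_zero.2 rfl, card_K5] at this
      omega
    rw [Nat.one_le_iff_ne_zero, Ne, Submodule.finrank_eq_zero]
    intro e
    rw [e, Submodule.mem_bot] at hm
    exact hne (congrArg Subtype.val hm)
  have hrange : Module.finrank (ZMod 2) (LinearMap.range r) ≤ 10 := by
    have := LinearMap.finrank_range_add_finrank_ker r
    rw [h.1] at this
    omega
  have hann := Subspace.finrank_add_finrank_dualAnnihilator_eq (LinearMap.range r)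
  have hV : Module.finrank (ZMod 2) (S → ZMod 2) = 12 := by
    rw [Module.finrank_fintype_fun_eq_card, Fintype.card_coe, hScard]
  rw [hV] at hann
  let sig : Module.Dual (ZMod 2) (S → ZMod 2) := ∑ i, LinearMap.proj i
  have hnle : ¬ (LinearMap.range r).dualAnnihilator ≤ Submodule.span (ZMod 2) {sig} := by
    intro hle
    have h1 := Submodule.finrank_mono hle
    have h2 := finrank_span_le_card (R := ZMod 2) ({sig} : Set (Module.Dual (ZMod 2) (S → ZMod 2)))
    simp at h2
    omega
  obtain ⟨φ, hφ, hφ'⟩ := SetLike.not_le_iff_exists.1 hnle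
  have hφ0 : φ ≠ 0 := by rintro rfl; exact hφ' (Submodule.zero_mem _)
  have hφs : φ ≠ sig := by rintro rfl; exact hφ' (Submodule.mem_span_singleton_self _)
  have hφx : ∀ y : S → ZMod 2, φ y = ∑ i, y i * φ (Pi.single i 1) := by
    intro y
    conv_lhs => rw [pi_eq_sum_univ' y]
    rw [map_sum]
    refine Finset.sum_congr rfl fun i _ => ?_
    rw [map_smul, smul_eq_mul]
  let Z : Finset K5 := (univ.filter fun i : S => φ (Pi.single i 1) ≠ 0).map
    (Function.Embedding.subtype _)
  have hZsub : Z ⊆ S := by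
    intro i hi
    simp only [Z, mem_map] at hi
    obtain ⟨j, _, rfl⟩ := hi
    exact j.2
  have hZd : ∀ x ∈ C, ∑ i ∈ Z, x i = 0 := by
    intro x hx
    have h1 : φ (r ⟨x, hx⟩) = 0 :=
      (Submodule.mem_dualAnnihilator φ).1 hφ _ (LinearMap.mem_range_self _ _)
    rw [← h1, hφx]
    simp only [Z, Finset.sum_map, Finset.sum_filter]
    refine Finset.sum_congr rfl fun i _ => ?_
    rw [hr]
    rcases zmod2_cases (φ (Pi.single i 1)) with e | e <;> simp [e]
  have hZ0 : Z ≠ ∅ := by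
    intro e
    apply hφ0
    refine LinearMap.ext fun y => ?_
    rw [hφx, LinearMap.zero_apply]
    refine Finset.sum_eq_zero fun i _ => ?_
    have : i ∉ (univ.filter fun i : S => φ (Pi.single i 1) ≠ 0) := by
      rw [Finset.map_eq_empty.1 e]; simp
    simp at this
    rw [this, mul_zero]
  have hZS : S \ Z ≠ ∅ := by
    intro e
    rw [Finset.sdiff_eq_empty_iff_subset] at e
    apply hφs
    refine LinearMap.ext fun y => ?_
    rw [hφx]
    simp only [sig, LinearMap.sum_apply, LinearMap.proj_apply]
    refine Finset.sum_congr rfl fun i _ => ?_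
    have := e i.2
    simp only [Z, mem_map, mem_filter, mem_univ, true_and] at this
    obtain ⟨j, hj, hji⟩ := this
    have hji' : j = i := Subtype.ext hji
    subst hji'
    rw [(zmod2_cases _).resolve_left hj, mul_one]
  have h6 := (sat4_dual h Z hZd).resolve_left hZ0
  have hd2 : ∀ x ∈ C, ∑ i ∈ S \ Z, x i = 0 := by
    intro x hx
    have := Finset.sum_sdiff (f := x) hZsub
    rw [hZd x hx, hSd x hx, add_zero] at this
    exact this
  have h6' := (sat4_dual h (S \ Z) hd2).resolve_left hZS
  have hcard := Finset.card_sdiff_add_card_eq_card hZsub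
  exact ⟨Z, fun i hi => (mem_filter.1 (hZsub hi)).2, by omega, hZd, hSd⟩

lemma exists_base {C : Submodule (ZMod 2) (K5 → ZMod 2)} (h : SatCond 5 11 4 C) :
    ∃ e : Fin 32 ≃ K5, Base (pull e C) := by
  classical
  obtain ⟨c, hc, hwc⟩ := sat_ex h
  norm_num at hwc
  obtain ⟨Z, hZc, hZ6, hZd, hSd⟩ := exists_split h c hc hwc
  let cF : Fin 32 → Fin 3 := fun i => if i.1 < 6 then 0 else if i.1 < 12 then 1 else 2
  let cK : K5 → Fin 3 := fun v => if v ∈ Z then 0 else if c v ≠ 0 then 1 else 2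
  have hS : (univ.filter (fun i => c i ≠ 0)).card = 12 := hwc
  have hZS : Z ⊆ univ.filter (fun i => c i ≠ 0) := fun i hi => by simpa using hZc i hi
  have hcard : ∀ k : Fin 3, Fintype.card {a // cF a = k} = Fintype.card {b // cK b = k} := by
    intro k
    rw [Fintype.card_subtype, Fintype.card_subtype]
    fin_cases k
    · have h1 : (univ.filter fun a => cF a = 0).card = 6 := by decide +kernel
      have h2 : (univ.filter fun b => cK b = 0) = Z := by
        ext v
        simp only [cK, mem_filter, mem_univ, true_and]
        split_ifs <;> simp [*]
      change (univ.filter fun a => cF a = 0).card = (univ.filter fun b => cK b = 0).card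
      rw [h1, h2, hZ6]
    · have h1 : (univ.filter fun a => cF a = 1).card = 6 := by decide +kernel
      have h2 : (univ.filter fun b => cK b = 1) = (univ.filter (fun i => c i ≠ 0)) \ Z := by
        ext v
        simp only [cK, mem_filter, mem_univ, true_and, mem_sdiff]
        split_ifs <;> simp_all
      change (univ.filter fun a => cF a = 1).card = (univ.filter fun b => cK b = 1).card
      rw [h1, h2, Finset.card_sdiff_of_subset hZS, hZ6, hS]
    · have h1 : (univ.filter fun a => cF a = 2).card = 20 := by decide +kernel
      have h2 : (univ.filter fun b => cK b = 2) = univ \ (univ.filter (fun i => c i ≠ 0)) := by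
        ext v
        simp only [cK, mem_filter, mem_univ, true_and, mem_sdiff]
        have := hZc v
        split_ifs <;> simp_all
      change (univ.filter fun a => cF a = 2).card = (univ.filter fun b => cK b = 2).card
      rw [h1, h2, Finset.card_sdiff_of_subset (Finset.subset_univ _), hS, Finset.card_univ, card_K5]
  let e : Fin 32 ≃ K5 := Equiv.ofFiberEquiv (f := cF) (g := cK)
    (fun k => Fintype.equivOfCardEq (hcard k))
  have he : ∀ i, cK (e i) = cF i := fun i => Equiv.ofFiberEquiv_map _ i
  have heZ : ∀ i, e i ∈ Z ↔ i.1 < 6 := by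
    intro i
    have := he i
    simp only [cK, cF] at this
    split_ifs at this <;> simp_all
  have hec : ∀ i, c (e i) ≠ 0 ↔ i.1 < 12 := by
    intro i
    have := he i
    have h1 := hZc (e i)
    simp only [cK, cF] at this
    split_ifs at this <;> simp_all <;> omega
  have hsum : ∀ (Y : Finset (Fin 32)) (y : Fin 32 → ZMod 2),
      ∑ i ∈ Y.map e.toEmbedding, (y ∘ e.symm) i = ∑ i ∈ Y, y i := by
    intro Y y
    rw [Finset.sum_map]
    simp
  have hmapZ : (univ.filter (fun i : Fin 32 => i.1 < 6)).map e.toEmbedding = Z := by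
    ext v
    simp only [mem_map_equiv, mem_filter, mem_univ, true_and]
    rw [← heZ]; simp
  have hmapS : (univ.filter (fun i : Fin 32 => i.1 < 12)).map e.toEmbedding =
      univ.filter (fun i => c i ≠ 0) := by
    ext v
    simp only [mem_map_equiv, mem_filter, mem_univ, true_and]
    rw [← hec]; simp
  have hp1 : ∀ x ∈ pull e C, ∑ i ∈ univ.filter (fun i : Fin 32 => i.1 < 6), x i = 0 := by
    intro x hx
    rw [← hsum, hmapZ]; exact hZd _ (mem_pull.1 hx)
  have hp2 : ∀ x ∈ pull e C, ∑ i ∈ univ.filter (fun i : Fin 32 => i.1 < 12), x i = 0 := by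
    intro x hx
    rw [← hsum, hmapS]; exact hSd _ (mem_pull.1 hx)
  refine ⟨e, ?_, ?_, ?_, ?_, hp1, ?_, ?_⟩
  · intro x hx
    rw [← wt_comp e.symm x]
    exact sat_wt h _ (mem_pull.1 hx)
  · rw [mem_pull]; exact sat_one h
  · rw [mem_pull]
    have : tV ∘ e.symm = 1 + c := by
      funext v
      obtain ⟨i, rfl⟩ := e.surjective v
      have := hec i
      simp only [Function.comp, Equiv.symm_apply_apply, tV, Pi.add_apply, Pi.one_apply]
      rcases zmod2_cases (c (e i)) with e0 | e0 <;> rw [e0] at this ⊢ <;> simp at this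
      · simp [this]
      · rw [if_neg (by omega)]; rfl
    rw [this]; exact C.add_mem (sat_one h) hc
  · intro Y hY
    have := sat4_dual h (Y.map e.toEmbedding) (by
      intro x hx
      have h1 := hY _ (comp_mem_pull e hx)
      rw [← h1, Finset.sum_map]; rfl)
    rw [Finset.card_map, Finset.map_eq_empty] at this
    exact this
  · intro x hx
    have h1 := hp1 x hx
    have h2 := hp2 x hx
    have h3 := Finset.sum_filter_add_sum_filter_not (univ.filter (fun i : Fin 32 => i.1 < 12))
      (fun i : Fin 32 => i.1 < 6) x
    rw [Finset.filter_filter, Finset.filter_filter, h2] at h3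
    have e1 : (univ.filter fun i : Fin 32 => i.1 < 12 ∧ i.1 < 6) = univ.filter fun i => i.1 < 6 := by
      ext i; simp; omega
    have e2 : (univ.filter fun i : Fin 32 => i.1 < 12 ∧ ¬ i.1 < 6) =
        univ.filter fun i => 6 ≤ i.1 ∧ i.1 < 12 := by
      ext i; simp; omega
    rw [e1, e2, h1, zero_add] at h3
    exact h3
  · rw [finrank_pull]; exact h.1

section
variable {C : Submodule (ZMod 2) (Fin 32 → ZMod 2)}

lemma Base.mod4 (h : Base C) {x : Fin 32 → ZMod 2} (hx : x ∈ C) : 4 ∣ wt x := by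
  rcases h.wts x hx with e | e | e | e | e <;> rw [e] <;> norm_num

lemma wt_tV : wt tV = 20 := by
  unfold wt tV; decide +kernel

/-- A word vanishing on the first twelve coordinates is `0` or `tV`. -/
lemma Base.ker (h : Base C) {x : Fin 32 → ZMod 2} (hx : x ∈ C) (h0 : ∀ i, i.1 < 12 → x i = 0) :
    x = 0 ∨ x = tV := by
  have h1 := wt_add x tV
  have h2 : x * tV = x := by
    funext i
    simp only [Pi.mul_apply, tV]
    split_ifs with hi
    · simp
    · rw [h0 i (by omega)]; simp
  rw [h2, wt_tV] at h1
  have h3 := h.wts _ (C.add_mem hx h.t)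
  have h4 := h.wts _ hx
  have h5 : wt x = 0 ∨ wt (x + tV) = 0 := by omega
  rcases h5 with e | e
  · left; exact wt_eq_zero.1 e
  · right
    have := wt_eq_zero.1 e
    have h6 : x = x + tV + tV := by rw [add_assoc, vadd_self2, add_zero]
    rw [h6, this, zero_add]

lemma sum_lt6 (x : Fin 32 → ZMod 2) : ∑ i ∈ univ.filter (fun i : Fin 32 => i.1 < 6), x i =
    x 0 + x 1 + x 2 + x 3 + x 4 + x 5 := by
  have : univ.filter (fun i : Fin 32 => i.1 < 6) = {0, 1, 2, 3, 4, 5} := by decide +kernel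
  rw [this]
  simp [Finset.sum_insert, add_assoc]

lemma sum_lt12 (x : Fin 32 → ZMod 2) :
    ∑ i ∈ univ.filter (fun i : Fin 32 => 6 ≤ i.1 ∧ i.1 < 12), x i =
    x 6 + x 7 + x 8 + x 9 + x 10 + x 11 := by
  have : univ.filter (fun i : Fin 32 => 6 ≤ i.1 ∧ i.1 < 12) = {6, 7, 8, 9, 10, 11} := by
    decide +kernel
  rw [this]
  simp [Finset.sum_insert, add_assoc]

/-- The ten independent coordinates among the first twelve. -/
def ten : Fin 10 → Fin 32 := ![0, 1, 2, 3, 4, 6, 7, 8, 9, 10]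

lemma z2_eq {a b : ZMod 2} (h : a + b = 0) : b = a := by
  revert a b; decide

lemma Base.x5 (h : Base C) {x : Fin 32 → ZMod 2} (hx : x ∈ C) :
    x 5 = x 0 + x 1 + x 2 + x 3 + x 4 := by
  have := h.p x hx
  rw [sum_lt6] at this
  exact z2_eq this

lemma Base.x11 (h : Base C) {x : Fin 32 → ZMod 2} (hx : x ∈ C) :
    x 11 = x 6 + x 7 + x 8 + x 9 + x 10 := by
  have := h.p' x hx
  rw [sum_lt12] at this
  exact z2_eq this

lemma Base.zero12 (h : Base C) {x : Fin 32 → ZMod 2} (hx : x ∈ C) (h0 : ∀ k, x (ten k) = 0) :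
    ∀ i : Fin 32, i.1 < 12 → x i = 0 := by
  have h1 := h.x5 hx
  have h2 := h.x11 hx
  have e0 : x 0 = 0 := h0 0
  have e1 : x 1 = 0 := h0 1
  have e2 : x 2 = 0 := h0 2
  have e3 : x 3 = 0 := h0 3
  have e4 : x 4 = 0 := h0 4
  have e6 : x 6 = 0 := h0 5
  have e7 : x 7 = 0 := h0 6
  have e8 : x 8 = 0 := h0 7
  have e9 : x 9 = 0 := h0 8
  have e10 : x 10 = 0 := h0 9
  simp only [e0, e1, e2, e3, e4, add_zero] at h1
  simp only [e6, e7, e8, e9, e10, add_zero] at h2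
  intro i hi
  obtain ⟨i, hi'⟩ := i
  simp only at hi
  interval_cases i <;> assumption

lemma Base.patt (h : Base C) (f : Fin 10 → ZMod 2) : ∃ x ∈ C, ∀ k, x (ten k) = f k := by
  classical
  let r : C →ₗ[ZMod 2] (Fin 10 → ZMod 2) :=
    (LinearMap.funLeft (ZMod 2) (ZMod 2) ten).comp C.subtype
  have hr : ∀ (x : C) k, r x k = x.1 (ten k) := fun _ _ => rfl
  have hker : Module.finrank (ZMod 2) (LinearMap.ker r) ≤ 1 := by
    have htk : (⟨tV, h.t⟩ : C) ∈ LinearMap.ker r := by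
      rw [LinearMap.mem_ker]
      funext k
      rw [hr]
      have : ∀ k, tV (ten k) = 0 := by unfold tV ten; decide +kernel
      exact this k
    refine finrank_le_one (⟨⟨tV, h.t⟩, htk⟩ : LinearMap.ker r) ?_
    rintro ⟨⟨x, hx⟩, hxk⟩
    have h0 : ∀ k, x (ten k) = 0 := by
      intro k
      have := congrFun (LinearMap.mem_ker.1 hxk) k
      exact this
    rcases h.ker hx (h.zero12 hx h0) with e | e
    · refine ⟨0, Subtype.ext (Subtype.ext ?_)⟩
      simp [e]
    · refine ⟨1, Subtype.ext (Subtype.ext ?_)⟩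
      simp [e]
  have hs : Function.Surjective r := by
    rw [← LinearMap.range_eq_top]
    apply Submodule.eq_top_of_finrank_eq
    have h1 := LinearMap.finrank_range_add_finrank_ker r
    have h2 := Submodule.finrank_le (LinearMap.range r)
    rw [h.rank] at h1
    rw [Module.finrank_fintype_fun_eq_card, Fintype.card_fin] at h2 ⊢
    omega
  obtain ⟨x, hx⟩ := hs f
  exact ⟨x.1, x.2, fun k => by rw [← hr, hx]⟩
end

/-! ### Linear algebra on bit masks -/

/-- Parity of the intersection of two masks (33 bits). -/
def par (n r : ℕ) : ZMod 2 := ∑ i ∈ range 33, if n.testBit i && r.testBit i then 1 else 0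

lemma par_xor_left (a b r : ℕ) : par (a ^^^ b) r = par a r + par b r := by
  simp only [par, ← Finset.sum_add_distrib, Nat.testBit_xor]
  refine Finset.sum_congr rfl fun i _ => ?_
  cases a.testBit i <;> cases b.testBit i <;> cases r.testBit i <;> simp [add_self2]

lemma par_comm (a b : ℕ) : par a b = par b a := by
  simp only [par, Bool.and_comm]

lemma par_zero (a : ℕ) : par 0 a = 0 := by
  simp [par]

lemma par_xcomb (ws : List ℕ) (r m : ℕ) (h : ∀ w ∈ ws, par w r = 0) : par (xcomb ws m) r = 0 := by
  induction ws generalizing m with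
  | nil => exact par_zero r
  | cons w ws ih =>
    have e : xcomb (w :: ws) m = (cond (Nat.beq (Nat.land 1 m) 1) w 0) ^^^
      (xcomb ws (Nat.shiftRight m 1)) := rfl
    rw [e, par_xor_left, ih _ (fun w hw => h w (by simp [hw])), add_zero]
    cases Nat.beq (Nat.land 1 m) 1
    · exact par_zero r
    · exact h w (by simp)

lemma xcomb_cons (w : ℕ) (ws : List ℕ) (b : Bool) (m : ℕ) :
    xcomb (w :: ws) (2 * m + b.toNat) = (cond b w 0) ^^^ xcomb ws m := by
  have e : xcomb (w :: ws) (2 * m + b.toNat) =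
    (cond (Nat.beq (Nat.land 1 (2 * m + b.toNat)) 1) w 0) ^^^
      (xcomb ws (Nat.shiftRight (2 * m + b.toNat) 1)) := rfl
  have e1 : Nat.land 1 (2 * m + b.toNat) = b.toNat := by
    change 1 &&& (2 * m + b.toNat) = _
    rw [Nat.and_comm, Nat.and_one_is_mod]
    cases b <;> simp <;> omega
  have e2 : Nat.shiftRight (2 * m + b.toNat) 1 = m := by
    change (2 * m + b.toNat) >>> 1 = m
    rw [Nat.shiftRight_eq_div_pow]
    cases b <;> simp <;> omega
  rw [e, e1, e2]
  cases b <;> rfl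

lemma testBit_xcomb_false (ws : List ℕ) (p m : ℕ) (h : ∀ w ∈ ws, w.testBit p = false) :
    (xcomb ws m).testBit p = false := by
  induction ws generalizing m with
  | nil => simp [xcomb]
  | cons w ws ih =>
    have e : xcomb (w :: ws) m = (cond (Nat.beq (Nat.land 1 m) 1) w 0) ^^^
      (xcomb ws (Nat.shiftRight m 1)) := rfl
    rw [e, Nat.testBit_xor, ih _ (fun w hw => h w (by simp [hw]))]
    cases Nat.beq (Nat.land 1 m) 1
    · simp
    · simpa using h w (by simp)

lemma xcomb_lt (ws : List ℕ) (N m : ℕ) (h : ∀ w ∈ ws, w < 2 ^ N) : xcomb ws m < 2 ^ N := by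
  apply Nat.lt_pow_two_of_testBit
  intro i hi
  apply testBit_xcomb_false
  intro w hw
  exact Nat.testBit_lt_two_pow (lt_of_lt_of_le (h w hw) (Nat.pow_le_pow_right (by norm_num) hi))

lemma clear_bits (cols : List (ℕ × ℕ)) (hp : cols.Pairwise fun a b => b.2.testBit a.1 = false)
    (hd : ∀ a ∈ cols, a.2.testBit a.1 = true) (D : ℕ) :
    ∃ m, ∀ a ∈ cols, (D ^^^ xcomb (cols.map Prod.snd) m).testBit a.1 = false := by
  induction cols generalizing D with
  | nil => exact ⟨0, by simp⟩
  | cons a l ih =>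
    rw [List.pairwise_cons] at hp
    obtain ⟨m, hm⟩ := ih hp.2 (fun b hb => hd b (by simp [hb]))
      (D ^^^ cond (D.testBit a.1) a.2 0)
    refine ⟨2 * m + (D.testBit a.1).toNat, ?_⟩
    rw [List.map_cons, xcomb_cons, ← Nat.xor_assoc]
    intro b hb
    rcases List.mem_cons.1 hb with rfl | hb
    · rw [Nat.testBit_xor, testBit_xcomb_false, Nat.testBit_xor]
      · have := hd b (by simp)
        cases e : D.testBit b.1 <;> simp [this]
      · intro w hw
        obtain ⟨c, hc, rfl⟩ := List.mem_map.1 hw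
        exact hp.1 c hc
    · exact hm b hb

lemma span_lemma (N : ℕ) (hN : N ≤ 33) (cols : List (ℕ × ℕ)) (red : List (ℕ × ℕ)) (D : ℕ)
    (hD : D < 2 ^ N)
    (hp : cols.Pairwise fun a b => b.2.testBit a.1 = false)
    (hd : ∀ a ∈ cols, a.2.testBit a.1 = true ∧ a.2 < 2 ^ N)
    (hcr : ∀ a ∈ cols, ∀ r ∈ red, par a.2 r.2 = 0)
    (hr : ∀ r ∈ red, par D r.2 = 0)
    (hred : ∀ r ∈ red, r.2.testBit r.1 = true ∧ r.1 < N ∧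
      ∀ i < N, i ≠ r.1 → r.2.testBit i = true → i ∈ cols.map Prod.fst)
    (hcov : ∀ i < N, i ∈ cols.map Prod.fst ∨ i ∈ red.map Prod.fst) :
    ∃ m, D = xcomb (cols.map Prod.snd) m := by
  obtain ⟨m, hm⟩ := clear_bits cols hp (fun a ha => (hd a ha).1) D
  refine ⟨m, ?_⟩
  set X := xcomb (cols.map Prod.snd) m with hX
  have hXlt : X < 2 ^ N := xcomb_lt _ _ _ (by
    intro w hw
    obtain ⟨c, hc, rfl⟩ := List.mem_map.1 hw
    exact (hd c hc).2)
  have hDX : D ^^^ X < 2 ^ N := Nat.xor_lt_two_pow hD hXlt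
  have hbit : ∀ i, N ≤ i → (D ^^^ X).testBit i = false := fun i hi =>
    Nat.testBit_lt_two_pow (lt_of_lt_of_le hDX (Nat.pow_le_pow_right (by norm_num) hi))
  have hcolz : ∀ i ∈ cols.map Prod.fst, (D ^^^ X).testBit i = false := by
    intro i hi
    obtain ⟨c, hc, rfl⟩ := List.mem_map.1 hi
    exact hm c hc
  have hredz : ∀ r ∈ red, (D ^^^ X).testBit r.1 = false := by
    intro r hrm
    have h1 : par (D ^^^ X) r.2 = 0 := by
      rw [par_xor_left, hr r hrm, par_xcomb, add_zero]
      intro w hw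
      obtain ⟨c, hc, rfl⟩ := List.mem_map.1 hw
      exact hcr c hc r hrm
    obtain ⟨h2, h3, h4⟩ := hred r hrm
    unfold par at h1
    rw [Finset.sum_eq_single r.1] at h1
    · rw [h2, Bool.and_true] at h1
      cases e : (D ^^^ X).testBit r.1
      · rfl
      · rw [e] at h1; simp at h1
    · intro i _ hi
      rw [if_neg]
      intro hb
      rw [Bool.and_eq_true] at hb
      by_cases hiN : i < N
      · have := hcolz i (h4 i hiN hi hb.2)
        rw [this] at hb; simp at hb
      · have := hbit i (by omega)
        rw [this] at hb; simp at hb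
    · intro hn
      exact absurd (Finset.mem_range.2 (by omega)) hn
  apply Nat.eq_of_testBit_eq
  intro i
  have h0 : (D ^^^ X).testBit i = false := by
    by_cases hi : i < N
    · rcases hcov i hi with h | h
      · exact hcolz i h
      · obtain ⟨c, hc, rfl⟩ := List.mem_map.1 h
        exact hredz c hc
    · exact hbit i (by omega)
  rw [Nat.testBit_xor] at h0
  cases e : D.testBit i <;> cases e' : X.testBit i <;> simp_all

/-! ### Permutations preserving the three blocks -/

lemma Base.pull {C : Submodule (ZMod 2) (Fin 32 → ZMod 2)} (h : Base C) (π : Equiv.Perm (Fin 32))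
    (h6 : ∀ i, (π i).1 < 6 ↔ i.1 < 6) (h12 : ∀ i, (π i).1 < 12 ↔ i.1 < 12) :
    Base (pull π C) := by
  classical
  have hsum : ∀ (Y : Finset (Fin 32)) (y : Fin 32 → ZMod 2),
      ∑ i ∈ Y.map π.toEmbedding, (y ∘ π.symm) i = ∑ i ∈ Y, y i := by
    intro Y y
    rw [Finset.sum_map]
    simp
  refine ⟨?_, ?_, ?_, ?_, ?_, ?_, ?_⟩
  · intro x hx
    rw [← wt_comp π.symm x]
    exact h.wts _ (mem_pull.1 hx)
  · rw [mem_pull]; exact h.one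
  · rw [mem_pull]
    have : tV ∘ π.symm = tV := by
      funext v
      obtain ⟨i, rfl⟩ := π.surjective v
      have := h12 i
      simp only [Function.comp, Equiv.symm_apply_apply, tV]
      by_cases hi : i.1 < 12
      · rw [if_neg (by omega), if_neg (by have := this.2 hi; omega)]
      · rw [if_pos (by omega), if_pos (by have := mt this.1 hi; omega)]
    rw [this]; exact h.t
  · intro Y hY
    have := h.dual (Y.map π.toEmbedding) (by
      intro x hx
      have h1 := hY _ (comp_mem_pull π hx)
      rw [← h1, Finset.sum_map]; rfl)
    rw [Finset.card_map, Finset.map_eq_empty] at this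
    exact this
  · intro x hx
    have := h.p _ (mem_pull.1 hx)
    have e : univ.filter (fun i : Fin 32 => i.1 < 6) =
        (univ.filter (fun i : Fin 32 => i.1 < 6)).map π.toEmbedding := by
      ext v
      obtain ⟨i, rfl⟩ := π.surjective v
      simp [h6]
    rw [e, hsum] at this
    exact this
  · intro x hx
    have := h.p' _ (mem_pull.1 hx)
    have e : univ.filter (fun i : Fin 32 => 6 ≤ i.1 ∧ i.1 < 12) =
        (univ.filter (fun i : Fin 32 => 6 ≤ i.1 ∧ i.1 < 12)).map π.toEmbedding := by
      ext v
      obtain ⟨i, rfl⟩ := π.surjective v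
      have := h6 i
      have := h12 i
      simp; omega
    rw [e, hsum] at this
    exact this
  · rw [finrank_pull]; exact h.rank

/-! ### Separation of the last twenty coordinates -/

lemma Base.sepT {C : Submodule (ZMod 2) (Fin 32 → ZMod 2)} (h : Base C)
    (u : Fin 10 → Fin 32 → ZMod 2) (hu : ∀ i, u i ∈ C)
    (hup : ∀ i k, u i (ten k) = if k = i then 1 else 0)
    (v v' : Fin 32) (hv : 12 ≤ v.1) (hv' : 12 ≤ v'.1)
    (heq : ∀ i : Fin 10, i.1 < 5 → u i v = u i v') : v = v' := by
  classical
  by_contra hne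
  -- every word agrees up to the tail
  have hall : ∀ x ∈ C, x v + x v' = ∑ k : Fin 10, x (ten k) * (u k v + u k v') := by
    intro x hx
    have hy : x + ∑ k : Fin 10, x (ten k) • u k ∈ C :=
      C.add_mem hx (C.sum_mem fun k _ => C.smul_mem _ (hu k))
    have hy0 : ∀ l, (x + ∑ k : Fin 10, x (ten k) • u k) (ten l) = 0 := by
      intro l
      simp only [Pi.add_apply, Finset.sum_apply, Pi.smul_apply, smul_eq_mul, hup]
      simp [add_self2]
    have hvv : (x + ∑ k : Fin 10, x (ten k) • u k) v = (x + ∑ k : Fin 10, x (ten k) • u k) v' := by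
      rcases h.ker hy (h.zero12 hy hy0) with e | e
      · rw [e]; rfl
      · rw [e]; simp [tV, hv, hv']
    simp only [Pi.add_apply, Finset.sum_apply, Pi.smul_apply, smul_eq_mul] at hvv
    simp only [mul_add, Finset.sum_add_distrib]
    generalize (∑ k : Fin 10, x (ten k) * u k v) = a at *
    generalize (∑ k : Fin 10, x (ten k) * u k v') = b at *
    generalize x v = c at *
    generalize x v' = d at *
    revert a b c d; decide
  let D : Finset (Fin 10) := univ.filter fun k => u k v ≠ u k v'
  have htinj : Function.Injective ten := by unfold ten; decide +kernel
  let D' : Finset (Fin 32) := D.map ⟨ten, htinj⟩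
  have hD5 : ∀ k ∈ D, 5 ≤ k.1 := by
    intro k hk
    by_contra hlt
    exact (mem_filter.1 hk).2 (heq k (by omega))
  have hsumD : ∀ x ∈ C, x v + x v' = ∑ i ∈ D', x i := by
    intro x hx
    rw [hall x hx, Finset.sum_map, Finset.sum_filter]
    refine Finset.sum_congr rfl fun k _ => ?_
    simp only [Function.Embedding.coeFn_mk]
    rcases zmod2_cases (u k v) with e | e <;> rcases zmod2_cases (u k v') with e' | e' <;>
      simp [e, e', add_self2]
  let P' : Finset (Fin 32) := univ.filter (fun i : Fin 32 => 6 ≤ i.1 ∧ i.1 < 12)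
  have hP' : P'.card = 6 := by decide +kernel
  have hten : ∀ k : Fin 10, 5 ≤ k.1 → ten k ∈ P' := by
    simp only [P', mem_filter, mem_univ, true_and]
    unfold ten; decide +kernel
  have hsub : D' ⊆ P' := by
    intro i hi
    obtain ⟨k, hk, rfl⟩ := Finset.mem_map.1 hi
    exact hten k (hD5 k hk)
  have hgen : ∀ E ⊆ P', (∀ x ∈ C, x v + x v' = ∑ i ∈ E, x i) → 4 ≤ E.card := by
    intro E hE hEs
    have hvE : v ∉ E := fun hh => by have := (mem_filter.1 (hE hh)).2; omega
    have hvE' : v' ∉ E := fun hh => by have := (mem_filter.1 (hE hh)).2; omega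
    have := h.dual (insert v (insert v' E)) (by
      intro x hx
      rw [Finset.sum_insert (by simp [hne, hvE]), Finset.sum_insert hvE', ← hEs x hx]
      generalize x v = c
      generalize x v' = d
      revert c d; decide)
    rw [Finset.card_insert_of_notMem (by simp [hne, hvE]), Finset.card_insert_of_notMem hvE'] at this
    rcases this with e | e
    · simp at e
    · omega
  have h1 := hgen D' hsub hsumD
  have h2 := hgen (P' \ D') Finset.sdiff_subset (by
    intro x hx
    have := Finset.sum_sdiff (f := x) hsub
    rw [h.p' x hx] at this
    rw [hsumD x hx]
    exact z2_eq this)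
  rw [Finset.card_sdiff_of_subset hsub, hP'] at h2
  omega

/-! ### Normalizing the position set -/

/-- The model position sets, their words, and permutations to the standard one. -/
def swapD : List (List ℕ × List ℕ × List ℕ) := [
  (
    [9, 10, 13, 14, 17, 19, 20, 22, 26, 27, 28, 29, 31, 0, 3, 5, 6, 7, 8, 16],
    [765677601, 893034530, 969719844, 1106309160, 2180972592],
    [0, 1, 2, 3, 4, 5, 6, 7, 8, 9, 10, 11, 12, 13, 14, 15, 16, 17, 18, 19, 20, 21, 22, 23, 24,
     25, 26, 27, 28, 29, 30, 31]),
  (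
    [10, 9, 14, 13, 18, 19, 20, 21, 25, 27, 28, 30, 31, 0, 3, 6, 5, 7, 8, 16],
    [893034529, 765677602, 969719844, 1106309160, 2180972592],
    [1, 0, 2, 3, 4, 5, 6, 7, 8, 9, 10, 11, 12, 13, 14, 15, 16, 17, 18, 19, 20, 21, 22, 23, 24,
     25, 26, 27, 28, 29, 30, 31]),
  (
    [12, 10, 13, 11, 20, 22, 17, 19, 26, 30, 25, 29, 31, 0, 6, 5, 3, 7, 8, 16],
    [969719841, 893034530, 765677604, 1106309160, 2180972592],
    [2, 1, 0, 3, 4, 5, 6, 7, 8, 9, 10, 11, 12, 13, 14, 15, 16, 17, 18, 19, 20, 21, 22, 23, 24,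
     25, 26, 27, 28, 29, 30, 31]),
  (
    [9, 3, 13, 7, 24, 26, 20, 22, 19, 27, 21, 29, 31, 0, 10, 12, 6, 14, 1, 16],
    [1106309153, 893034530, 969719844, 765677608, 2180972592],
    [3, 1, 2, 0, 4, 5, 6, 7, 8, 9, 10, 11, 12, 13, 14, 15, 16, 17, 18, 19, 20, 21, 22, 23, 24,
     25, 26, 27, 28, 29, 30, 31]),
  (
    [24, 10, 28, 14, 17, 19, 5, 7, 11, 27, 13, 29, 31, 0, 18, 20, 6, 22, 8, 1],
    [2180972577, 893034530, 969719844, 1106309160, 765677616],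
    [4, 1, 2, 3, 0, 5, 6, 7, 8, 9, 10, 11, 12, 13, 14, 15, 16, 17, 18, 19, 20, 21, 22, 23, 24,
     25, 26, 27, 28, 29, 30, 31]),
  (
    [23, 10, 19, 14, 15, 13, 20, 22, 26, 5, 28, 3, 1, 0, 29, 27, 6, 25, 8, 16],
    [765677601, 412741666, 342855716, 1817419816, 2891730992],
    [5, 1, 2, 3, 4, 0, 6, 7, 8, 9, 10, 11, 12, 13, 14, 15, 16, 17, 18, 19, 20, 21, 22, 23, 24,
     25, 26, 27, 28, 29, 30, 31])]

lemma swapD_ex : ∀ l ∈ xsJ, ∃ q ∈ swapD, q.1 = l := by decide +kernel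

lemma swapD_len : ∀ q ∈ swapD, q.1.length = 20 ∧ q.1.Nodup ∧ (∀ x ∈ q.1, x < 32) ∧
    q.2.1.length = 5 := by decide +kernel

lemma swapD_words : ∀ q ∈ swapD, ∀ i : Fin 5, ∀ j : Fin 32,
    (q.2.1.getD i.1 0).testBit j.1 = if j.1 < 12 then (decide (j.1 = i.1 ∨ j.1 = 5)) else
      (q.1.getD (j.1 - 12) 0).testBit i.1 := by decide +kernel

lemma swapD_perm : ∀ q ∈ swapD, permOK q.2.2 = true ∧ ∀ j : Fin 32,
    (q.2.2.getD j.1 0 < 6 ↔ j.1 < 6) ∧ (q.2.2.getD j.1 0 < 12 ↔ j.1 < 12) := by decide +kernel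

lemma swapD_std : ∀ q ∈ swapD, ∀ w ∈ stdW, ∃ m < 128,
    permN q.2.2 w = xcomb (q.2.1 ++ [4294963200, 4294967295]) m := by decide +kernel

lemma vec_eq_iff (n : ℕ) (f : Fin 32 → ZMod 2) :
    vec n = f ↔ ∀ j : Fin 32, n.testBit j.1 = decide (f j ≠ 0) := by
  constructor
  · rintro rfl j
    unfold vec
    cases n.testBit j <;> simp
  · intro h
    funext j
    unfold vec
    rw [h j]
    rcases zmod2_cases (f j) with e | e <;> simp [e]

lemma vec_tV : vec 4294963200 = tV := by
  rw [vec_eq_iff]; unfold tV; decide +kernel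

lemma vec_one : vec 4294967295 = 1 := by
  rw [vec_eq_iff]; decide +kernel

lemma Base.even_mul {C : Submodule (ZMod 2) (Fin 32 → ZMod 2)} (h : Base C)
    {x y : Fin 32 → ZMod 2} (hx : x ∈ C) (hy : y ∈ C) : ∑ v, x v * y v = 0 := by
  have h1 := wt_add x y
  have h2 := h.mod4 hx
  have h3 := h.mod4 hy
  have h4 := h.mod4 (C.add_mem hx hy)
  have h5 : 2 ∣ wt (x * y) := by omega
  have h6 : ∑ v, x v * y v = (wt (x * y) : ZMod 2) := by
    rw [wt, Finset.card_filter, Nat.cast_sum]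
    refine Finset.sum_congr rfl fun i _ => ?_
    simp only [Pi.mul_apply]
    rcases zmod2_cases (x i) with e | e <;> rcases zmod2_cases (y i) with e' | e' <;>
      simp [e, e']
  rw [h6]
  exact (ZMod.natCast_eq_zero_iff _ _).2 h5

lemma Base.exists_u {C : Submodule (ZMod 2) (Fin 32 → ZMod 2)} (h : Base C) :
    ∃ u : Fin 10 → Fin 32 → ZMod 2, (∀ i, u i ∈ C) ∧
      (∀ i k, u i (ten k) = if k = i then 1 else 0) ∧ ∀ i, u i 12 = 0 := by
  choose b hb hbp using fun i : Fin 10 => h.patt (fun k => if k = i then 1 else 0)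
  refine ⟨fun i => b i + b i 12 • tV, fun i => C.add_mem (hb i) (C.smul_mem _ h.t), ?_, ?_⟩
  · intro i k
    have : ∀ k, tV (ten k) = 0 := by unfold tV ten; decide +kernel
    simp [this, hbp]
  · intro i
    have : tV 12 = 1 := by unfold tV; decide +kernel
    simp [this, add_self2]

lemma sum_split12 {R : Type*} [AddCommMonoid R] (f : Fin 32 → R) :
    ∑ v, f v = ∑ v ∈ univ.filter (fun v : Fin 32 => v.1 < 12), f v +
      ∑ v ∈ univ.filter (fun v : Fin 32 => 12 ≤ v.1), f v := by
  rw [← Finset.sum_filter_add_sum_filter_not univ (fun v : Fin 32 => v.1 < 12)]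
  simp only [not_lt]

lemma sum_first12 {R : Type*} [AddCommMonoid R] (f : Fin 32 → R) :
    ∑ v ∈ univ.filter (fun v : Fin 32 => v.1 < 12), f v =
      f 0 + (f 1 + (f 2 + (f 3 + (f 4 + (f 5 + (f 6 + (f 7 + (f 8 + (f 9 + (f 10 + f 11)))))))))) := by
  have : univ.filter (fun i : Fin 32 => i.1 < 12) = {0, 1, 2, 3, 4, 5, 6, 7, 8, 9, 10, 11} := by
    decide +kernel
  rw [this]
  simp [Finset.sum_insert]

/-- The bilinear form on 5-bit numbers. -/
def bil (a s : ℕ) : ZMod 2 := ∑ i : Fin 5, if a.testBit i.1 && s.testBit i.1 then 1 else 0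

/-- Weight on the first twelve coordinates. -/
def cstM (H : ℕ) : ℕ := (H.testBit 1).toNat + ((H.testBit 2).toNat + ((H.testBit 4).toNat +
  ((H.testBit 8).toNat + ((H.testBit 16).toNat + ((H.testBit 31).toNat + 6 * (H.testBit 0).toNat)))))

lemma wcondM_spec : ∀ p ∈ wcondM, cstM p.2 = p.1 ∧
    ∃ a < 32, ∀ s < 32, p.2.testBit s = decide (bil a s ≠ 0) := by decide +kernel

lemma basicM_spec : ∀ r ∈ basicM, r = 4294967295 ∨ r = 4294967297 ∨
    (∃ i : Fin 5, (∀ s < 32, r.testBit s = s.testBit i.1) ∧ r.testBit 32 = false) ∨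
    (∃ i j : Fin 5, i ≠ j ∧ (∀ s < 32, r.testBit s = (s.testBit i.1 && s.testBit j.1)) ∧
      r.testBit 32 = true) := by decide +kernel

lemma redM_spec : ∀ r ∈ redM, r.2.1 = xcomb basicM r.2.2 ∧ par M00 r.2.1 = par (2 ^ 32) r.2.1 ∧
    r.2.1.testBit r.1 = true ∧ r.1 < 32 ∧
    ∀ i < 32, i ≠ r.1 → r.2.1.testBit i = true → i ∈ colsM.map Prod.fst := by decide +kernel

lemma redM_cov : ∀ i < 32, i ∈ colsM.map Prod.fst ∨
    i ∈ (redM.map (fun r => (r.1, r.2.1))).map Prod.fst := by decide +kernel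

lemma colsM_pair : colsM.Pairwise fun a b => b.2.testBit a.1 = false := by decide +kernel

lemma colsM_spec : ∀ a ∈ colsM, a.2.testBit a.1 = true ∧ a.2 < 2 ^ 32 := by decide +kernel

lemma colsM_red : ∀ a ∈ colsM, ∀ r ∈ redM.map (fun r => (r.1, r.2.1)), par a.2 r.2 = 0 := by
  decide +kernel

lemma okw_of {w : ℕ} (h : w = 0 ∨ w = 12 ∨ w = 16 ∨ w = 20 ∨ w = 32) : okw w = true := by
  rcases h with rfl | rfl | rfl | rfl | rfl <;> decide +kernel

lemma okMl_of (l : List (ℕ × ℕ)) (n : ℕ)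
    (h : ∀ p ∈ l, okw (p.1 + popc (n &&& p.2)) = true ∧
      okw (p.1 + 20 - popc (n &&& p.2)) = true) : okMl l n = true := by
  induction l with
  | nil => rfl
  | cons p l ih =>
    obtain ⟨c, m⟩ := p
    have h1 := h (c, m) (by simp)
    simp only [okMl, Bool.and_eq_true]
    exact ⟨⟨h1.1, h1.2⟩, ih fun p hp => h p (by simp [hp])⟩

lemma testBit_eq_beq (M k : ℕ) : Nat.beq (Nat.land 1 (Nat.shiftRight M k)) 1 = M.testBit k := by
  rw [Nat.testBit]
  change Nat.beq (1 &&& (M >>> k)) 1 = (1 &&& (M >>> k) != 0)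
  rw [Nat.and_comm, Nat.and_one_is_mod]
  rcases Nat.mod_two_eq_zero_or_one (M >>> k) with e | e <;> rw [e] <;> rfl

lemma allPos_spec (M s : ℕ) (l : List ℕ) (h : allPos M s l = true) :
    ∀ x ∈ l, M.testBit (s ^^^ x) = true := by
  induction l with
  | nil => simp
  | cons a l ih =>
    simp only [allPos, Bool.and_eq_true, testBit_eq_beq] at h
    intro x hx
    rcases List.mem_cons.1 hx with rfl | hx
    · exact h.1
    · exact ih h.2 x hx

section
variable (A : Fin 32 → ℕ)

/-- The set of values on the last 20 coordinates, as a bit mask. -/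
def posM : ℕ := Nat.ofBits (fun s : Fin 32 => decide (∃ v : Fin 32, 12 ≤ v.1 ∧ A v = s.1))

lemma posM_lt : posM A < 2 ^ 32 := Nat.ofBits_lt_two_pow _

lemma testBit_posM (s : ℕ) (hs : s < 32) :
    (posM A).testBit s = decide (∃ v : Fin 32, 12 ≤ v.1 ∧ A v = s) := by
  unfold posM
  rw [Nat.testBit_ofBits_lt _ _ hs]

lemma posM_sum {R : Type*} [AddCommMonoid R] (hA : ∀ v, A v < 32)
    (hinj : ∀ v w : Fin 32, 12 ≤ v.1 → 12 ≤ w.1 → A v = A w → v = w) (g : ℕ → R) :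
    ∑ s ∈ range 32, (if (posM A).testBit s then g s else 0) =
      ∑ v ∈ univ.filter (fun v : Fin 32 => 12 ≤ v.1), g (A v) := by
  rw [← Finset.sum_filter, ← Finset.sum_image (f := g) (g := A)]
  · refine Finset.sum_congr ?_ fun _ _ => rfl
    ext s
    simp only [mem_filter, mem_range, mem_image, mem_univ, true_and]
    constructor
    · rintro ⟨hs, h⟩
      rw [testBit_posM A s hs, decide_eq_true_eq] at h
      exact h
    · rintro ⟨v, hv, rfl⟩
      refine ⟨hA v, ?_⟩
      rw [testBit_posM A _ (hA v), decide_eq_true_eq]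
      exact ⟨v, hv, rfl⟩
  · intro v hv w hw
    exact hinj v w (by simpa using hv) (by simpa using hw)

lemma posM_par (hA : ∀ v, A v < 32)
    (hinj : ∀ v w : Fin 32, 12 ≤ v.1 → 12 ≤ w.1 → A v = A w → v = w) (r : ℕ) :
    par (posM A) r = ∑ v ∈ univ.filter (fun v : Fin 32 => 12 ≤ v.1),
      if r.testBit (A v) then 1 else 0 := by
  rw [← posM_sum A hA hinj (fun s => if r.testBit s then (1 : ZMod 2) else 0), par,
    Finset.sum_range_succ, Nat.testBit_lt_two_pow (posM_lt A)]
  simp only [Bool.false_and, Bool.false_eq_true, if_false, add_zero]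
  refine Finset.sum_congr rfl fun s _ => ?_
  cases (posM A).testBit s <;> simp

lemma posM_popc (hA : ∀ v, A v < 32)
    (hinj : ∀ v w : Fin 32, 12 ≤ v.1 → 12 ≤ w.1 → A v = A w → v = w) (r : ℕ) :
    popc (posM A &&& r) = ∑ v ∈ univ.filter (fun v : Fin 32 => 12 ≤ v.1),
      (r.testBit (A v)).toNat := by
  rw [← posM_sum A hA hinj (fun s => (r.testBit s).toNat), popc_eq]
  refine Finset.sum_congr rfl fun s _ => ?_
  rw [Nat.testBit_and]
  cases (posM A).testBit s <;> simp

end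

lemma card_last20 : (univ.filter (fun v : Fin 32 => 12 ≤ v.1)).card = 20 := by decide +kernel

lemma par_two_pow (r : ℕ) : par (2 ^ 32) r = if r.testBit 32 then 1 else 0 := by
  unfold par
  rw [Finset.sum_range_succ, Finset.sum_eq_zero]
  · rw [Nat.testBit_two_pow_self]; simp
  · intro i hi
    rw [Nat.testBit_two_pow_of_ne (by have := Finset.mem_range.1 hi; omega)]
    simp

/-- The words with prescribed values on the first twelve coordinates. -/
lemma Base.u_vals {C : Submodule (ZMod 2) (Fin 32 → ZMod 2)} (h : Base C)
    (u : Fin 10 → Fin 32 → ZMod 2) (hu : ∀ i, u i ∈ C)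
    (hup : ∀ i k, u i (ten k) = if k = i then 1 else 0) (i : Fin 5) (j : Fin 32) (hj : j.1 < 12) :
    u (Fin.castLE (by norm_num) i) j = if j.1 = i.1 ∨ j.1 = 5 then 1 else 0 := by
  set w := Fin.castLE (by norm_num : 5 ≤ 10) i with hw
  have h5 := h.x5 (hu w)
  have h11 := h.x11 (hu w)
  have e0 : u w 0 = _ := hup w 0
  have e1 : u w 1 = _ := hup w 1
  have e2 : u w 2 = _ := hup w 2
  have e3 : u w 3 = _ := hup w 3
  have e4 : u w 4 = _ := hup w 4
  have e6 : u w 6 = _ := hup w 5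
  have e7 : u w 7 = _ := hup w 6
  have e8 : u w 8 = _ := hup w 7
  have e9 : u w 9 = _ := hup w 8
  have e10 : u w 10 = _ := hup w 9
  rw [e0, e1, e2, e3, e4] at h5
  rw [e6, e7, e8, e9, e10] at h11
  obtain ⟨j, hj'⟩ := j
  simp only at hj
  interval_cases j
  · refine e0.trans ?_; rw [hw]; fin_cases i <;> rfl
  · refine e1.trans ?_; rw [hw]; fin_cases i <;> rfl
  · refine e2.trans ?_; rw [hw]; fin_cases i <;> rfl
  · refine e3.trans ?_; rw [hw]; fin_cases i <;> rfl
  · refine e4.trans ?_; rw [hw]; fin_cases i <;> rfl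
  · refine h5.trans ?_; rw [hw]; fin_cases i <;> rfl
  · refine e6.trans ?_; rw [hw]; fin_cases i <;> rfl
  · refine e7.trans ?_; rw [hw]; fin_cases i <;> rfl
  · refine e8.trans ?_; rw [hw]; fin_cases i <;> rfl
  · refine e9.trans ?_; rw [hw]; fin_cases i <;> rfl
  · refine e10.trans ?_; rw [hw]; fin_cases i <;> rfl
  · refine h11.trans ?_; rw [hw]; fin_cases i <;> rfl

/-- Values of the map to 5-bit numbers on the first twelve coordinates. -/
def A12 : List ℕ := [1, 2, 4, 8, 16, 31, 0, 0, 0, 0, 0, 0]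

lemma A12_spec : ∀ j < 12, A12.getD j 0 < 32 ∧ ∀ i : Fin 5,
    (A12.getD j 0).testBit i.1 = decide (j = i.1 ∨ j = 5) := by decide +kernel

lemma eq_of_bits5 (a b : ℕ) (ha : a < 32) (hb : b < 32)
    (h : ∀ i : Fin 5, a.testBit i.1 = b.testBit i.1) : a = b := by
  apply Nat.eq_of_testBit_eq
  intro i
  by_cases hi : i < 5
  · exact h ⟨i, hi⟩
  · have h32 : 32 ≤ 2 ^ i := by
      calc 32 = 2 ^ 5 := rfl
        _ ≤ 2 ^ i := Nat.pow_le_pow_right (by norm_num) (by omega)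
    rw [Nat.testBit_lt_two_pow (lt_of_lt_of_le ha h32), Nat.testBit_lt_two_pow (lt_of_lt_of_le hb h32)]

lemma Base.exists_pos {C : Submodule (ZMod 2) (Fin 32 → ZMod 2)} (h : Base C) :
    ∃ (u : Fin 5 → Fin 32 → ZMod 2) (A : Fin 32 → ℕ) (s : ℕ), (∀ i, u i ∈ C) ∧
      (∀ v, A v < 32) ∧ (∀ v (i : Fin 5), (A v).testBit i.1 = decide (u i v ≠ 0)) ∧
      (∀ v, v.1 < 12 → A v = A12.getD v.1 0) ∧ s < 32 ∧
      ∃ l ∈ xsJ, ∀ x ∈ l, ∃ v : Fin 32, 12 ≤ v.1 ∧ A v = s ^^^ x := by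
  classical
  obtain ⟨u0, hu0, hup, hz⟩ := h.exists_u
  let u : Fin 5 → Fin 32 → ZMod 2 := fun i => u0 (Fin.castLE (by norm_num) i)
  have hu : ∀ i, u i ∈ C := fun i => hu0 _
  let A : Fin 32 → ℕ := fun v => Nat.ofBits (fun i : Fin 5 => decide (u i v ≠ 0))
  have hA : ∀ v, A v < 32 := fun v => Nat.ofBits_lt_two_pow (n := 5) _
  have hAb : ∀ v (i : Fin 5), (A v).testBit i.1 = decide (u i v ≠ 0) := by
    intro v i
    simp only [A]
    rw [Nat.testBit_ofBits_lt _ _ i.2]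
  have hA12 : ∀ v : Fin 32, v.1 < 12 → A v = A12.getD v.1 0 := by
    intro v hv
    apply eq_of_bits5 _ _ (hA v) (A12_spec v.1 hv).1
    intro i
    rw [hAb, (A12_spec v.1 hv).2 i]
    have := h.u_vals u0 hu0 hup i v hv
    simp only [u, this]
    split_ifs with hc <;> simp [hc]
  have hinj : ∀ v w : Fin 32, 12 ≤ v.1 → 12 ≤ w.1 → A v = A w → v = w := by
    intro v w hv hw e
    refine h.sepT u0 hu0 hup v w hv hw fun i hi => ?_
    have h1 := hAb v ⟨i.1, hi⟩
    have h2 := hAb w ⟨i.1, hi⟩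
    rw [e, h2, decide_eq_decide] at h1
    have e3 : u ⟨i.1, hi⟩ = u0 i := rfl
    rw [e3] at h1
    rcases zmod2_cases (u0 i v) with e | e <;> rcases zmod2_cases (u0 i w) with e' | e' <;>
      simp [e, e'] at h1 ⊢
  have hA0 : A 12 = 0 := by
    apply eq_of_bits5 _ _ (hA 12) (by norm_num)
    intro i
    rw [hAb]
    simp [u, hz]
  set M := posM A with hM
  have hMlt : M < 2 ^ 32 := posM_lt A
  have hubit : ∀ (i : Fin 5) (v : Fin 32), (if (A v).testBit i.1 then (1 : ZMod 2) else 0) = u i v := by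
    intro i v
    rw [hAb]
    rcases zmod2_cases (u i v) with e | e <;> simp [e]
  -- parity checks
  have hbasic : ∀ r ∈ basicM, par (M ^^^ 2 ^ 32) r = 0 := by
    intro r hr
    rw [par_xor_left, par_two_pow]
    rcases basicM_spec r hr with rfl | rfl | ⟨i, h1, h2⟩ | ⟨i, j, hij, h1, h2⟩
    · rw [posM_par A hA hinj, Finset.sum_congr rfl (g := fun _ => (1 : ZMod 2))]
      · rw [Finset.sum_const, card_last20]; decide +kernel
      · intro v _
        rw [if_pos]
        rw [show (4294967295 : ℕ) = 2 ^ 32 - 1 from rfl, Nat.testBit_two_pow_sub_one]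
        simpa using hA v
    · have h0 : M.testBit 0 = true := by
        rw [hM, testBit_posM A 0 (by norm_num), decide_eq_true_eq]
        exact ⟨12, by decide, hA0⟩
      have h1 : par M 4294967297 = 1 := by
        unfold par
        rw [Finset.sum_eq_single 0]
        · rw [h0]; decide +kernel
        · intro b hb hb0
          rw [if_neg]
          intro hc
          rw [Bool.and_eq_true] at hc
          have hb' := Finset.mem_range.1 hb
          have hb32 : b = 32 := by
            by_contra hne
            have : ∀ b < 32, b ≠ 0 → Nat.testBit 4294967297 b = false := by decide +kernel
            rw [this b (by omega) hb0] at hc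
            simp at hc
          rw [hb32, Nat.testBit_lt_two_pow hMlt] at hc
          simp at hc
        · simp
      rw [h1]; decide +kernel
    · rw [posM_par A hA hinj, h2]
      simp only [Bool.false_eq_true, if_false, add_zero]
      have := h.even_mul (hu i) h.t
      rw [sum_split12] at this
      rw [Finset.sum_eq_zero (s := univ.filter (fun v : Fin 32 => v.1 < 12)), zero_add] at this
      · refine Eq.trans ?_ this
        refine Finset.sum_congr rfl fun v hv => ?_
        rw [h1 _ (hA v), hubit]
        simp [tV, (mem_filter.1 hv).2]
      · intro v hv
        have := (mem_filter.1 hv).2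
        rw [tV, if_neg (by omega), mul_zero]
    · rw [posM_par A hA hinj, h2]
      simp only [if_true]
      have := h.even_mul (hu i) (hu j)
      rw [sum_split12] at this
      have h12 : ∑ v ∈ univ.filter (fun v : Fin 32 => v.1 < 12), u i v * u j v = 1 := by
        rw [Finset.sum_eq_single 5]
        · rw [← hubit, ← hubit, hA12 5 (by decide)]
          have : ∀ i : Fin 5, (A12.getD (5 : Fin 32).1 0).testBit i.1 = true := by decide +kernel
          rw [this, this]; rfl
        · intro v hv hv5
          have hv' := (mem_filter.1 hv).2
          simp only [u]
          rw [h.u_vals u0 hu0 hup i v hv', h.u_vals u0 hu0 hup j v hv']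
          have h5 : v.1 ≠ 5 := fun e => hv5 (Fin.ext e)
          have hij' : i.1 ≠ j.1 := fun e => hij (Fin.ext e)
          by_cases hvi : v.1 = i.1
          · have : ¬ (v.1 = j.1 ∨ v.1 = 5) := by omega
            rw [if_neg this, mul_zero]
          · have : ¬ (v.1 = i.1 ∨ v.1 = 5) := by omega
            rw [if_neg this, zero_mul]
        · intro hn; exact absurd (by simp) hn
      rw [h12] at this
      have e : ∑ v ∈ univ.filter (fun v : Fin 32 => 12 ≤ v.1), (if r.testBit (A v) then (1 : ZMod 2) else 0)
          = ∑ v ∈ univ.filter (fun v : Fin 32 => 12 ≤ v.1), u i v * u j v := by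
        refine Finset.sum_congr rfl fun v _ => ?_
        rw [h1 _ (hA v), ← hubit, ← hubit]
        cases (A v).testBit i.1 <;> cases (A v).testBit j.1 <;> simp
      rw [e, z2_eq this]; decide
  have hspan : ∃ m, M ^^^ M00 = xcomb (colsM.map Prod.snd) m := by
    refine span_lemma 32 (by norm_num) colsM (redM.map (fun r => (r.1, r.2.1))) (M ^^^ M00)
      (Nat.xor_lt_two_pow hMlt (by decide)) colsM_pair colsM_spec colsM_red ?_ ?_ redM_cov
    · intro r hr
      obtain ⟨q, hq, rfl⟩ := List.mem_map.1 hr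
      have hs := redM_spec q hq
      have h1 : par (M ^^^ 2 ^ 32) q.2.1 = 0 := by
        rw [hs.1, par_comm]
        exact par_xcomb _ _ _ fun w hw => by rw [par_comm]; exact hbasic w hw
      rw [par_xor_left] at h1 ⊢
      simp only [hs.2.1]
      exact h1
    · intro r hr
      obtain ⟨q, hq, rfl⟩ := List.mem_map.1 hr
      exact (redM_spec q hq).2.2
  obtain ⟨m, hm⟩ := hspan
  have hMe : M = M00 ^^^ xcomb (colsM.map Prod.snd) m := by
    rw [← hm, Nat.xor_comm M, ← Nat.xor_assoc, Nat.xor_self, Nat.zero_xor]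
  have htest : testM M = true := by
    rw [hMe]; exact allSpan_spec _ _ _ testM_all m
  have hpop : popc M = 20 := by
    have := posM_popc A hA hinj (2 ^ 32 - 1)
    rw [Nat.and_two_pow_sub_one_eq_mod, Nat.mod_eq_of_lt hMlt] at this
    rw [this, Finset.sum_congr rfl (g := fun _ => 1)]
    · rw [Finset.sum_const, card_last20]; rfl
    · intro v _
      rw [Nat.testBit_two_pow_sub_one]
      simp [hA v]
  have hok : okMl wcondM M = true := by
    apply okMl_of
    intro p hp
    obtain ⟨hc, a, ha, hab⟩ := wcondM_spec p hp
    let x : Fin 32 → ZMod 2 := ∑ i : Fin 5, (if a.testBit i.1 then (1 : ZMod 2) else 0) • u i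
    have hx : x ∈ C := C.sum_mem fun i _ => C.smul_mem _ (hu i)
    have hxv : ∀ v, p.2.testBit (A v) = decide (x v ≠ 0) := by
      intro v
      rw [hab _ (hA v)]
      have : bil a (A v) = x v := by
        simp only [x, bil, Finset.sum_apply, Pi.smul_apply, smul_eq_mul]
        refine Finset.sum_congr rfl fun i _ => ?_
        rw [← hubit]
        cases a.testBit i.1 <;> cases (A v).testBit i.1 <;> simp
      rw [this]
    have hfirst : ∑ v ∈ univ.filter (fun v : Fin 32 => v.1 < 12), (p.2.testBit (A v)).toNat = p.1 := by
      rw [sum_first12, ← hc, hA12 0 (by decide), hA12 1 (by decide), hA12 2 (by decide),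
        hA12 3 (by decide), hA12 4 (by decide), hA12 5 (by decide), hA12 6 (by decide),
        hA12 7 (by decide), hA12 8 (by decide), hA12 9 (by decide), hA12 10 (by decide),
        hA12 11 (by decide)]
      simp only [A12, cstM]
      simp
      omega
    have hwx : wt x = p.1 + popc (M &&& p.2) := by
      rw [posM_popc A hA hinj, ← hfirst, ← sum_split12, wt, Finset.card_filter]
      refine Finset.sum_congr rfl fun v _ => ?_
      rw [hxv]
      by_cases e : x v = 0 <;> simp [e]
    have hwxt : wt (x * tV) = popc (M &&& p.2) := by
      rw [posM_popc A hA hinj, wt, Finset.card_filter, sum_split12, Finset.sum_eq_zero, zero_add]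
      · refine Finset.sum_congr rfl fun v hv => ?_
        rw [hxv]
        simp only [Pi.mul_apply, tV, (mem_filter.1 hv).2, if_true, mul_one]
        by_cases e : x v = 0 <;> simp [e]
      · intro v hv
        have := (mem_filter.1 hv).2
        simp [tV]; omega
    have h2 := wt_add x tV
    rw [hwxt, wt_tV, hwx] at h2
    refine ⟨okw_of (hwx ▸ h.wts x hx), okw_of ?_⟩
    have h3 := h.wts _ (C.add_mem hx h.t)
    have : p.1 + 20 - popc (M &&& p.2) = wt (x + tV) := by omega
    rw [this]; exact h3
  unfold testM at htest
  rw [hpop, hok] at htest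
  simp only [Nat.beq_refl, Bool.not_true, Bool.false_or, List.any_eq_true, List.mem_range] at htest
  obtain ⟨s, hs, l, hl, hal⟩ := htest
  refine ⟨u, A, s, hu, hA, hAb, hA12, hs, l, hl, fun x hx => ?_⟩
  have h1 := allPos_spec M s l hal x hx
  by_cases hlt : s ^^^ x < 32
  · rw [hM, testBit_posM A _ hlt, decide_eq_true_eq] at h1
    exact h1
  · rw [Nat.testBit_lt_two_pow (lt_of_lt_of_le hMlt (Nat.pow_le_pow_right (by norm_num) (by omega)))] at h1
    simp at h1

lemma pull_pull {ι κ μ : Type*} (a : ι ≃ κ) (b : κ ≃ μ) (C : Submodule (ZMod 2) (μ → ZMod 2)) :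
    pull a (pull b C) = pull (a.trans b) C := by
  ext y
  simp only [mem_pull]
  rfl

lemma Base.exists_std {C : Submodule (ZMod 2) (Fin 32 → ZMod 2)} (h : Base C) :
    ∃ π : Equiv.Perm (Fin 32), Base (_root_.pull π C) ∧ ∀ w ∈ stdW, vec w ∈ _root_.pull π C := by
  classical
  obtain ⟨u, A, s, hu, hA, hAb, hA12, hs, l, hl, hpos⟩ := h.exists_pos
  obtain ⟨q, hq, rfl⟩ := swapD_ex l hl
  obtain ⟨hlen, hnd, hlt, hlen5⟩ := swapD_len q hq
  have hget : ∀ i : Fin 32, 12 ≤ i.1 → q.1.getD (i.1 - 12) 0 ∈ q.1 := by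
    intro i hi
    rw [List.getD_eq_getElem _ _ (by omega)]
    exact List.getElem_mem _
  have hex : ∀ i : Fin 32, ∃ v : Fin 32, (i.1 < 12 → v = i) ∧
      (12 ≤ i.1 → 12 ≤ v.1 ∧ A v = s ^^^ q.1.getD (i.1 - 12) 0) := by
    intro i
    by_cases hi : i.1 < 12
    · exact ⟨i, fun _ => rfl, fun h => by omega⟩
    · obtain ⟨v, hv, hv'⟩ := hpos _ (hget i (by omega))
      exact ⟨v, fun h => absurd h hi, fun _ => ⟨hv, hv'⟩⟩
  choose p hp1 hp2 using hex
  have hinj : Function.Injective p := by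
    intro i j hij
    by_cases hi : i.1 < 12 <;> by_cases hj : j.1 < 12
    · rw [← hp1 i hi, ← hp1 j hj, hij]
    · have h1 := (hp2 j (by omega)).1
      rw [← hij, hp1 i hi] at h1
      omega
    · have h1 := (hp2 i (by omega)).1
      rw [hij, hp1 j hj] at h1
      omega
    · have h1 := (hp2 i (by omega)).2
      have h2 := (hp2 j (by omega)).2
      rw [hij, h2] at h1
      have h3 := Nat.xor_right_injective h1
      rw [List.getD_eq_getElem _ _ (by omega), List.getD_eq_getElem _ _ (by omega)] at h3
      have := (List.Nodup.getElem_inj_iff hnd).1 h3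
      exact Fin.ext (by omega)
  let π : Equiv.Perm (Fin 32) := Equiv.ofBijective p
    ⟨hinj, Finite.injective_iff_surjective.1 hinj⟩
  have hπ : ∀ i, π i = p i := fun _ => rfl
  have hB : Base (_root_.pull π C) := by
    apply h.pull π
    · intro i
      rw [hπ]
      by_cases hi : i.1 < 12
      · rw [hp1 i hi]
      · have := (hp2 i (by omega)).1
        omega
    · intro i
      rw [hπ]
      by_cases hi : i.1 < 12
      · rw [hp1 i hi]
      · have := (hp2 i (by omega)).1
        omega
  have hws : ∀ w ∈ q.2.1, vec w ∈ _root_.pull π C := by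
    intro w hw
    obtain ⟨i, hi, rfl⟩ := List.getElem_of_mem hw
    have hwd := swapD_words q hq ⟨i, by omega⟩
    simp only at hwd
    rw [List.getD_eq_getElem _ _ (by omega)] at hwd
    let i5 : Fin 5 := ⟨i, by omega⟩
    let y : Fin 32 → ZMod 2 := u i5 + (if s.testBit i then (1 : ZMod 2) else 0) • tV
    have hy : y ∈ C := C.add_mem (hu _) (C.smul_mem _ h.t)
    have : vec q.2.1[i] = y ∘ π := by
      rw [vec_eq_iff]
      intro j
      rw [hwd j]
      simp only [Function.comp, hπ, y, Pi.add_apply, Pi.smul_apply, smul_eq_mul]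
      split_ifs with hj hsi hsi
      · rw [hp1 j hj, tV, if_neg (by omega), mul_zero, add_zero, ← hAb, hA12 j hj,
          (A12_spec j.1 hj).2]
      · rw [hp1 j hj, zero_mul, add_zero, ← hAb, hA12 j hj, (A12_spec j.1 hj).2]
      · obtain ⟨h1, h2⟩ := hp2 j (by omega)
        have h3 := hAb (p j) i5
        rw [h2, Nat.testBit_xor, hsi] at h3
        rw [tV, if_pos h1]
        generalize (q.1.getD (j.1 - 12) 0).testBit i = b at *
        rcases zmod2_cases (u i5 (p j)) with e | e <;> rw [e] at h3 ⊢ <;> cases b <;> simp_all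
        decide
      · obtain ⟨h1, h2⟩ := hp2 j (by omega)
        have h3 := hAb (p j) i5
        rw [h2, Nat.testBit_xor] at h3
        have hsi' : s.testBit i5.1 = false := by simpa using hsi
        rw [hsi', Bool.false_xor] at h3
        rw [zero_mul, add_zero]
        exact h3
    rw [this]
    exact comp_mem_pull π hy
  obtain ⟨hok, hsw⟩ := swapD_perm q hq
  obtain ⟨σ, hσ1, hσ2⟩ := exists_perm _ hok
  refine ⟨σ.symm.trans π, ?_, ?_⟩
  · rw [← pull_pull]
    apply hB.pull
    · intro i
      have := (hsw (σ.symm i)).1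
      rw [← hσ2, Equiv.apply_symm_apply] at this
      exact this.symm
    · intro i
      have := (hsw (σ.symm i)).2
      rw [← hσ2, Equiv.apply_symm_apply] at this
      exact this.symm
  · intro w hw
    rw [← pull_pull, mem_pull, Equiv.symm_symm, ← hσ1]
    obtain ⟨m, -, hm⟩ := swapD_std q hq w hw
    rw [hm]
    apply vec_xcomb_mem
    intro w hw
    rcases List.mem_append.1 hw with hw | hw
    · exact hws w hw
    · simp only [List.mem_cons, List.not_mem_nil, or_false] at hw
      rcases hw with rfl | rfl
      · rw [vec_tV]; exact hB.t
      · rw [vec_one]; exact hB.one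

/-! ### Words with support of size two in the second block -/

/-- Parity checks on the last 20 positions. -/
def basicT : List ℕ :=
    [186933, 218026, 236748, 270095, 532464, 1048575, 8192]

/-- Reduced parity checks. -/
def redT : List (ℕ × ℕ × ℕ) :=
    [(13, 8192, 64), (14, 17356, 124), (15, 36010, 122), (16, 66869, 121), (17, 136531, 7),
     (18, 270095, 8), (19, 532464, 16)]

/-- The fifteen patterns of weight two on the second block. -/
def patL : List ℕ :=
    [192, 320, 576, 1088, 2112, 384, 640, 1152, 2176, 768, 1280, 2304, 1536, 2560, 3072]

/-- The word with given first 12 and last 20 positions. -/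
def wd (L n : ℕ) : ℕ := 2 ^ 12 * n + L

lemma testBit_wd (L n i : ℕ) (hL : L < 2 ^ 12) :
    (wd L n).testBit i = if i < 12 then L.testBit i else n.testBit (i - 12) :=
  Nat.testBit_two_pow_mul_add n hL i

lemma wd_xor (L n L' n' : ℕ) (hL : L < 2 ^ 12) (hL' : L' < 2 ^ 12) :
    wd L n ^^^ wd L' n' = wd (L ^^^ L') (n ^^^ n') := by
  apply Nat.eq_of_testBit_eq
  intro i
  rw [Nat.testBit_xor, testBit_wd _ _ _ hL, testBit_wd _ _ _ hL',
    testBit_wd _ _ _ (Nat.xor_lt_two_pow hL hL'), Nat.testBit_xor, Nat.testBit_xor]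
  split_ifs <;> rfl

lemma wd_lt (L n : ℕ) (hL : L < 2 ^ 12) (hn : n < 2 ^ 20) : wd L n < 2 ^ 32 := by
  unfold wd; omega

lemma popc_wd (L n : ℕ) (hL : L < 2 ^ 12) (hn : n < 2 ^ 20) :
    popc (wd L n) = popc L + popc n := by
  have e1 : popc L = ∑ i ∈ range 12, (L.testBit i).toNat := by
    rw [popc_eq, show (32 : ℕ) = 12 + 20 from rfl, Finset.sum_range_add,
      Finset.sum_eq_zero (s := range 20), add_zero]
    intro i _
    rw [Nat.testBit_lt_two_pow (lt_of_lt_of_le hL (Nat.pow_le_pow_right (by norm_num) (by omega)))]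
    rfl
  have e2 : popc n = ∑ i ∈ range 20, (n.testBit i).toNat := by
    rw [popc_eq, show (32 : ℕ) = 20 + 12 from rfl, Finset.sum_range_add,
      Finset.sum_eq_zero (s := range 12), add_zero]
    intro i _
    rw [Nat.testBit_lt_two_pow (lt_of_lt_of_le hn (Nat.pow_le_pow_right (by norm_num) (by omega)))]
    rfl
  rw [e1, e2, popc_eq, show (32 : ℕ) = 12 + 20 from rfl, Finset.sum_range_add]
  have a1 : ∑ i ∈ range 12, ((wd L n).testBit i).toNat = ∑ i ∈ range 12, (L.testBit i).toNat := by
    refine Finset.sum_congr rfl fun i hi => ?_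
    rw [testBit_wd _ _ _ hL, if_pos (Finset.mem_range.1 hi)]
  have a2 : ∑ i ∈ range 20, ((wd L n).testBit (12 + i)).toNat =
      ∑ i ∈ range 20, (n.testBit i).toNat := by
    refine Finset.sum_congr rfl fun i hi => ?_
    rw [testBit_wd _ _ _ hL, if_neg (by omega : ¬ 12 + i < 12), Nat.add_sub_cancel_left]
  rw [a1, a2]

lemma par_wd (L n L' n' : ℕ) (hL : L < 2 ^ 12) (hL' : L' < 2 ^ 12) (hn : n < 2 ^ 20)
    (h : L &&& L' = 0) : par (wd L n) (wd L' n') = par n n' := by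
  unfold par
  have e : ∑ i ∈ range 33, (if n.testBit i && n'.testBit i then (1 : ZMod 2) else 0) =
      ∑ i ∈ range 21, (if n.testBit i && n'.testBit i then (1 : ZMod 2) else 0) := by
    rw [show (33 : ℕ) = 21 + 12 from rfl, Finset.sum_range_add,
      Finset.sum_eq_zero (s := range 12), add_zero]
    intro i _
    rw [Nat.testBit_lt_two_pow (lt_of_lt_of_le hn (Nat.pow_le_pow_right (by norm_num) (by omega)))]
    rfl
  rw [e, show (33 : ℕ) = 12 + 21 from rfl, Finset.sum_range_add,
      Finset.sum_eq_zero (s := range 12), zero_add]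
  · refine Finset.sum_congr rfl fun i hi => ?_
    have hi' : ¬ 12 + i < 12 := by omega
    rw [testBit_wd _ _ _ hL, testBit_wd _ _ _ hL', if_neg hi', if_neg hi', Nat.add_sub_cancel_left]
  · intro i hi
    have hi' := Finset.mem_range.1 hi
    rw [testBit_wd _ _ _ hL, testBit_wd _ _ _ hL', if_pos hi', if_pos hi', ← Nat.testBit_and, h]
    simp

/-- Parity as a scalar product. -/
lemma par_vec (W S : ℕ) (hW : W < 2 ^ 32) : par W S = ∑ v, vec W v * vec S v := by
  unfold par
  rw [Finset.sum_range_succ, Nat.testBit_lt_two_pow hW, Finset.sum_range]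
  simp only [Bool.false_and, Bool.false_eq_true, if_false, add_zero]
  refine Finset.sum_congr rfl fun i _ => ?_
  unfold vec
  cases W.testBit i <;> cases S.testBit i <;> simp

lemma patL_spec : ∀ L ∈ patL, L < 2 ^ 12 ∧ L &&& 63 = 0 ∧ ∀ s < 64, popc (L ^^^ s) = popc s + 2 := by
  decide +kernel

lemma T64_spec : ∀ p ∈ T64, p.2 < 2 ^ 20 ∧ ∃ m < 64, ∃ s < 64, xcomb stdW m = wd s p.2 ∧
    popc s + 2 = p.1 := by
  decide +kernel

lemma basicT_spec : ∀ r ∈ basicT, r = 8192 ∨ r = 1048575 ∨ ∃ w ∈ stdW, ∃ s < 64, w = wd s r := by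
  decide +kernel

/-- The basis with its leading positions. -/
def colsTp : List (ℕ × ℕ) := (List.range 13).zip colsT

lemma redT_spec : ∀ r ∈ redT, r.2.1 = xcomb basicT r.2.2 ∧
    r.2.1.testBit r.1 = true ∧ r.1 < 20 ∧
    ∀ i < 20, i ≠ r.1 → r.2.1.testBit i = true → i ∈ colsTp.map Prod.fst := by decide +kernel

lemma redT_cov : ∀ i < 20, i ∈ colsTp.map Prod.fst ∨
    i ∈ (redT.map (fun r => (r.1, r.2.1))).map Prod.fst := by decide +kernel

lemma colsT_pair : colsTp.Pairwise fun a b => b.2.testBit a.1 = false := by decide +kernel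

lemma colsT_spec : ∀ a ∈ colsTp, a.2.testBit a.1 = true ∧ a.2 < 2 ^ 20 := by decide +kernel

lemma colsT_red : ∀ a ∈ colsTp, ∀ r ∈ redT.map (fun r => (r.1, r.2.1)), par a.2 r.2 = 0 := by
  decide +kernel

lemma colsT_snd : colsTp.map Prod.snd = colsT := by decide +kernel

lemma colsT_key : allSpan (fun n => Nat.beq n (xcomb colsT (Nat.land 8191 n))) colsT 0 = true := by
  decide +kernel

/-- A base code containing the standard words. -/
structure StdC (C : Submodule (ZMod 2) (Fin 32 → ZMod 2)) : Prop where
  base : Base C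
  std : ∀ w ∈ stdW, vec w ∈ C

lemma okTl_of (l : List (ℕ × ℕ)) (n : ℕ)
    (h : ∀ p ∈ l, okw (p.1 + popc (n ^^^ p.2)) = true) : okTl l n = true := by
  induction l with
  | nil => rfl
  | cons p l ih =>
    obtain ⟨c, m⟩ := p
    simp only [okTl, Bool.and_eq_true]
    exact ⟨h (c, m) (by simp), ih fun p hp => h p (by simp [hp])⟩

/-- A normalized word with a given pattern of weight two. -/
structure PairW (C : Submodule (ZMod 2) (Fin 32 → ZMod 2)) (L n : ℕ) : Prop where
  pat : L ∈ patL
  lt : n < 2 ^ 20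
  zero : n.testBit 13 = false
  mem : vec (wd L n) ∈ C

lemma PairW.ok {C : Submodule (ZMod 2) (Fin 32 → ZMod 2)} (h : StdC C) {L n : ℕ}
    (hp : PairW C L n) : n = xcomb colsT (Nat.land 8191 n) ∧ tb (Nat.land 8191 n) = true ∧
      (memB repsL (Nat.land 8191 n) || descB symL n) = true := by
  obtain ⟨hL, hL63, hLp⟩ := patL_spec L hp.pat
  have hLs : ∀ s < 64, L &&& s = 0 := by
    intro s hs
    have : s = 63 &&& s := by
      rw [Nat.and_comm, show (63 : ℕ) = 2 ^ 6 - 1 from rfl, Nat.and_two_pow_sub_one_eq_mod,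
        Nat.mod_eq_of_lt hs]
    rw [this, ← Nat.and_assoc, hL63, Nat.zero_and]
  have hbasic : ∀ r ∈ basicT, par n r = 0 := by
    have hone : par n 1048575 = 0 := by
      have h1 := h.base.even_mul hp.mem h.base.t
      rw [← vec_tV, ← par_vec _ _ (wd_lt L n hL hp.lt),
        show (4294963200 : ℕ) = wd 0 1048575 from rfl,
        par_wd _ _ _ _ hL (by norm_num) hp.lt (Nat.and_zero _)] at h1
      exact h1
    intro r hr
    rcases basicT_spec r hr with rfl | rfl | ⟨w, hw, s, hs, rfl⟩
    · unfold par
      refine Finset.sum_eq_zero fun i _ => ?_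
      rw [if_neg]
      rw [show (8192 : ℕ) = 2 ^ 13 from rfl, Nat.testBit_two_pow, Bool.and_eq_true, decide_eq_true_eq]
      rintro ⟨h1, rfl⟩
      rw [hp.zero] at h1
      simp at h1
    · exact hone
    · have h1 := h.base.even_mul hp.mem (h.std _ hw)
      rw [← par_vec _ _ (wd_lt L n hL hp.lt),
        par_wd _ _ _ _ hL (by omega) hp.lt (hLs s hs)] at h1
      exact h1
  have hspan : ∃ m, n = xcomb (colsTp.map Prod.snd) m := by
    refine span_lemma 20 (by norm_num) colsTp (redT.map (fun r => (r.1, r.2.1))) n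
      hp.lt colsT_pair colsT_spec colsT_red ?_ ?_ redT_cov
    · intro r hr
      obtain ⟨q, hq, rfl⟩ := List.mem_map.1 hr
      have hs := redT_spec q hq
      simp only [hs.1]
      rw [par_comm]
      exact par_xcomb _ _ _ fun w hw => by rw [par_comm]; exact hbasic w hw
    · intro r hr
      obtain ⟨q, hq, rfl⟩ := List.mem_map.1 hr
      exact (redT_spec q hq).2
  obtain ⟨m, hm⟩ := hspan
  rw [colsT_snd] at hm
  have h1 := allSpan_spec _ _ _ colsT_key m
  have h2 := allSpan_spec _ _ _ testL_all m
  rw [Nat.zero_xor, ← hm] at h1 h2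
  have hok : okTl T64 n = true := by
    apply okTl_of
    intro p hpT
    obtain ⟨hp2, m, -, s, hs, he, hc⟩ := T64_spec p hpT
    have hmem : vec (wd L n ^^^ wd s p.2) ∈ C := by
      rw [vec_xor, ← he]
      exact C.add_mem hp.mem (vec_xcomb_mem C _ h.std m)
    have hw := h.base.wts _ hmem
    have hs12 : s < 2 ^ 12 := by omega
    rw [wt_vec, wd_xor _ _ _ _ hL hs12, popc_wd _ _ (Nat.xor_lt_two_pow hL hs12)
      (Nat.xor_lt_two_pow hp.lt hp2), hLp s hs, hc] at hw
    exact okw_of hw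
  refine ⟨Nat.eq_of_beq_eq_true h1, ?_⟩
  unfold testL at h2
  rw [hok] at h2
  cases htb : tb (Nat.land 8191 n)
  · rw [htb] at h2; simp at h2
  · rw [htb] at h2
    exact ⟨rfl, h2⟩

/-- Generators of the first code. -/
def gold3 : List ℕ :=
    [2863311530, 3435973836, 4042322160, 4278255360, 4294901760, 4294967295, 4240463466,
     763833720, 2991450344, 2526622524, 3405161312]

/-- Generators of the second code. -/
def gold5 : List ℕ :=
    [2863311530, 3435973836, 4042322160, 4278255360, 4294901760, 4294967295, 1819068726,
     1273900424, 2769263052, 4123616160, 2222241720]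

/-- Final certificates: keys, type, permutation, coefficients. -/
def certD : List (List ℕ × Bool × List ℕ × List ℕ) := [
  (
    [342, 2794, 4259, 6088], true,
    [18, 0, 4, 19, 12, 9, 16, 17, 14, 11, 6, 2, 22, 5, 10, 20, 23, 24, 27, 3, 29, 8, 15, 1, 21,
     31, 30, 13, 26, 7, 25, 28],
    [1320, 470, 1483, 1584, 425, 64, 1487, 634, 342, 188, 1758]),
  (
    [342, 3004, 4597, 5790], true,
    [18, 0, 4, 19, 12, 9, 2, 17, 14, 11, 6, 16, 22, 5, 10, 20, 23, 24, 27, 3, 29, 8, 15, 1, 21,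
     31, 30, 13, 26, 7, 25, 28],
    [1320, 342, 1483, 1584, 297, 64, 1487, 762, 470, 188, 1758]),
  (
    [358, 2669, 4639, 5195], false,
    [20, 0, 9, 18, 2, 13, 3, 12, 1, 8, 19, 21, 30, 5, 15, 16, 10, 4, 17, 22, 29, 7, 31, 28, 25,
     14, 24, 23, 26, 11, 27, 6],
    [1403, 1863, 289, 1316, 2038, 64, 455, 887, 615, 987, 1421]),
  (
    [358, 2827, 4985, 5421], false,
    [20, 0, 9, 18, 2, 13, 21, 12, 1, 8, 19, 3, 30, 5, 15, 16, 10, 4, 17, 22, 29, 7, 31, 28, 25,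
     14, 24, 23, 26, 11, 27, 6],
    [1403, 1991, 417, 1316, 1910, 64, 327, 887, 743, 987, 1421]),
  (
    [406, 2767, 4445, 5964], false,
    [0, 13, 2, 9, 18, 20, 12, 1, 19, 21, 8, 3, 28, 14, 15, 6, 10, 16, 24, 31, 27, 5, 11, 23, 29,
     7, 26, 30, 17, 22, 25, 4],
    [1834, 564, 1186, 1909, 1552, 64, 235, 461, 1355, 1493, 837]),
  (
    [406, 2905, 4299, 5850], false,
    [0, 13, 2, 9, 18, 20, 3, 1, 19, 21, 8, 12, 28, 14, 15, 6, 10, 16, 24, 31, 27, 5, 11, 23, 29,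
     7, 26, 30, 17, 22, 25, 4],
    [1962, 692, 1058, 2037, 1552, 64, 235, 333, 1355, 1493, 837]),
  (
    [422, 3762, 5425, 5992], false,
    [0, 18, 9, 13, 2, 20, 1, 12, 8, 21, 19, 3, 11, 15, 24, 30, 27, 14, 16, 26, 28, 25, 10, 4, 7,
     29, 6, 31, 22, 17, 23, 5],
    [851, 2029, 1320, 812, 989, 64, 333, 501, 1229, 1491, 1806]),
  (
    [422, 3860, 5271, 5838], false,
    [0, 18, 9, 13, 2, 20, 3, 12, 8, 21, 19, 1, 11, 15, 24, 30, 27, 14, 16, 26, 28, 25, 10, 4, 7,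
     29, 6, 31, 22, 17, 23, 5],
    [851, 1901, 1320, 812, 989, 64, 461, 373, 1101, 1491, 1934]),
  (
    [598, 3548, 5297, 5973], true,
    [0, 18, 4, 19, 9, 12, 14, 16, 11, 2, 6, 17, 5, 22, 20, 10, 1, 15, 8, 29, 3, 27, 24, 23, 28,
     31, 30, 26, 13, 7, 25, 21],
    [568, 341, 1883, 688, 298, 64, 1871, 1273, 1109, 1340, 1997]),
  (
    [598, 3978, 5379, 5863], true,
    [0, 18, 4, 19, 9, 12, 17, 16, 2, 11, 6, 14, 5, 22, 20, 10, 1, 15, 8, 29, 3, 27, 24, 23, 28,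
     31, 30, 26, 13, 7, 25, 21],
    [1208, 469, 2011, 1072, 426, 64, 1999, 633, 725, 828, 1869]),
  (
    [678, 2379, 5079, 5600], true,
    [18, 0, 9, 12, 4, 19, 6, 16, 11, 17, 14, 2, 15, 21, 30, 31, 25, 5, 3, 27, 8, 29, 26, 7, 13,
     10, 20, 24, 28, 23, 1, 22],
    [1540, 1374, 1895, 1491, 1281, 64, 1875, 1969, 1150, 284, 1157]),
  (
    [678, 3053, 4465, 5958], true,
    [18, 0, 9, 12, 4, 19, 2, 16, 11, 17, 14, 6, 15, 21, 30, 31, 25, 5, 3, 27, 8, 29, 26, 7, 13,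
     10, 20, 24, 28, 23, 1, 22],
    [1540, 1374, 2023, 1491, 1281, 64, 2003, 1841, 1278, 412, 1029])]

/-- The words given by a list of four keys. -/
def fourW (s : List ℕ) : List ℕ :=
  stdW ++ List.zipWith (fun L k => wd L (xcomb colsT k)) [2112, 2176, 2304, 2560] s

lemma certD_perm : ∀ q ∈ certD, permOK q.2.2.1 = true := by decide +kernel

lemma certD_sol : ∀ s ∈ solL, ∃ q ∈ certD, q.1 = s := by decide +kernel

lemma certD_spec : ∀ q ∈ certD, ∀ g ∈ (if q.2.1 then gold3 else gold5), ∃ m ∈ q.2.2.2,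
    permN q.2.2.1 g = xcomb (fourW q.1) m := by decide +kernel

lemma filtK_eq (p : ℕ → Bool) (k : List ℕ → Bool) (l acc : List ℕ) :
    filtK p k l acc = k ((l.filter p).reverse ++ acc) := by
  induction l generalizing acc with
  | nil => rfl
  | cons a l ih =>
    rw [filtK, List.filter_cons]
    cases h : p a <;> simp [ih]

lemma srch3_spec {r d b c : ℕ} {l : List ℕ} (h : srch3 r d b l = true) (hc : c ∈ l)
    (h1 : tb (b ^^^ c) = true) (h2 : d < 5548 ^^^ (r ^^^ (b ^^^ (c ^^^ d))))
    (h3 : tb (5548 ^^^ (r ^^^ (b ^^^ (c ^^^ d)))) = true)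
    (h4 : tb (5548 ^^^ (b ^^^ (c ^^^ d))) = true)
    (h5 : tb (5548 ^^^ (r ^^^ (c ^^^ d))) = true)
    (h6 : tb (5548 ^^^ (r ^^^ (b ^^^ d))) = true)
    (h7 : tb (5548 ^^^ (r ^^^ (b ^^^ c))) = true) : [r, b, c, d] ∈ solL := by
  induction l with
  | nil => simp at hc
  | cons a l ih =>
    rw [srch3, Bool.and_eq_true] at h
    rcases List.mem_cons.1 hc with rfl | hc
    · have h2' : Nat.blt d (5548 ^^^ (r ^^^ (b ^^^ (c ^^^ d)))) = true := by
        rw [Nat.blt_eq]; exact h2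
      have h0 := h.1
      change (!(tb (b ^^^ c)) || !(Nat.blt d (5548 ^^^ (r ^^^ (b ^^^ (c ^^^ d)))))
        || !(tb (5548 ^^^ (r ^^^ (b ^^^ (c ^^^ d)))))
        || !(tb (5548 ^^^ (b ^^^ (c ^^^ d))))
        || !(tb (5548 ^^^ (r ^^^ (c ^^^ d))))
        || !(tb (5548 ^^^ (r ^^^ (b ^^^ d))))
        || !(tb (5548 ^^^ (r ^^^ (b ^^^ c))))
        || solL.any (fun s => s == [r, b, c, d])) = true at h0
      rw [h1, h2', h3, h4, h5, h6, h7] at h0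
      simp only [Bool.not_true, Bool.false_or, List.any_eq_true, beq_iff_eq] at h0
      obtain ⟨s, hs, rfl⟩ := h0
      exact hs
    · exact ih h.2 hc

lemma srch2_spec {r d b : ℕ} {l : List ℕ} (h : srch2 r d l = true)
    (hl : l.Pairwise (· < ·)) (hb : b ∈ l) :
    ∃ l', srch3 r d b l' = true ∧ ∀ x ∈ l, b < x → x ∈ l' := by
  induction l with
  | nil => simp at hb
  | cons a l ih =>
    rw [srch2, Bool.and_eq_true] at h
    rw [List.pairwise_cons] at hl
    rcases List.mem_cons.1 hb with rfl | hb2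
    · refine ⟨l, h.1, fun x hx hbx => ?_⟩
      rcases List.mem_cons.1 hx with rfl | hx
      · exact absurd hbx (lt_irrefl _)
      · exact hx
    · obtain ⟨l', h1, h2⟩ := ih h.2 hl.2 hb2
      refine ⟨l', h1, fun x hx hbx => ?_⟩
      rcases List.mem_cons.1 hx with rfl | hx
      · exact absurd hbx (hl.1 b hb2).asymm
      · exact h2 x hx hbx

lemma srch1_spec {r d : ℕ} {l : List ℕ} (h : srch1 r l = true)
    (hl : l.Pairwise (· > ·)) (hd : d ∈ l) :
    ∃ l' : List ℕ, srch2 r d (l'.filter (fun c => tb (d ^^^ c))).reverse = true ∧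
      l'.Pairwise (· > ·) ∧ ∀ x ∈ l, x < d → x ∈ l' := by
  induction l with
  | nil => simp at hd
  | cons a l ih =>
    rw [srch1, Bool.and_eq_true, filtK_eq, List.append_nil] at h
    rw [List.pairwise_cons] at hl
    rcases List.mem_cons.1 hd with rfl | hd2
    · refine ⟨l, h.1, hl.2, fun x hx hbx => ?_⟩
      rcases List.mem_cons.1 hx with rfl | hx
      · exact absurd hbx (lt_irrefl _)
      · exact hx
    · obtain ⟨l', h1, h2, h3⟩ := ih h.2 hl.2 hd2
      refine ⟨l', h1, h2, fun x hx hbx => ?_⟩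
      rcases List.mem_cons.1 hx with rfl | hx
      · exact absurd hbx (lt_asymm (hl.1 d hd2))
      · exact h3 x hx hbx

/-- Sortedness test. -/
def sortB : ℕ → List ℕ → Bool
  | _, [] => true
  | a, b :: l => Nat.blt a b && sortB b l

lemma sortB_spec (a : ℕ) (l : List ℕ) (h : sortB a l = true) :
    (a :: l).Pairwise (· < ·) := by
  induction l generalizing a with
  | nil => simp
  | cons b l ih =>
    rw [sortB, Bool.and_eq_true, Nat.blt_eq] at h
    have h1 := ih b h.2
    rw [List.pairwise_cons]
    refine ⟨fun x hx => ?_, h1⟩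
    rcases List.mem_cons.1 hx with rfl | hx
    · exact h.1
    · exact h.1.trans ((List.pairwise_cons.1 h1).1 x hx)

lemma LL_sortB : sortB 0 LL = true := by decide +kernel

lemma LL_sorted : LL.Pairwise (· < ·) := (List.pairwise_cons.1 (sortB_spec 0 LL LL_sortB)).2

lemma LB_eq : Nat.beq (maskL LL) LB = true := by decide +kernel

lemma mem_LL {k : ℕ} (h : tb k = true) : k ∈ LL := by
  rw [← testBit_maskL, Nat.eq_of_beq_eq_true LB_eq, ← testBit_eq_beq]
  exact h

lemma srch_sound {r b c d e : ℕ} (hr : r ∈ repsL)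
    (tb_b : tb b = true) (tb_c : tb c = true) (tb_d : tb d = true) (tb_e : tb e = true)
    (hbc : b < c) (hcd : c < d) (hde : d < e)
    (hs : r ^^^ (b ^^^ (c ^^^ (d ^^^ e))) = 5548)
    (rb : tb (r ^^^ b) = true) (rc : tb (r ^^^ c) = true) (rd : tb (r ^^^ d) = true)
    (re : tb (r ^^^ e) = true) (bc : tb (b ^^^ c) = true) (bd : tb (b ^^^ d) = true)
    (be : tb (b ^^^ e) = true) (cd : tb (c ^^^ d) = true) (ce : tb (c ^^^ e) = true)
    (de : tb (d ^^^ e) = true) : [r, b, c, d] ∈ solL := by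
  have h0 := List.all_eq_true.1 srch_all r hr
  rw [srch0, filtK_eq, List.append_nil] at h0
  have hm : ∀ x, tb x = true → tb (r ^^^ x) = true →
      x ∈ (LL.filter (fun b => tb (r ^^^ b))).reverse := by
    intro x h1 h2
    rw [List.mem_reverse, List.mem_filter]
    exact ⟨mem_LL h1, h2⟩
  obtain ⟨l', h1, h2, h3⟩ := srch1_spec h0 (by
    rw [List.pairwise_reverse]; exact LL_sorted.filter _) (hm d tb_d rd)
  have hm2 : ∀ x ∈ (LL.filter (fun b => tb (r ^^^ b))).reverse, x < d → tb (x ^^^ d) = true →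
      x ∈ (l'.filter (fun c => tb (d ^^^ c))).reverse := by
    intro x hx h4 h5
    rw [List.mem_reverse, List.mem_filter, Nat.xor_comm]
    exact ⟨h3 x hx h4, h5⟩
  obtain ⟨l'', h4, h5⟩ := srch2_spec h1 (by
    rw [List.pairwise_reverse]; exact h2.filter _) (hm2 b (hm b tb_b rb) (hbc.trans hcd) bd)
  have he : 5548 ^^^ (r ^^^ (b ^^^ (c ^^^ d))) = e := by
    rw [← hs]
    simp [Nat.xor_comm, Nat.xor_left_comm]
  have x1 : 5548 ^^^ (b ^^^ (c ^^^ d)) = r ^^^ e := by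
    rw [← hs]; simp [Nat.xor_comm, Nat.xor_left_comm]
  have x2 : 5548 ^^^ (r ^^^ (c ^^^ d)) = b ^^^ e := by
    rw [← hs]; simp [Nat.xor_comm, Nat.xor_left_comm]
  have x3 : 5548 ^^^ (r ^^^ (b ^^^ d)) = c ^^^ e := by
    rw [← hs]; simp [Nat.xor_comm, Nat.xor_left_comm]
  have x4 : 5548 ^^^ (r ^^^ (b ^^^ c)) = d ^^^ e := by
    rw [← hs]; simp [Nat.xor_comm, Nat.xor_left_comm]
  exact srch3_spec h4 (h5 c (hm2 c (hm c tb_c rc) hcd cd) hbc) bc (by rw [he]; exact hde)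
    (by rw [he]; exact tb_e) (by rw [x1]; exact re) (by rw [x2]; exact be) (by rw [x3]; exact ce)
    (by rw [x4]; exact de)

lemma wd_split (L W : ℕ) (hL : L < 2 ^ 12)
    (h : ∀ i < 12, W.testBit i = L.testBit i) : W = wd L (W >>> 12) := by
  apply Nat.eq_of_testBit_eq
  intro i
  rw [testBit_wd _ _ _ hL]
  split_ifs with hi
  · exact h i hi
  · rw [Nat.testBit_shiftRight]
    congr 1; omega

lemma shift_lt {W : ℕ} (h : W < 2 ^ 32) : W >>> 12 < 2 ^ 20 := by
  rw [Nat.shiftRight_eq_div_pow]; omega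

lemma norm20_spec {C : Submodule (ZMod 2) (Fin 32 → ZMod 2)} (h : StdC C) {L n : ℕ}
    (hp : L ∈ patL) (hn : n < 2 ^ 20) (hm : vec (wd L n) ∈ C) : PairW C L (norm20 n) := by
  obtain ⟨hL, -, -⟩ := patL_spec L hp
  unfold norm20
  rw [testBit_eq_beq]
  cases hb : n.testBit 13
  · exact ⟨hp, hn, hb, hm⟩
  · refine ⟨hp, Nat.xor_lt_two_pow hn (by norm_num), ?_, ?_⟩
    · change (n ^^^ 1048575).testBit 13 = false
      rw [Nat.testBit_xor, hb]; decide
    · change vec (wd L (n ^^^ 1048575)) ∈ C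
      have e : wd L (n ^^^ 1048575) = wd L n ^^^ 4294963200 := by
        rw [show (4294963200 : ℕ) = wd 0 1048575 from rfl, wd_xor _ _ _ _ hL (by norm_num),
          Nat.xor_zero]
      rw [e, vec_xor, vec_tV]
      exact C.add_mem hm h.base.t

lemma patL_par : ∀ L ∈ patL, vec L 5 = vec L 0 + vec L 1 + vec L 2 + vec L 3 + vec L 4 ∧
    vec L 11 = vec L 6 + vec L 7 + vec L 8 + vec L 9 + vec L 10 := by decide +kernel

lemma exists_pairW {C : Submodule (ZMod 2) (Fin 32 → ZMod 2)} (h : StdC C) {L : ℕ}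
    (hp : L ∈ patL) : ∃ n, PairW C L n := by
  obtain ⟨hL, -, -⟩ := patL_spec L hp
  obtain ⟨p5, p11⟩ := patL_par L hp
  obtain ⟨x, hx, hk⟩ := h.base.patt fun k => vec L (ten k)
  have h5 := h.base.x5 hx
  have h11 := h.base.x11 hx
  have e0 : x 0 = vec L 0 := hk 0
  have e1 : x 1 = vec L 1 := hk 1
  have e2 : x 2 = vec L 2 := hk 2
  have e3 : x 3 = vec L 3 := hk 3
  have e4 : x 4 = vec L 4 := hk 4
  have e6 : x 6 = vec L 6 := hk 5
  have e7 : x 7 = vec L 7 := hk 6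
  have e8 : x 8 = vec L 8 := hk 7
  have e9 : x 9 = vec L 9 := hk 8
  have e10 : x 10 = vec L 10 := hk 9
  have e5 : x 5 = vec L 5 := by rw [h5, p5, e0, e1, e2, e3, e4]
  have e11 : x 11 = vec L 11 := by rw [h11, p11, e6, e7, e8, e9, e10]
  have hall : ∀ i : ℕ, ∀ hi : i < 12, x ⟨i, by omega⟩ = vec L ⟨i, by omega⟩ := by
    intro i hi
    interval_cases i <;> assumption
  have hW : toN x = wd L (toN x >>> 12) := by
    refine wd_split L _ hL fun i hi => ?_
    have h1 := testBit_toN x ⟨i, by omega⟩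
    rw [hall i hi] at h1
    change (toN x).testBit i = _ at h1
    rw [h1]
    unfold vec
    cases L.testBit i <;> simp
  exact ⟨_, norm20_spec h hp (shift_lt (toN_lt x)) (by rw [← hW, vec_toN]; exact hx)⟩

lemma uniqW {C : Submodule (ZMod 2) (Fin 32 → ZMod 2)} (h : StdC C) {L n n' : ℕ}
    (hL : L < 2 ^ 12) (hn : n < 2 ^ 20) (hn' : n' < 2 ^ 20) (h0 : n.testBit 13 = false)
    (h0' : n'.testBit 13 = false) (hm : vec (wd L n) ∈ C) (hm' : vec (wd L n') ∈ C) :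
    n = n' := by
  have h1 := C.add_mem hm hm'
  rw [← vec_xor, wd_xor _ _ _ _ hL hL, Nat.xor_self] at h1
  have hz : ∀ i : Fin 32, i.1 < 12 → vec (wd 0 (n ^^^ n')) i = 0 := by
    intro i hi
    unfold vec
    rw [testBit_wd _ _ _ (by norm_num), if_pos hi]
    simp
  have hv : ∀ i, ∀ hi : i < 20, vec (wd 0 (n ^^^ n')) ⟨12 + i, by omega⟩ =
      if (n ^^^ n').testBit i then 1 else 0 := by
    intro i hi
    unfold vec
    rw [testBit_wd _ _ _ (by norm_num), if_neg (by omega : ¬ 12 + i < 12), Nat.add_sub_cancel_left]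
  rcases h.base.ker h1 hz with e | e
  · apply Nat.eq_of_testBit_eq
    intro i
    rcases lt_or_ge i 20 with hi | hi
    · have h2 := hv i hi
      rw [e, Nat.testBit_xor] at h2
      revert h2
      cases n.testBit i <;> cases n'.testBit i <;> simp
    · have hp : 2 ^ 20 ≤ 2 ^ i := Nat.pow_le_pow_right (by norm_num) hi
      rw [Nat.testBit_lt_two_pow (by omega), Nat.testBit_lt_two_pow (by omega)]
  · exfalso
    have h2 := hv 13 (by norm_num)
    rw [e, Nat.testBit_xor, h0, h0'] at h2
    simp [tV] at h2

/-- The code contains a copy of one of the two generator sets. -/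
def HasGold (C : Submodule (ZMod 2) (Fin 32 → ZMod 2)) : Prop :=
  ∃ σ : Equiv.Perm (Fin 32), (∀ g ∈ gold3, vec g ∘ σ ∈ C) ∨ (∀ g ∈ gold5, vec g ∘ σ ∈ C)

lemma HasGold.of_pull {C : Submodule (ZMod 2) (Fin 32 → ZMod 2)} {π : Equiv.Perm (Fin 32)}
    (h : HasGold (pull π C)) : HasGold C := by
  obtain ⟨σ, h⟩ := h
  refine ⟨π.symm.trans σ, h.imp ?_ ?_⟩ <;>
  · intro h g hg
    have := mem_pull.1 (h g hg)
    exact this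

lemma land_xor8191 (a b : ℕ) : Nat.land 8191 (a ^^^ b) = Nat.land 8191 a ^^^ Nat.land 8191 b := by
  change 8191 &&& (a ^^^ b) = (8191 &&& a) ^^^ (8191 &&& b)
  exact Nat.and_xor_distrib_left ..

/-- The patterns of the five words. -/
def pj (j : Fin 5) : ℕ := 2 ^ (6 + j.1) + 2 ^ 11

lemma pj_mem : ∀ j, pj j ∈ patL := by decide +kernel

lemma pj_xor : ∀ i j, i ≠ j → pj i ^^^ pj j ∈ patL := by decide +kernel

lemma pj_lt : ∀ j, pj j < 2 ^ 12 := by decide +kernel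

/-- The sum of all standard words except the last one. -/
def zw : ℕ := norm20 (xcomb stdW 127 >>> 12)

lemma zw_spec : vec (xcomb stdW 127) = vec (wd 4032 (xcomb stdW 127 >>> 12)) ∧
    xcomb stdW 127 >>> 12 < 2 ^ 20 ∧ (zw = xcomb stdW 127 >>> 12 ∨
    wd 4032 zw = xcomb stdW 127 ^^^ 4294963200) ∧ zw < 2 ^ 20 ∧ zw.testBit 13 = false ∧
    Nat.land 8191 zw = 5548 := by
  decide +kernel

lemma key_sum {C : Submodule (ZMod 2) (Fin 32 → ZMod 2)} (h : StdC C) {n : Fin 5 → ℕ}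
    (hn : ∀ j, PairW C (pj j) (n j)) :
    n 0 ^^^ (n 1 ^^^ (n 2 ^^^ (n 3 ^^^ n 4))) = zw := by
  obtain ⟨z1, z2, z3, z4, z5, -⟩ := zw_spec
  have hx : ∀ {a b}, a < 2 ^ 20 → b < 2 ^ 20 → a ^^^ b < 2 ^ 20 := Nat.xor_lt_two_pow
  refine uniqW h (L := 4032) (by norm_num)
    (hx (hn 0).lt (hx (hn 1).lt (hx (hn 2).lt (hx (hn 3).lt (hn 4).lt)))) z4 ?_ z5 ?_ ?_
  · simp only [Nat.testBit_xor, (hn 0).zero, (hn 1).zero, (hn 2).zero, (hn 3).zero, (hn 4).zero]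
    rfl
  · have e : wd 4032 (n 0 ^^^ (n 1 ^^^ (n 2 ^^^ (n 3 ^^^ n 4)))) =
        wd (pj 0) (n 0) ^^^ (wd (pj 1) (n 1) ^^^ (wd (pj 2) (n 2) ^^^
          (wd (pj 3) (n 3) ^^^ wd (pj 4) (n 4)))) := by
      rw [wd_xor _ _ _ _ (pj_lt _) (pj_lt _), wd_xor _ _ _ _ (pj_lt _) (by decide),
        wd_xor _ _ _ _ (pj_lt _) (by decide), wd_xor _ _ _ _ (pj_lt _) (by decide)]
      rfl
    rw [e, vec_xor, vec_xor, vec_xor, vec_xor]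
    exact C.add_mem (hn 0).mem (C.add_mem (hn 1).mem (C.add_mem (hn 2).mem
      (C.add_mem (hn 3).mem (hn 4).mem)))
  · have hm := vec_xcomb_mem C stdW h.std 127
    rcases z3 with e | e
    · rw [e, ← z1]; exact hm
    · rw [e, vec_xor, vec_tV]; exact C.add_mem hm h.base.t

lemma symL_perm : ∀ p ∈ symL, permOK p.1 = true := by decide +kernel

lemma symL_block : ∀ p ∈ symL, ∀ i : Fin 32, (p.1.getD i.1 0 < 6 ↔ i.1 < 6) ∧
    (p.1.getD i.1 0 < 12 ↔ i.1 < 12) := by decide +kernel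

lemma symL_low : ∀ p ∈ symL, ∀ i < 12, Nat.testBit 2112 (p.1.getD i 0) = Nat.testBit 2112 i ∧
    p.1.getD i 0 < 12 := by decide +kernel

lemma symL_std : ∀ p ∈ symL, ∀ w ∈ stdW, permN p.1 (permN p.2 w) = w ∧
    ((List.range 128).any fun m => Nat.beq (permN p.2 w) (xcomb stdW m)) = true := by
  decide +kernel

lemma symL_inv : ∀ p ∈ symL, ∀ w ∈ stdW, ∃ m, permN p.1 (xcomb stdW m) = w := by
  intro p hp w hw
  obtain ⟨h1, h2⟩ := symL_std p hp w hw
  obtain ⟨m, -, hm⟩ := List.any_eq_true.1 h2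
  exact ⟨m, by rw [← Nat.eq_of_beq_eq_true hm, h1]⟩

lemma descB_spec (s : List (List ℕ × List ℕ)) (n : ℕ) (h : descB s n = true) :
    ∃ p ∈ s, Nat.land 8191 (norm20 (permN p.1 (wd 2112 n) >>> 12)) < Nat.land 8191 n := by
  induction s with
  | nil => simp [descB] at h
  | cons p s ih =>
    obtain ⟨l, l'⟩ := p
    rw [descB, Bool.or_eq_true] at h
    rcases h with h | h
    · refine ⟨(l, l'), by simp, ?_⟩
      rw [Nat.blt_eq] at h
      have e : wd 2112 n = Nat.add 2112 (Nat.mul 4096 n) := Nat.add_comm _ _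
      rw [e]
      exact h
    · obtain ⟨p, hp, h⟩ := ih h
      exact ⟨p, by simp [hp], h⟩

lemma permN_lt (l : List ℕ) (n : ℕ) : permN l n < 2 ^ l.length := by
  induction l with
  | nil => simp [permN]
  | cons a l ih =>
    have e : Nat.land 1 (Nat.shiftRight n a) ≤ 1 := Nat.and_le_left
    change Nat.land 1 (Nat.shiftRight n a) + 2 * permN l n < 2 ^ (l.length + 1)
    rw [pow_succ]; omega

/-- Induction step: a symmetry lowers the key. -/
lemma desc_step {C : Submodule (ZMod 2) (Fin 32 → ZMod 2)} (h : StdC C) {n : ℕ}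
    (hp : PairW C 2112 n) (hd : descB symL n = true) :
    ∃ π : Equiv.Perm (Fin 32), StdC (pull π C) ∧ ∃ n', PairW (pull π C) 2112 n' ∧
      Nat.land 8191 n' < Nat.land 8191 n := by
  obtain ⟨p, hps, hlt⟩ := descB_spec _ _ hd
  obtain ⟨σ, hσ, hσ2⟩ := exists_perm _ (symL_perm p hps)
  have hS : StdC (pull σ C) := by
    refine ⟨h.base.pull σ ?_ ?_, ?_⟩
    · intro i; rw [hσ2]; exact (symL_block p hps i).1
    · intro i; rw [hσ2]; exact (symL_block p hps i).2
    · intro w hw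
      obtain ⟨m, hm⟩ := symL_inv p hps w hw
      rw [← hm, hσ]
      exact comp_mem_pull σ (vec_xcomb_mem C _ h.std m)
  have hlen : p.1.length = 32 := by
    have := symL_perm p hps
    rw [permOK, Bool.and_eq_true] at this
    exact Nat.eq_of_beq_eq_true this.1
  have hW : permN p.1 (wd 2112 n) = wd 2112 (permN p.1 (wd 2112 n) >>> 12) := by
    refine wd_split 2112 _ (by norm_num) fun i hi => ?_
    obtain ⟨h1, h2⟩ := symL_low p hps i hi
    have hi' : i < p.1.length := by omega
    rw [testBit_permN _ _ _ hi']
    rw [List.getD_eq_getElem _ _ hi'] at h1 h2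
    rw [testBit_wd _ _ _ (by norm_num), if_pos h2, h1]
  refine ⟨σ, hS, _, norm20_spec hS hp.pat (n := permN p.1 (wd 2112 n) >>> 12) ?_ ?_, hlt⟩
  · apply shift_lt
    have := permN_lt p.1 (wd 2112 n)
    rwa [hlen] at this
  · rw [← hW, hσ]
    exact comp_mem_pull σ hp.mem

lemma exists_reps (N : ℕ) : ∀ {C : Submodule (ZMod 2) (Fin 32 → ZMod 2)}, StdC C → ∀ {n : ℕ},
    PairW C 2112 n → Nat.land 8191 n < N → ∃ π : Equiv.Perm (Fin 32), StdC (pull π C) ∧ ∃ n',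
      PairW (pull π C) 2112 n' ∧ Nat.land 8191 n' ∈ repsL := by
  induction N with
  | zero => intro C _ n _ h; omega
  | succ N ih =>
    intro C hC n hn hN
    have h1 := (hn.ok hC).2.2
    rw [Bool.or_eq_true] at h1
    rcases h1 with h1 | h1
    · refine ⟨Equiv.refl _, ?_⟩
      have e : pull (Equiv.refl (Fin 32)) C = C := by
        ext x; rw [mem_pull]; rfl
      rw [e]
      refine ⟨hC, n, hn, ?_⟩
      have : ∀ (l : List ℕ) (k : ℕ), memB l k = true → k ∈ l := by
        intro l k
        induction l with
        | nil => simp [memB]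
        | cons a l ih =>
          rw [memB, Bool.or_eq_true, List.mem_cons]
          rintro (h | h)
          · exact Or.inl (Nat.eq_of_beq_eq_true h).symm
          · exact Or.inr (ih h)
      exact this _ _ h1
    · obtain ⟨π, hS, n', hn', hlt⟩ := desc_step hC hn h1
      obtain ⟨π', hS', n'', hn'', h⟩ := ih hS hn' (by omega)
      rw [pull_pull] at hS' hn''
      exact ⟨_, hS', n'', hn'', h⟩

/-- The list attached to a permutation of four positions of the second block. -/
def tauL (τ : Equiv.Perm (Fin 4)) : List ℕ :=
  [0, 1, 2, 3, 4, 5, 6, 7 + (τ 0).1, 7 + (τ 1).1, 7 + (τ 2).1, 7 + (τ 3).1, 11, 12, 13, 14, 15, 16, 17,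
    18, 19, 20, 21, 22, 23, 24, 25, 26, 27, 28, 29, 30, 31]

lemma tauL_perm : ∀ τ, permOK (tauL τ) = true := by decide +kernel

lemma tauL_block : ∀ τ, ∀ i : Fin 32, ((tauL τ).getD i.1 0 < 6 ↔ i.1 < 6) ∧
    ((tauL τ).getD i.1 0 < 12 ↔ i.1 < 12) ∧ (12 ≤ i.1 → (tauL τ).getD i.1 0 = i.1) := by
  decide +kernel

lemma tauL_std : ∀ τ, ∀ w ∈ stdW, permN (tauL τ) w = w := by decide +kernel

lemma tauL_pj : ∀ τ : Equiv.Perm (Fin 4), permN (tauL τ) (pj 0) = pj 0 ∧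
    ∀ i, permN (tauL τ) (pj (τ i).succ) = pj i.succ := by decide +kernel

lemma vec_wd (L n : ℕ) (hL : L < 2 ^ 12) : vec (wd L n) = vec L + vec (wd 0 n) := by
  rw [← vec_xor]
  congr 1
  have e : L = wd L 0 := by simp [wd]
  conv_rhs => rw [e]
  rw [wd_xor _ _ _ _ hL (by norm_num), Nat.xor_zero, Nat.zero_xor]

/-- A family of five words. -/
def Fam (C : Submodule (ZMod 2) (Fin 32 → ZMod 2)) (n : Fin 5 → ℕ) : Prop :=
  ∀ j, PairW C (pj j) (n j)

lemma reorder {C : Submodule (ZMod 2) (Fin 32 → ZMod 2)} (h : StdC C) {n : Fin 5 → ℕ}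
    (hn : Fam C n) (τ : Equiv.Perm (Fin 4)) :
    ∃ π : Equiv.Perm (Fin 32), StdC (pull π C) ∧
      Fam (pull π C) (Fin.cons (n 0) fun i => n (τ i).succ) := by
  obtain ⟨σ, hσ, hσ2⟩ := exists_perm _ (tauL_perm τ)
  have hz : ∀ m (i : Fin 32), i.1 < 12 → vec (wd 0 m) i = 0 := by
    intro m i hi
    unfold vec
    rw [testBit_wd _ _ _ (by norm_num), if_pos hi]
    simp
  have key : ∀ L L' m, L < 2 ^ 12 → L' < 2 ^ 12 → permN (tauL τ) L = L' → vec (wd L m) ∈ C →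
      vec (wd L' m) ∈ pull σ C := by
    intro L L' m hL hL' he hm
    have h0 : vec (wd 0 m) ∘ σ = vec (wd 0 m) := by
      funext i
      obtain ⟨-, h2, h3⟩ := tauL_block τ i
      rw [← hσ2] at h2 h3
      by_cases hi : i.1 < 12
      · rw [Function.comp_apply, hz m _ (h2.2 hi), hz m _ hi]
      · rw [Function.comp_apply]
        exact congrArg _ (Fin.ext (h3 (by omega)))
    have : vec (wd L' m) = vec (wd L m) ∘ σ := by
      rw [vec_wd _ _ hL, vec_wd _ _ hL', ← he, hσ]
      conv_lhs => rw [← h0]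
      rfl
    rw [this]
    exact comp_mem_pull σ hm
  refine ⟨σ, ⟨h.base.pull σ ?_ ?_, ?_⟩, ?_⟩
  · intro i; rw [hσ2]; exact (tauL_block τ i).1
  · intro i; rw [hσ2]; exact (tauL_block τ i).2.1
  · intro w hw
    rw [← tauL_std τ w hw, hσ]
    exact comp_mem_pull σ (h.std w hw)
  · intro j
    refine Fin.cases ?_ (fun i => ?_) j
    · exact ⟨(hn 0).pat, (hn 0).lt, (hn 0).zero, key _ _ _ (pj_lt 0) (pj_lt 0) (tauL_pj τ).1 (hn 0).mem⟩
    · have hi := hn (τ i).succ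
      exact ⟨pj_mem _, hi.lt, hi.zero, key _ _ _ (pj_lt _) (pj_lt _) ((tauL_pj τ).2 i) hi.mem⟩

lemma Fam.xor {C : Submodule (ZMod 2) (Fin 32 → ZMod 2)} {n : Fin 5 → ℕ}
    (hn : Fam C n) {i j : Fin 5} (hij : i ≠ j) : PairW C (pj i ^^^ pj j) (n i ^^^ n j) := by
  refine ⟨pj_xor i j hij, Nat.xor_lt_two_pow (hn i).lt (hn j).lt, ?_, ?_⟩
  · rw [Nat.testBit_xor, (hn i).zero, (hn j).zero]; rfl
  · rw [← wd_xor _ _ _ _ (pj_lt i) (pj_lt j), vec_xor]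
    exact C.add_mem (hn i).mem (hn j).mem

lemma hasGold_sorted {C : Submodule (ZMod 2) (Fin 32 → ZMod 2)} (h : StdC C) {n : Fin 5 → ℕ}
    (hn : Fam C n) (hr : Nat.land 8191 (n 0) ∈ repsL)
    (h12 : Nat.land 8191 (n 1) < Nat.land 8191 (n 2))
    (h23 : Nat.land 8191 (n 2) < Nat.land 8191 (n 3))
    (h34 : Nat.land 8191 (n 3) < Nat.land 8191 (n 4)) : HasGold C := by
  have hs := congrArg (Nat.land 8191) (key_sum h hn)
  rw [zw_spec.2.2.2.2.2, land_xor8191, land_xor8191, land_xor8191, land_xor8191] at hs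
  have ht : ∀ j, tb (Nat.land 8191 (n j)) = true := fun j => ((hn j).ok h).2.1
  have ht2 : ∀ i j, i ≠ j → tb (Nat.land 8191 (n i) ^^^ Nat.land 8191 (n j)) = true := by
    intro i j hij
    rw [← land_xor8191]
    exact ((hn.xor hij).ok h).2.1
  have hsol := srch_sound hr (ht 1) (ht 2) (ht 3) (ht 4) h12 h23 h34 hs
    (ht2 0 1 (by decide)) (ht2 0 2 (by decide)) (ht2 0 3 (by decide)) (ht2 0 4 (by decide))
    (ht2 1 2 (by decide)) (ht2 1 3 (by decide)) (ht2 1 4 (by decide)) (ht2 2 3 (by decide))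
    (ht2 2 4 (by decide)) (ht2 3 4 (by decide))
  obtain ⟨q, hq, hqs⟩ := certD_sol _ hsol
  obtain ⟨σ, hσ, -⟩ := exists_perm _ (certD_perm q hq)
  have hfour : ∀ w ∈ fourW q.1, vec w ∈ C := by
    intro w hw
    rw [hqs, fourW, List.mem_append] at hw
    rcases hw with hw | hw
    · exact h.std w hw
    · simp only [List.zipWith_cons_cons, List.zipWith_nil_left, List.mem_cons, List.not_mem_nil,
        or_false, ← ((hn 0).ok h).1, ← ((hn 1).ok h).1, ← ((hn 2).ok h).1,
        ← ((hn 3).ok h).1] at hw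
      rcases hw with rfl | rfl | rfl | rfl
      · exact (hn 0).mem
      · exact (hn 1).mem
      · exact (hn 2).mem
      · exact (hn 3).mem
  have hg : ∀ g ∈ (if q.2.1 then gold3 else gold5), vec g ∘ σ ∈ C := by
    intro g hg
    obtain ⟨m, -, hm⟩ := certD_spec q hq g hg
    rw [← hσ, hm]
    exact vec_xcomb_mem C _ hfour m
  refine ⟨σ, ?_⟩
  cases hb : q.2.1
  · rw [hb] at hg; exact Or.inr hg
  · rw [hb] at hg; exact Or.inl hg

lemma StdC.hasGold {C : Submodule (ZMod 2) (Fin 32 → ZMod 2)} (h : StdC C) : HasGold C := by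
  obtain ⟨n0, hn0⟩ := exists_pairW h (L := 2112) (pj_mem 0)
  obtain ⟨π, hS, m, hm, hr⟩ := exists_reps _ h hn0 (Nat.lt_succ_self _)
  refine HasGold.of_pull (π := π) ?_
  clear hn0 h
  generalize pull π C = D at *
  have hex : ∀ j : Fin 4, ∃ n, PairW D (pj j.succ) n := fun j => exists_pairW hS (pj_mem _)
  choose f hf using hex
  have hfam : Fam D (Fin.cons m f) := by
    intro j
    refine Fin.cases hm (fun i => hf i) j
  set k : Fin 4 → ℕ := fun i => Nat.land 8191 (f i) with hk
  have hinj : Function.Injective k := by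
    intro i j hij
    by_contra hne
    have h1 := ((hfam.xor (i := i.succ) (j := j.succ) (by simpa using hne)).ok hS).2.1
    rw [land_xor8191] at h1
    simp only [Fin.cons_succ] at h1
    change tb (k i ^^^ k j) = true at h1
    rw [hij, Nat.xor_self] at h1
    exact absurd h1 (by decide +kernel)
  obtain ⟨π', hS', hF'⟩ := reorder hS hfam (Tuple.sort k)
  refine HasGold.of_pull (π := π') ?_
  have hmono : StrictMono (k ∘ Tuple.sort k) :=
    (Tuple.monotone_sort k).strictMono_of_injective (hinj.comp (Equiv.injective _))
  refine hasGold_sorted hS' hF' hr ?_ ?_ ?_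
  · exact hmono (show (0 : Fin 4) < 1 by decide)
  · exact hmono (show (1 : Fin 4) < 2 by decide)
  · exact hmono (show (2 : Fin 4) < 3 by decide)

lemma sat11_gold {C : Submodule (ZMod 2) (K5 → ZMod 2)} (h : SatCond 5 11 4 C) :
    ∃ e : Fin 32 ≃ K5, (∀ g ∈ gold3, vec g ∈ pull e C) ∨ (∀ g ∈ gold5, vec g ∈ pull e C) := by
  obtain ⟨e, hB⟩ := exists_base h
  obtain ⟨π, hB', hstd⟩ := hB.exists_std
  obtain ⟨σ, hg⟩ := (StdC.mk hB' hstd).hasGold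
  refine ⟨σ.symm.trans (π.trans e), ?_⟩
  rw [← pull_pull, ← pull_pull]
  refine hg.imp ?_ ?_ <;>
  · intro hg g hgm
    rw [mem_pull]
    exact hg g hgm

/-! ### The two codes -/

lemma xcomb_cons' (w : ℕ) (ws : List ℕ) (m : ℕ) :
    xcomb (w :: ws) m = (cond (m.testBit 0) w 0) ^^^ xcomb ws (m >>> 1) := by
  rw [← testBit_eq_beq]
  rfl

lemma xcomb_xor (l : List ℕ) (m m' : ℕ) : xcomb l m ^^^ xcomb l m' = xcomb l (m ^^^ m') := by
  induction l generalizing m m' with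
  | nil => exact Nat.xor_self 0
  | cons w ws ih =>
    rw [xcomb_cons', xcomb_cons', xcomb_cons', Nat.shiftRight_xor_distrib, ← ih, Nat.testBit_xor]
    cases m.testBit 0 <;> cases m'.testBit 0 <;>
      simp [Nat.xor_comm, Nat.xor_left_comm]

/-- The code generated by a list of words. -/
def codeL (l : List ℕ) : Submodule (ZMod 2) (Fin 32 → ZMod 2) where
  carrier := {x | ∃ m, vec (xcomb l m) = x}
  add_mem' := by
    rintro _ _ ⟨m, rfl⟩ ⟨m', rfl⟩
    exact ⟨m ^^^ m', by rw [← xcomb_xor, vec_xor]⟩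
  zero_mem' := ⟨0, by
    have h := xcomb_xor l 0 0
    rw [Nat.xor_self, Nat.xor_self] at h
    rw [← h, vec_zero]⟩
  smul_mem' := by
    rintro c _ ⟨m, rfl⟩
    rcases zmod2_cases c with rfl | rfl
    · refine ⟨0, ?_⟩
      have h := xcomb_xor l 0 0
      rw [Nat.xor_self, Nat.xor_self] at h
      rw [← h, vec_zero, zero_smul]
    · exact ⟨m, by rw [one_smul]⟩

lemma mem_codeL {l : List ℕ} {x : Fin 32 → ZMod 2} : x ∈ codeL l ↔ ∃ m, vec (xcomb l m) = x :=
  Iff.rfl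

lemma mem_codeL_of_mem {l : List ℕ} {g : ℕ} (hg : g ∈ l) : vec g ∈ codeL l := by
  suffices h : ∃ m, xcomb l m = g by
    obtain ⟨m, hm⟩ := h
    exact ⟨m, by rw [hm]⟩
  induction l with
  | nil => simp at hg
  | cons a l ih =>
    rcases List.mem_cons.1 hg with rfl | hg
    · refine ⟨1, ?_⟩
      rw [xcomb_cons']
      have h : xcomb l 0 = 0 := by
        have h := xcomb_xor l 0 0
        rw [Nat.xor_self, Nat.xor_self] at h
        exact h.symm
      have e : 1 >>> 1 = 0 := rfl
      rw [e, h]; simp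
    · obtain ⟨m, hm⟩ := ih hg
      refine ⟨2 * m, ?_⟩
      rw [xcomb_cons']
      have e : (2 * m) >>> 1 = m := by rw [Nat.shiftRight_eq_div_pow]; omega
      rw [e, hm]; simp

lemma codeL_le {l : List ℕ} {C : Submodule (ZMod 2) (Fin 32 → ZMod 2)}
    (h : ∀ g ∈ l, vec g ∈ C) : codeL l ≤ C := by
  rintro _ ⟨m, rfl⟩
  exact vec_xcomb_mem C l h m

lemma xcomb_mod (l : List ℕ) (m : ℕ) : xcomb l m = xcomb l (m % 2 ^ l.length) := by
  induction l generalizing m with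
  | nil => rfl
  | cons a l ih =>
    rw [xcomb_cons', xcomb_cons', ih (m >>> 1), ih ((m % 2 ^ (a :: l).length) >>> 1),
      Nat.testBit_mod_two_pow]
    have e : (m >>> 1) % 2 ^ l.length =
        ((m % 2 ^ (a :: l).length) >>> 1) % 2 ^ l.length := by
      apply Nat.eq_of_testBit_eq
      intro i
      simp only [Nat.testBit_mod_two_pow, Nat.testBit_shiftRight, List.length_cons]
      by_cases hi : i < l.length
      · have : 1 + i < l.length + 1 := by omega
        simp [hi, this]
      · simp [hi]
    rw [e]
    simp

lemma finrank_codeL {l : List ℕ} (hl : l.length = 11)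
    (h : ∀ a < 32, ∀ b < 64, popc (xcomb l (64 * a + b)) = 0 → a = 0 ∧ b = 0) :
    Module.finrank (ZMod 2) (codeL l) = 11 := by
  classical
  have : Fintype (codeL l) := Fintype.ofFinite _
  have hb : Function.Bijective (fun m : Fin (2 ^ 11) =>
      (⟨vec (xcomb l m.1), m.1, rfl⟩ : codeL l)) := by
    constructor
    · intro m m' hm
      have h1 : vec (xcomb l m.1) = vec (xcomb l m'.1) := congrArg Subtype.val hm
      have h2 : vec (xcomb l (m.1 ^^^ m'.1)) = 0 := by
        rw [← xcomb_xor, vec_xor, h1, vadd_self2]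
      have h3 : popc (xcomb l (m.1 ^^^ m'.1)) = 0 := by
        rw [← wt_vec, h2]; simp [wt]
      have h4 : m.1 ^^^ m'.1 < 2 ^ 11 := Nat.xor_lt_two_pow m.2 m'.2
      rw [← Nat.div_add_mod (m.1 ^^^ m'.1) 64] at h3
      have h5 := h _ (by omega) _ (Nat.mod_lt _ (by norm_num)) h3
      have h6 : m.1 ^^^ m'.1 = 0 := by omega
      exact Fin.ext (Nat.xor_eq_zero_iff.1 h6)
    · rintro ⟨_, m, rfl⟩
      refine ⟨⟨m % 2 ^ 11, Nat.mod_lt _ (by norm_num)⟩, Subtype.ext ?_⟩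
      change vec (xcomb l (m % 2 ^ 11)) = _
      rw [← hl, ← xcomb_mod]
  have hc := Fintype.card_of_bijective hb
  rw [card_code, Fintype.card_fin] at hc
  exact (Nat.pow_right_injective (le_refl 2) hc).symm

lemma gold3_inj : ∀ a < 32, ∀ b < 64, popc (xcomb gold3 (64 * a + b)) = 0 → a = 0 ∧ b = 0 := by
  decide +kernel

lemma gold5_inj : ∀ a < 32, ∀ b < 64, popc (xcomb gold5 (64 * a + b)) = 0 → a = 0 ∧ b = 0 := by
  decide +kernel

lemma gold3_wt : allSpan (fun n => okw (popc n)) gold3 0 = true := by decide +kernel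

lemma gold5_wt : allSpan (fun n => okw (popc n)) gold5 0 = true := by decide +kernel

/-- Numbering of the points of `F_2^5`. -/
def idx : K5 ≃ Fin 32 := (finFunctionFinEquiv (m := 2) (n := 5))

/-- The first five generators. -/
def linG (i : Fin 5) : ℕ := [2863311530, 3435973836, 4042322160, 4278255360, 4294901760].getD i.1 0

lemma linG_mem3 : ∀ i, linG i ∈ gold3 := by decide +kernel

lemma linG_mem5 : ∀ i, linG i ∈ gold5 := by decide +kernel

lemma linG_idx : ∀ (v : K5) (i : Fin 5), vec (linG i) (idx v) = v i := by decide +kernel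

lemma okw_spec : ∀ w ≤ 32, okw w = true → w = 0 ∨ w = 12 ∨ w = 16 ∨ w = 20 ∨ w = 32 := by
  decide +kernel

lemma sat_codeL {l : List ℕ} (hr : Module.finrank (ZMod 2) (codeL l) = 11)
    (hw : allSpan (fun n => okw (popc n)) l 0 = true)
    (hex : ∀ w ∈ [0, 12, 16, 20, 32], ∃ m, popc (xcomb l m) = w)
    (hlin : ∀ i, linG i ∈ l) (hone : 4294967295 ∈ l) : SatCond 5 11 4 (pull idx (codeL l)) := by
  refine ⟨by rw [finrank_pull, hr], by norm_num, by norm_num, ?_, ?_⟩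
  · have e : ({0, 2 ^ 5 / 2 - 4, 2 ^ 5 / 2, 2 ^ 5 / 2 + 4, 2 ^ 5} : Set ℕ) = {0, 12, 16, 20, 32} := by
      norm_num
    rw [e]
    ext w
    constructor
    · rintro ⟨x, hx, rfl⟩
      rw [mem_pull] at hx
      obtain ⟨m, hm⟩ := hx
      have h1 := allSpan_spec _ _ _ hw m
      rw [Nat.zero_xor, ← wt_vec, hm, wt_comp] at h1
      have h2 : wt x ≤ 32 := by
        have := wt_le x
        rwa [card_K5] at this
      simpa using okw_spec _ h2 h1
    · intro h
      obtain ⟨m, hm⟩ := hex w (by simpa using h)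
      exact ⟨vec (xcomb l m) ∘ idx, comp_mem_pull idx ⟨m, rfl⟩, by rw [wt_comp, wt_vec, hm]⟩
  · rintro _ ⟨a, b, rfl⟩
    have e : (fun v : Fin 5 → ZMod 2 => (∑ i, a i * v i) + b) =
        (∑ i, a i • (vec (linG i) ∘ idx)) + b • (vec 4294967295 ∘ idx) := by
      funext v
      rw [Pi.add_apply, Finset.sum_apply, vec_one]
      simp [linG_idx]
    rw [e]
    refine Submodule.add_mem _ (Submodule.sum_mem _ fun i _ => Submodule.smul_mem _ _ ?_)
      (Submodule.smul_mem _ _ ?_)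
    · exact comp_mem_pull idx (mem_codeL_of_mem (hlin i))
    · exact comp_mem_pull idx (mem_codeL_of_mem hone)

lemma gold3_ex : ∀ w ∈ [0, 12, 16, 20, 32], ∃ m ∈ List.range 128, popc (xcomb gold3 m) = w := by
  decide +kernel

lemma gold5_ex : ∀ w ∈ [0, 12, 16, 20, 32], ∃ m ∈ List.range 128, popc (xcomb gold5 m) = w := by
  decide +kernel

lemma sat_gold3 : SatCond 5 11 4 (pull idx (codeL gold3)) :=
  sat_codeL (finrank_codeL rfl gold3_inj) gold3_wt
    (fun w hw => (gold3_ex w hw).imp fun _ h => h.2) linG_mem3 (by decide)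

lemma sat_gold5 : SatCond 5 11 4 (pull idx (codeL gold5)) :=
  sat_codeL (finrank_codeL rfl gold5_inj) gold5_wt
    (fun w hw => (gold5_ex w hw).imp fun _ h => h.2) linG_mem5 (by decide)

lemma codeEquiv_pull {C : Submodule (ZMod 2) (K5 → ZMod 2)} {l : List ℕ}
    (hr : Module.finrank (ZMod 2) (codeL l) = 11) (hC : Module.finrank (ZMod 2) C = 11)
    {e : Fin 32 ≃ K5} (h : ∀ g ∈ l, vec g ∈ pull e C) :
    CodeEquiv (C : Set (K5 → ZMod 2)) (pull idx (codeL l) : Submodule (ZMod 2) (K5 → ZMod 2)) := by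
  have h1 : codeL l = pull e C :=
    Submodule.eq_of_le_of_finrank_eq (codeL_le h) (by rw [hr, finrank_pull, hC])
  refine ⟨idx.trans e, ?_⟩
  rw [h1, pull_pull]
  ext x
  constructor
  · intro hx
    refine ⟨x ∘ (idx.trans e).symm, mem_pull.1 hx, ?_⟩
    funext i
    simp
  · rintro ⟨y, hy, rfl⟩
    exact comp_mem_pull _ hy

/-! ### The two codes are not equivalent -/

/-- Sums of pairs of columns of the second code, as a bit set. -/
def pairB : ℕ :=
  516874977348250503741956616261057781076282798232135370308114261099427952779773689064754967875723038723464335581372346142019152601671476166532427411406834798342644645301357745125884683436172325330872941311793695428760016199793266563203195081215272728621601924555312930194501508727600320017480027034545338610639872260733615494013462508418157362907222492860771006574093991594446455690657658650135957038084409196831292471215324121074775301050014779514424618021879057413437696344593695361208732116441716829941095432294616540534241477808247735216277323687531258613739728545416533054739101936461924642789611536384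

/-- Common relations with the first two coordinates. -/
def relM : List ℕ :=
    [0, 0, 2250488096, 1226012176, 2617685064, 1812560004, 4106519824, 4173875744, 916854852,
     962143368, 365990488, 719348132, 2584282428, 1694894652, 2811300008, 1533150292, 2358530604,
     1281925404, 1706107216, 2591167136, 2211268104, 1137608964, 1211797184, 2218085824,
     1882514952, 2956515588, 8873332, 4954808, 2198378448, 1124363232, 560373992, 312037588]

/-- First automorphism. -/
def autA : List ℕ :=
    [0, 2, 4, 6, 8, 10, 12, 14, 16, 18, 20, 22, 24, 26, 28, 30, 5, 7, 1, 3, 13, 15, 9, 11, 21,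
     23, 17, 19, 29, 31, 25, 27]

/-- Second automorphism. -/
def autS : List ℕ :=
    [1, 3, 5, 7, 9, 11, 13, 15, 17, 19, 21, 23, 25, 27, 29, 31, 4, 6, 0, 2, 12, 14, 8, 10, 20,
     22, 16, 18, 28, 30, 24, 26]

lemma autA_spec : ∀ g ∈ gold5, ∃ m ∈
      [16, 1, 18, 4, 8, 32, 576, 1152, 832, 1664, 1280],
    permN autA g = xcomb gold5 m := by decide +kernel

lemma autS_spec : ∀ g ∈ gold5, ∃ m ∈
      [48, 1, 18, 4, 8, 32, 634, 1165, 836, 1690, 1281],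
    permN autS g = xcomb gold5 m := by decide +kernel

/-- A sum of four coordinates is a sum of two coordinates. -/
def Rel4 (C : Submodule (ZMod 2) (Fin 32 → ZMod 2)) (a b c d : Fin 32) : Prop :=
  ∃ p q : Fin 32, p ≠ q ∧ ∀ x ∈ C, x a + x b + x c + x d = x p + x q

/-- The invariant. -/
def Bad (C : Submodule (ZMod 2) (Fin 32 → ZMod 2)) (x y : Fin 32) : Prop :=
  ∃ z w : Fin 32, z ≠ w ∧ z ≠ x ∧ z ≠ y ∧ w ≠ x ∧ w ≠ y ∧ ∃ T : Finset (Fin 32), 7 ≤ T.card ∧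
    ∀ t ∈ T, t ≠ x ∧ t ≠ y ∧ t ≠ z ∧ t ≠ w ∧ Rel4 C x y z t ∧ Rel4 C x y w t

lemma Rel4.map {C D : Submodule (ZMod 2) (Fin 32 → ZMod 2)} {σ : Equiv.Perm (Fin 32)}
    (hσ : ∀ x ∈ C, x ∘ σ ∈ D) {a b c d : Fin 32} (h : Rel4 D a b c d) :
    Rel4 C (σ a) (σ b) (σ c) (σ d) := by
  obtain ⟨p, q, hpq, h⟩ := h
  exact ⟨σ p, σ q, σ.injective.ne hpq, fun x hx => h _ (hσ x hx)⟩

lemma Bad.map {C D : Submodule (ZMod 2) (Fin 32 → ZMod 2)} {σ : Equiv.Perm (Fin 32)}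
    (hσ : ∀ x ∈ C, x ∘ σ ∈ D) {x y : Fin 32} (h : Bad D x y) : Bad C (σ x) (σ y) := by
  obtain ⟨z, w, h1, h2, h3, h4, h5, T, hT, h⟩ := h
  refine ⟨σ z, σ w, σ.injective.ne h1, σ.injective.ne h2, σ.injective.ne h3, σ.injective.ne h4,
    σ.injective.ne h5, T.map σ.toEmbedding, by rwa [Finset.card_map], ?_⟩
  intro t ht
  obtain ⟨s, hs, rfl⟩ := Finset.mem_map.1 ht
  obtain ⟨a1, a2, a3, a4, a5, a6⟩ := h s hs
  exact ⟨σ.injective.ne a1, σ.injective.ne a2, σ.injective.ne a3, σ.injective.ne a4,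
    a5.map hσ, a6.map hσ⟩

/-- Columns of a generator matrix. -/
def colN : List ℕ → ℕ → ℕ
  | [], _ => 0
  | g :: l, v => Nat.add (Nat.land 1 (Nat.shiftRight g v)) (Nat.mul 2 (colN l v))

lemma testBit_colN (l : List ℕ) (v i : ℕ) :
    (colN l v).testBit i = (l.getD i 0).testBit v := by
  induction l generalizing i with
  | nil => simp [colN]
  | cons a l ih =>
    have e : colN (a :: l) v = 2 * colN l v + (a.testBit v).toNat := by
      change (1 &&& (a >>> v)) + 2 * colN l v = _
      rw [Nat.add_comm, Nat.and_comm, Nat.and_one_is_mod, Nat.shiftRight_eq_div_pow, Nat.toNat_testBit]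
    rw [e]
    cases i with
    | zero => cases h : a.testBit v <;> simp [h]
    | succ i =>
      rw [Nat.testBit_succ, List.getD_cons_succ, ← ih]
      congr 1
      have : (a.testBit v).toNat ≤ 1 := Bool.toNat_le _
      omega

lemma bits_iff (g : ℕ) (a b c d p q : Fin 32) :
    vec g a + vec g b + vec g c + vec g d = vec g p + vec g q ↔
      ((((g.testBit a).xor (g.testBit b)).xor (g.testBit c)).xor (g.testBit d)) =
        (g.testBit p).xor (g.testBit q) := by
  unfold vec
  cases g.testBit a <;> cases g.testBit b <;> cases g.testBit c <;> cases g.testBit d <;>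
    cases g.testBit p <;> cases g.testBit q <;> decide

lemma col_of_rel {l : List ℕ} {a b c d p q : Fin 32}
    (h : ∀ x ∈ codeL l, x a + x b + x c + x d = x p + x q) :
    colN l a ^^^ colN l b ^^^ colN l c ^^^ colN l d = colN l p ^^^ colN l q := by
  apply Nat.eq_of_testBit_eq
  intro i
  simp only [Nat.testBit_xor, testBit_colN]
  rw [← bits_iff]
  apply h
  by_cases hi : i < l.length
  · rw [List.getD_eq_getElem _ _ hi]
    exact mem_codeL_of_mem (List.getElem_mem hi)
  · rw [List.getD_eq_default _ _ (by omega), vec_zero]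
    exact Submodule.zero_mem _

lemma rel_of_gens {l : List ℕ} {a b c d : Fin 32} (p q : Fin 32) (hpq : p ≠ q)
    (h : ∀ g ∈ l, vec g a + vec g b + vec g c + vec g d = vec g p + vec g q) :
    Rel4 (codeL l) a b c d := by
  refine ⟨p, q, hpq, ?_⟩
  let S : Submodule (ZMod 2) (Fin 32 → ZMod 2) :=
    { carrier := {x | x a + x b + x c + x d = x p + x q}
      add_mem' := by
        intro x y hx hy
        change (x a + y a) + (x b + y b) + (x c + y c) + (x d + y d) = (x p + y p) + (x q + y q)
        change x a + x b + x c + x d = x p + x q at hx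
        change y a + y b + y c + y d = y p + y q at hy
        linear_combination hx + hy
      zero_mem' := by
        change (0 : ZMod 2) + 0 + 0 + 0 = 0 + 0
        rfl
      smul_mem' := by
        intro r x hx
        change r * x a + r * x b + r * x c + r * x d = r * x p + r * x q
        change x a + x b + x c + x d = x p + x q at hx
        linear_combination r * hx }
  exact fun x hx => codeL_le (C := S) h hx

/-- Certificates for the first code. -/
def badT : List (ℕ × (ℕ × ℕ) × (ℕ × ℕ)) :=
  [(7, (4, 25), (8, 16)), (8, (14, 28), (7, 16)), (16, (23, 29), (7, 8)),
   (18, (22, 30), (22, 27)), (22, (18, 30), (18, 27)), (23, (16, 29), (2, 10)),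
   (28, (8, 14), (12, 15))]

/-- Boolean check of a relation among columns. -/
def chk (z t p q : ℕ) : Bool :=
  Nat.beq (Nat.xor (Nat.xor (Nat.xor (colN gold3 0) (colN gold3 1)) (colN gold3 z)) (colN gold3 t))
    (Nat.xor (colN gold3 p) (colN gold3 q))

lemma badT_spec1 : (badT.all fun s => chk 27 s.1 s.2.1.1 s.2.1.2) = true := by decide +kernel

lemma badT_spec2 : (badT.all fun s => chk 30 s.1 s.2.2.1 s.2.2.2) = true := by decide +kernel

lemma badT_spec3 : ∀ s ∈ badT, s.1 < 32 ∧ s.2.1.1 < 32 ∧ s.2.1.2 < 32 ∧ s.2.2.1 < 32 ∧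
    s.2.2.2 < 32 ∧ s.1 ≠ 0 ∧ s.1 ≠ 1 ∧ s.1 ≠ 27 ∧ s.1 ≠ 30 ∧ s.2.1.1 ≠ s.2.1.2 ∧
    s.2.2.1 ≠ s.2.2.2 := by decide

lemma rel_of_chk {z t p q : ℕ} (hz : z < 32) (ht : t < 32) (hp : p < 32) (hq : q < 32)
    (hpq : p ≠ q) (h : chk z t p q = true) : Rel4 (codeL gold3) 0 1 ⟨z, hz⟩ ⟨t, ht⟩ := by
  refine rel_of_gens ⟨p, hp⟩ ⟨q, hq⟩ (fun h => hpq (congrArg Fin.val h)) ?_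
  have e : colN gold3 0 ^^^ colN gold3 1 ^^^ colN gold3 z ^^^ colN gold3 t =
      colN gold3 p ^^^ colN gold3 q := Nat.eq_of_beq_eq_true h
  intro g hg
  rw [bits_iff]
  obtain ⟨i, hi, rfl⟩ := List.getElem_of_mem hg
  have e2 := congrArg (fun m => Nat.testBit m i) e
  simp only [Nat.testBit_xor, testBit_colN, List.getD_eq_getElem _ _ hi] at e2
  exact e2

lemma bad_gold3 : Bad (codeL gold3) 0 1 := by
  refine ⟨27, 30, by decide, by decide, by decide, by decide, by decide,
    ({7, 8, 16, 18, 22, 23, 28} : Finset (Fin 32)), by decide, ?_⟩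
  intro t ht
  have hm : ∀ t ∈ ({7, 8, 16, 18, 22, 23, 28} : Finset (Fin 32)), ∃ s ∈ badT, s.1 = t.1 := by
    decide
  obtain ⟨s, hs, hst⟩ := hm t ht
  obtain ⟨a0, a1, a2, a3, a4, h0, h1, h2, h3, h4, h5⟩ := badT_spec3 s hs
  obtain rfl : t = ⟨s.1, a0⟩ := Fin.ext hst.symm
  refine ⟨fun h => h0 (congrArg Fin.val h), fun h => h1 (congrArg Fin.val h),
    fun h => h2 (congrArg Fin.val h), fun h => h3 (congrArg Fin.val h), ?_, ?_⟩
  · exact rel_of_chk (by decide) a0 a1 a2 h4 (List.all_eq_true.1 badT_spec1 s hs)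
  · exact rel_of_chk (by decide) a0 a3 a4 h5 (List.all_eq_true.1 badT_spec2 s hs)

lemma pairB_spec : ∀ p q : Fin 32, p ≠ q →
    pairB.testBit (colN gold5 p ^^^ colN gold5 q) = true := by decide +kernel

lemma relM_spec : ∀ z t : Fin 32, z ≠ 0 → z ≠ 1 → t ≠ 0 → t ≠ 1 → t ≠ z →
    pairB.testBit (colN gold5 (0 : Fin 32).1 ^^^ colN gold5 (1 : Fin 32).1 ^^^ colN gold5 z.1 ^^^
      colN gold5 t.1) = true → (relM.getD z 0).testBit t = true := by decide +kernel

lemma relM_popc : ∀ z w : Fin 32, z ≠ w → popc (relM.getD z 0 &&& relM.getD w 0) ≤ 6 := by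
  decide +kernel

lemma rel_gold5 {z t : Fin 32} (h1 : z ≠ 0) (h2 : z ≠ 1) (h3 : t ≠ 0) (h4 : t ≠ 1) (h5 : t ≠ z)
    (h : Rel4 (codeL gold5) 0 1 z t) : (relM.getD z 0).testBit t = true := by
  obtain ⟨p, q, hpq, h⟩ := h
  have e := col_of_rel h
  apply relM_spec z t h1 h2 h3 h4 h5
  rw [e]
  exact pairB_spec p q hpq

lemma not_bad_01 : ¬ Bad (codeL gold5) 0 1 := by
  rintro ⟨z, w, h1, h2, h3, h4, h5, T, hT, h⟩
  have hsub : T ⊆ univ.filter fun i => vec (relM.getD z 0 &&& relM.getD w 0) i ≠ 0 := by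
    intro t ht
    obtain ⟨a1, a2, a3, a4, a5, a6⟩ := h t ht
    rw [Finset.mem_filter]
    refine ⟨Finset.mem_univ _, ?_⟩
    unfold vec
    rw [Nat.testBit_and, rel_gold5 h2 h3 a1 a2 a3 a5, rel_gold5 h4 h5 a1 a2 a4 a6]
    simp
  have h6 := Finset.card_le_card hsub
  have h7 := wt_vec (relM.getD z 0 &&& relM.getD w 0)
  unfold wt at h7
  have h8 := relM_popc z w h1
  omega

/-- The first automorphism as a function. -/
def fA (i : Fin 32) : Fin 32 := Fin.ofNat 32 (autA.getD i.1 0)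

/-- The second automorphism as a function. -/
def fS (i : Fin 32) : Fin 32 := Fin.ofNat 32 (autS.getD i.1 0)

lemma reach0 : ∀ x : Fin 32, ∃ j < 2, ∃ k < 31, fS^[k] (fA^[j] x) = 0 := by decide +kernel

lemma reach1 : ∀ y : Fin 32, y ≠ 0 → ∃ k < 31, fA^[k] y = 1 := by decide +kernel

/-- A pair of distinct bad coordinates. -/
def BadP (x y : Fin 32) : Prop := x ≠ y ∧ Bad (codeL gold5) x y

lemma badP_aut (l : List ℕ) (hl : permOK l = true) (hg : ∀ g ∈ gold5, ∃ m, permN l g = xcomb gold5 m)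
    {x y : Fin 32} (h : BadP x y) :
    BadP (Fin.ofNat 32 (l.getD x.1 0)) (Fin.ofNat 32 (l.getD y.1 0)) := by
  obtain ⟨σ, h1, h2⟩ := exists_perm l hl
  have e : ∀ i : Fin 32, Fin.ofNat 32 (l.getD i.1 0) = σ i := by
    intro i
    apply Fin.ext
    rw [← h2]
    exact Nat.mod_eq_of_lt (σ i).2
  rw [e, e]
  refine ⟨σ.injective.ne h.1, h.2.map fun x hx => ?_⟩
  have hle : codeL gold5 ≤ pull σ.symm (codeL gold5) := by
    apply codeL_le
    intro g hgm
    obtain ⟨m, hm⟩ := hg g hgm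
    rw [mem_pull, Equiv.symm_symm, ← h1, hm]
    exact ⟨m, rfl⟩
  exact mem_pull.1 (hle hx)

lemma badP_iter {f : Fin 32 → Fin 32} (hf : ∀ {x y}, BadP x y → BadP (f x) (f y)) (k : ℕ)
    {x y : Fin 32} (h : BadP x y) : BadP (f^[k] x) (f^[k] y) := by
  induction k with
  | zero => exact h
  | succ k ih =>
    rw [Function.iterate_succ_apply', Function.iterate_succ_apply']
    exact hf ih

lemma not_badP (x y : Fin 32) : ¬ BadP x y := by
  intro h
  have hA : ∀ {x y}, BadP x y → BadP (fA x) (fA y) := fun h =>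
    badP_aut autA (by decide +kernel) (fun g hg => (autA_spec g hg).imp fun _ h => h.2) h
  have hS : ∀ {x y}, BadP x y → BadP (fS x) (fS y) := fun h =>
    badP_aut autS (by decide +kernel) (fun g hg => (autS_spec g hg).imp fun _ h => h.2) h
  obtain ⟨j, -, k, -, h0⟩ := reach0 x
  have h1 := badP_iter hS k (badP_iter hA j h)
  rw [h0] at h1
  obtain ⟨i, -, h2⟩ := reach1 _ h1.1.symm
  have h3 := badP_iter hA i h1
  have h4 : fA^[i] 0 = 0 := Function.iterate_fixed (by decide) i
  rw [h2, h4] at h3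
  exact not_bad_01 h3.2

lemma gold_ne (τ : Equiv.Perm (Fin 32)) : codeL gold3 ≠ pull τ (codeL gold5) := by
  intro h
  have h1 : Bad (codeL gold5) (τ 0) (τ 1) :=
    bad_gold3.map fun x hx => by rw [h]; exact comp_mem_pull τ hx
  exact not_badP _ _ ⟨τ.injective.ne (by decide), h1⟩

lemma codeEquiv_iff {C D : Submodule (ZMod 2) (Fin 32 → ZMod 2)}
    (h : CodeEquiv (pull idx C : Set (K5 → ZMod 2)) (pull idx D : Set (K5 → ZMod 2))) :
    ∃ τ : Equiv.Perm (Fin 32), D = pull τ C := by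
  obtain ⟨σ, h⟩ := h
  refine ⟨idx.symm.trans (σ.trans idx), ?_⟩
  have h1 : pull idx D = pull σ (pull idx C) := by
    apply SetLike.coe_injective
    rw [h]
    ext x
    constructor
    · rintro ⟨y, hy, rfl⟩
      exact comp_mem_pull σ hy
    · intro hx
      refine ⟨x ∘ σ.symm, mem_pull.1 hx, ?_⟩
      funext i
      simp
  rw [← pull_pull, ← pull_pull, ← h1, pull_pull]
  ext x
  rw [mem_pull]
  simp only [Equiv.symm_trans_self]
  rfl

lemma not_equiv35 : ¬ CodeEquiv (pull idx (codeL gold5) : Set (K5 → ZMod 2))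
    (pull idx (codeL gold3) : Set (K5 → ZMod 2)) := fun h => by
  obtain ⟨τ, h⟩ := codeEquiv_iff h
  exact gold_ne τ h

lemma not_equiv53 : ¬ CodeEquiv (pull idx (codeL gold3) : Set (K5 → ZMod 2))
    (pull idx (codeL gold5) : Set (K5 → ZMod 2)) := fun h => by
  obtain ⟨τ, h⟩ := codeEquiv_iff h
  apply gold_ne τ.symm
  rw [h, pull_pull]
  ext x
  rw [mem_pull]
  simp only [Equiv.symm_trans_self]
  rfl

/-- up to equivalence there exist exactly 2 maximal `[32,11]`
codes satisfying (C1) and (C2), and every such code has minimum weight 12,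
so `a = 4` and its set of weights is `{0, 12, 16, 20, 32}`. -/
theorem stmt18 :
    ExactlyNClasses 2 (fun C => MaximalSat 5 C ∧ ∃ a, SatCond 5 11 a C) ∧
    ∀ (a : ℕ) (C : Submodule (ZMod 2) ((Fin 5 → ZMod 2) → ZMod 2)),
      SatCond 5 11 a C → MaximalSat 5 C →
      dmin (↑C : Set ((Fin 5 → ZMod 2) → ZMod 2)) = 12 ∧ a = 4 ∧
      {w : ℕ | ∃ x ∈ C, wt x = w} = ({0, 12, 16, 20, 32} : Set ℕ) := by
  refine ⟨⟨![pull idx (codeL gold3), pull idx (codeL gold5)], ?_, ?_, ?_⟩, ?_⟩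
  · intro i
    fin_cases i
    · exact ⟨sat11_max sat_gold3, 4, sat_gold3⟩
    · exact ⟨sat11_max sat_gold5, 4, sat_gold5⟩
  · intro i j hij
    fin_cases i <;> fin_cases j
    · exact absurd rfl hij
    · exact not_equiv53
    · exact not_equiv35
    · exact absurd rfl hij
  · rintro C ⟨-, a, h⟩
    obtain rfl := sat11_a h
    obtain ⟨e, hg | hg⟩ := sat11_gold h
    · exact ⟨0, codeEquiv_pull (finrank_codeL rfl gold3_inj) h.1 hg⟩
    · exact ⟨1, codeEquiv_pull (finrank_codeL rfl gold5_inj) h.1 hg⟩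
  · intro a C h _
    exact ⟨sat11_dmin h, sat11_a h, sat11_weights h⟩
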